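/- Let M ≥ 1 be an integer, α ∈ (1/2,1), θ > 0, and let π : ℝ → ℝ be continuously differentiable with |π′| ≤ 1 everywhere and π(θ) = θ(2−2α+α²)/(α(2−α)); set p := π′(θ), u := π(θ)+θ = 2θ/(α(2−α)), a := π(θ)−θ = 2θ(1−α)²/(α(2−α)), S_v := (2θα/((1−α)(2−α)))^{1/3} and S_h := (2/α)S_v²/(1+p+(1−p)/(1−α)²). Fix τ₁, τ₂, s₁, s₂ ∈ ℝ and, for T > 0, set t_i := uT − τ_i(p+1)T^{2/3}, n_i := M + ⌊aT − τ_i(p−1)T^{2/3}⌋, x_i := ⌊t_i − 2√(t_i(n_i−M)) − s_i T^{1/3}⌋, and Conj_i := e^{α t_i} (α−1)^{n_i−M} α^{−(x_i+n_i−M)}. Then lim_{T→∞} (Conj₂/Conj₁) T^{1/3} K((n₁,t₁),x₁;(n₂,t₂),x₂) = S_v^{−1} K_{DBM→2}(τ₁/S_h, s₁/S_v; τ₂/S_h, s₂/S_v), where K is the TASEP kernel with M slow particles of rate α. -/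

import Mathlib

open Complex Real MeasureTheory Filter
open scoped Classical

noncomputable section

/-! ## The finite-time TASEP kernel with `M` slow particles of rate `α` -/

/-- `φ̂(x₁,x₂)`, contour a circle of radius `r0` around `0` (enclosing exactly `0`). -/
def phiHat (n₁ n₂ : ℤ) (t₁ t₂ : ℝ) (x₁ x₂ : ℤ) (r0 : ℝ) : ℂ :=
  (2 * (π : ℂ) * I)⁻¹ * ∮ w in C((0 : ℂ), r0),
    w⁻¹ * Complex.exp (((t₁ - t₂ : ℝ) : ℂ) * w) * (w * (w - 1)) ^ (n₁ - n₂) *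
      w ^ (-(x₁ + 2 * n₁ - x₂ - 2 * n₂))

/-- Integrand of `K̂^{(1)}`. -/
def K1Int (M n₁ n₂ : ℤ) (t₁ t₂ : ℝ) (x₁ x₂ : ℤ) (v w : ℂ) : ℂ :=
  w⁻¹ * Complex.exp ((t₁ : ℂ) * w) * (w * (w - 1)) ^ (n₁ - M) *
    w ^ (-(x₁ + 2 * n₁ - 2 * M)) *
    (1 + v) ^ (x₂ + 2 * n₂ - 2 * M) * Complex.exp (-((t₂ : ℂ) * (v + 1))) *
    (v * (v + 1)) ^ (-(n₂ - M)) * (1 + 2 * v) / ((w + v) * (w - v - 1))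

/-- `K̂^{(1)}`: the `v`-contour encloses exactly `0`; the `w`-contour encloses
exactly `0` and `-v`. -/
def Khat1 (M n₁ n₂ : ℤ) (t₁ t₂ : ℝ) (x₁ x₂ : ℤ) (rv rw : ℝ) : ℂ :=
  (2 * (π : ℂ) * I)⁻¹ * ∮ v in C((0 : ℂ), rv),
    (2 * (π : ℂ) * I)⁻¹ *
      ((∮ w in C((0 : ℂ), rw), K1Int M n₁ n₂ t₁ t₂ x₁ x₂ v w) +
       (∮ w in C(-v, rw), K1Int M n₁ n₂ t₁ t₂ x₁ x₂ v w))

/-- Integrand of `K̂^{(2)}`. -/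
def K2Int (M : ℤ) (α : ℝ) (n₁ n₂ : ℤ) (t₁ t₂ : ℝ) (x₁ x₂ : ℤ) (v z w : ℂ) : ℂ :=
  w⁻¹ * Complex.exp ((t₁ : ℂ) * w) * (w * (w - 1)) ^ (n₁ - M) *
    (w * (w - (α : ℂ))) ^ M * w ^ (-(x₁ + 2 * n₁ - 2 * M)) *
    (1 + z) ^ (x₂ + 2 * n₂ - 2 * M) * Complex.exp (-((t₂ : ℂ) * (z + 1))) *
    (z * (z + 1)) ^ (-(n₂ - M)) * ((v + 1) * (v + 1 - (α : ℂ))) ^ (-M) *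
    ((1 + 2 * z) * (2 * v + 2 - (α : ℂ))) /
    ((z - v) * (z + v + 1) * (w - 1 - v) * (w + 1 - (α : ℂ) + v))

/-- `K̂^{(2)}`: the `v`-contour encloses exactly `α-1`; the `z`-contour encloses exactly
`0` and `v`; the `w`-contour encloses exactly `0` and `α-1-v`. -/
def Khat2 (M : ℤ) (α : ℝ) (n₁ n₂ : ℤ) (t₁ t₂ : ℝ) (x₁ x₂ : ℤ) (rv rz rw : ℝ) : ℂ :=
  (2 * (π : ℂ) * I)⁻¹ * ∮ v in C((α : ℂ) - 1, rv),
    (2 * (π : ℂ) * I)⁻¹ *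
      ((∮ z in C((0 : ℂ), rz), (2 * (π : ℂ) * I)⁻¹ *
          ((∮ w in C((0 : ℂ), rw), K2Int M α n₁ n₂ t₁ t₂ x₁ x₂ v z w) +
           (∮ w in C((α : ℂ) - 1 - v, rw), K2Int M α n₁ n₂ t₁ t₂ x₁ x₂ v z w))) +
       (∮ z in C(v, rz), (2 * (π : ℂ) * I)⁻¹ *
          ((∮ w in C((0 : ℂ), rw), K2Int M α n₁ n₂ t₁ t₂ x₁ x₂ v z w) +
           (∮ w in C((α : ℂ) - 1 - v, rw), K2Int M α n₁ n₂ t₁ t₂ x₁ x₂ v z w))))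

/-- The TASEP kernel with `M` slow particles of rate `α`:
`K = -𝟙·φ̂ + K̂^{(1)} + K̂^{(2)}`. -/
def Kker (M : ℤ) (α : ℝ) (n₁ n₂ : ℤ) (t₁ t₂ : ℝ) (x₁ x₂ : ℤ)
    (r0 rv1 rw1 rv2 rz2 rw2 : ℝ) : ℂ :=
  -(if n₁ ≤ n₂ ∧ t₂ ≤ t₁ ∧ ¬(n₁ = n₂ ∧ t₁ = t₂) then (1 : ℂ) else 0) *
      phiHat n₁ n₂ t₁ t₂ x₁ x₂ r0 +
    Khat1 M n₁ n₂ t₁ t₂ x₁ x₂ rv1 rw1 + Khat2 M α n₁ n₂ t₁ t₂ x₁ x₂ rv2 rz2 rw2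

/-! ## Wedge contours and the limiting kernel `K_{DBM→2}` -/

/-- Integral over the right-wedge contour anchored at `a`,
from `e^{iπ/3}∞` to `e^{-iπ/3}∞`. -/
def wedgeR (a : ℝ) (f : ℂ → ℂ) : ℂ :=
  -(Complex.exp ((π : ℂ) * I / 3) *
      ∫ s in Set.Ioi (0 : ℝ), f ((a : ℂ) + Complex.exp ((π : ℂ) * I / 3) * (s : ℂ))) +
    Complex.exp (-(π : ℂ) * I / 3) *
      ∫ s in Set.Ioi (0 : ℝ), f ((a : ℂ) + Complex.exp (-(π : ℂ) * I / 3) * (s : ℂ))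

/-- Integral over the left-wedge contour anchored at `a`,
from `e^{-2iπ/3}∞` to `e^{2iπ/3}∞`. -/
def wedgeL (a : ℝ) (f : ℂ → ℂ) : ℂ :=
  -(Complex.exp (-2 * (π : ℂ) * I / 3) *
      ∫ s in Set.Ioi (0 : ℝ), f ((a : ℂ) + Complex.exp (-2 * (π : ℂ) * I / 3) * (s : ℂ))) +
    Complex.exp (2 * (π : ℂ) * I / 3) *
      ∫ s in Set.Ioi (0 : ℝ), f ((a : ℂ) + Complex.exp (2 * (π : ℂ) * I / 3) * (s : ℂ))

/-- The kernel `K_{DBM→2}`, with `γ₂` a right-wedge contour anchored at `a2` and `γ₁`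
a left-wedge contour anchored at `a1`, `a1 < a2 < 0`. -/
def KDBM2 (M : ℕ) (τ₁ s₁ τ₂ s₂ : ℝ) (a1 a2 : ℝ) : ℂ :=
  -(if τ₁ < τ₂ then
      (((Real.sqrt (4 * π * (τ₂ - τ₁)))⁻¹ *
        Real.exp (-((s₂ - τ₂ ^ 2) - (s₁ - τ₁ ^ 2)) ^ 2 / (4 * (τ₂ - τ₁))) : ℝ) : ℂ)
    else 0) +
  ((2 * (π : ℂ) * I)⁻¹) ^ 2 * wedgeR a2 (fun w₂ => wedgeL a1 (fun w₁ =>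
    Complex.exp ((w₂ ^ 3 / 3 + (τ₂ : ℂ) * w₂ ^ 2 - ((s₂ - τ₂ ^ 2 : ℝ) : ℂ) * w₂) -
        (w₁ ^ 3 / 3 + (τ₁ : ℂ) * w₁ ^ 2 - ((s₁ - τ₁ ^ 2 : ℝ) : ℂ) * w₁)) *
      (w₁ / w₂) ^ M * (w₁ - w₂)⁻¹))

/-! ## The scaling along the curve `n = (1-α)² t` -/

/-- Times `t_i = uT - τ(p+1)T^{2/3}`. -/
def tT (u τ p : ℝ) (T : ℝ) : ℝ := u * T - τ * (p + 1) * T ^ ((2 : ℝ) / 3)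

/-- Particle indices `n_i = M + ⌊aT - τ(p-1)T^{2/3}⌋`. -/
def nT (M : ℕ) (a τ p : ℝ) (T : ℝ) : ℤ :=
  (M : ℤ) + ⌊a * T - τ * (p - 1) * T ^ ((2 : ℝ) / 3)⌋

/-- Positions `x_i = ⌊t_i - 2√(t_i(n_i - M)) - s_i T^{1/3}⌋`. -/
def xT (M : ℕ) (u a τ p s : ℝ) (T : ℝ) : ℤ :=
  ⌊tT u τ p T - 2 * Real.sqrt (tT u τ p T * ((nT M a τ p T - M : ℤ) : ℝ)) -
    s * T ^ ((1 : ℝ) / 3)⌋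

/-- The conjugation factor `Conj = e^{αt} (α-1)^{n-M} α^{-(x+n-M)}`. -/
def conjT (M : ℕ) (α u a τ p s : ℝ) (T : ℝ) : ℝ :=
  Real.exp (α * tT u τ p T) * (α - 1) ^ (nT M a τ p T - M) *
    α ^ (-(xT M u a τ p s T + nT M a τ p T - M))

/-! ## Contour lemmas -/

theorem circ_annulus {f : ℂ → ℂ} {c : ℂ} {ρ r R : ℝ} (hr : 0 < r) (hR : 0 < R) (hrρ : r < ρ)
    (hRρ : R < ρ) (hf : ∀ z, 0 < ‖z - c‖ → ‖z - c‖ < ρ → DifferentiableAt ℂ f z) :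
    (∮ z in C(c, R), f z) = ∮ z in C(c, r), f z := by
  have key : ∀ r R : ℝ, 0 < r → r ≤ R → R < ρ →
      (∮ z in C(c, R), f z) = ∮ z in C(c, r), f z := by
    intro r R hr hle hR
    apply Complex.circleIntegral_eq_of_differentiable_on_annulus_off_countable hr hle
      (s := ∅) Set.countable_empty
    · intro z hz
      simp only [Set.mem_sdiff, Metric.mem_closedBall, Metric.mem_ball, dist_eq_norm, not_lt] at hz
      exact (hf z (by linarith) (by linarith)).continuousAt.continuousWithinAt
    · intro z hz
      simp only [Set.mem_sdiff, Metric.mem_closedBall, Metric.mem_ball, dist_eq_norm, not_le] at hz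
      exact hf z (by linarith) (by linarith)
  rcases le_total r R with h | h
  · exact key r R hr h hRρ
  · exact (key R r hR h hrρ).symm

theorem circ_zero {f : ℂ → ℂ} {c : ℂ} {r : ℝ} (hr : 0 ≤ r)
    (hf : ∀ z, ‖z - c‖ ≤ r → DifferentiableAt ℂ f z) :
    (∮ z in C(c, r), f z) = 0 := by
  apply Complex.circleIntegral_eq_zero_of_differentiable_on_off_countable hr
    (s := ∅) Set.countable_empty
  · intro z hz
    exact (hf z (by simpa [dist_eq_norm] using hz)).continuousAt.continuousWithinAt
  · intro z hz
    exact hf z (by have := hz.1; rw [Metric.mem_ball, dist_eq_norm] at this; exact this.le)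

theorem circ_cauchy {f : ℂ → ℂ} {c : ℂ} {r : ℝ} (hr : 0 < r)
    (hf : ∀ z, ‖z - c‖ ≤ r → DifferentiableAt ℂ f z) :
    (∮ z in C(c, r), f z / (z - c)) = 2 * (π : ℂ) * I * f c := by
  have hd : DifferentiableOn ℂ f (Metric.closedBall c r) := fun z hz =>
    (hf z (by simpa [dist_eq_norm] using hz)).differentiableWithinAt
  have h := hd.circleIntegral_sub_inv_smul (w := c) (Metric.mem_ball_self hr)
  rw [smul_eq_mul] at h
  rw [← h]
  congr 1
  ext z
  rw [smul_eq_mul, div_eq_inv_mul]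

theorem circ_integrable {f : ℂ → ℂ} {c : ℂ} {r : ℝ} (hr : 0 ≤ r)
    (hf : ∀ z, ‖z - c‖ = r → DifferentiableAt ℂ f z) : CircleIntegrable f c r :=
  ContinuousOn.circleIntegrable hr (fun z hz =>
    (hf z (by simpa [dist_eq_norm] using hz)).continuousAt.continuousWithinAt)

/-- Two small circles around `0` and `c` are equivalent to one big circle around `0`. -/
theorem circ_two {G : ℂ → ℂ} {c : ℂ} {ρ r r' R : ℝ} (hr : 0 < r) (hrc : r < ‖c‖)
    (hr' : 0 < r') (hrc' : r' < ‖c‖) (hr'ρ : ‖c‖ + r' < ρ)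
    (hcR : ‖c‖ < R) (hRρ : R < ρ)
    (hG : ∀ z, 0 < ‖z‖ → ‖z‖ < ρ → DifferentiableAt ℂ G z) :
    (∮ z in C(0, r), G z / (z - c)) + (∮ z in C(c, r'), G z / (z - c)) =
      ∮ z in C(0, R), G z / (z - c) := by
  have hc0 : 0 < ‖c‖ := by linarith
  rw [circ_cauchy hr' (f := G)]
  swap
  · intro z hz
    apply hG
    · have := norm_sub_norm_le c (c - z)
      rw [← norm_neg (z - c), neg_sub] at hz
      simp only [sub_sub_cancel] at this
      linarith
    · have := norm_add_le c (z - c)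
      simp only [add_sub_cancel] at this
      linarith
  have hU : IsOpen {z : ℂ | 0 < ‖z‖ ∧ ‖z‖ < ρ} :=
    (isOpen_lt continuous_const continuous_norm).inter (isOpen_lt continuous_norm continuous_const)
  have hds : DifferentiableOn ℂ (dslope G c) {z : ℂ | 0 < ‖z‖ ∧ ‖z‖ < ρ} := by
    rw [Complex.differentiableOn_dslope]
    · exact fun z hz => (hG z hz.1 hz.2).differentiableWithinAt
    · exact hU.mem_nhds ⟨hc0, by linarith⟩
  have hds' : ∀ z, 0 < ‖z‖ → ‖z‖ < ρ → DifferentiableAt ℂ (dslope G c) z := fun z h1 h2 =>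
    hds.differentiableAt (hU.mem_nhds ⟨h1, h2⟩)
  have hann := circ_annulus (f := dslope G c) (c := 0) hr (by linarith : 0 < R) (by linarith)
    hRρ (by simpa using hds')
  have split : ∀ s : ℝ, 0 < s → s < ρ → s ≠ ‖c‖ →
      (∮ z in C(0, s), G z / (z - c)) = (∮ z in C(0, s), dslope G c z) +
        G c * ∮ z in C(0, s), (z - c)⁻¹ := by
    intro s hs hsρ hsc
    have hne : ∀ z : ℂ, ‖z - 0‖ = s → z - c ≠ 0 := by
      intro z hz h
      rw [sub_eq_zero] at h
      subst h
      simp at hz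
      exact hsc hz.symm
    rw [← circleIntegral.integral_const_mul, ← circleIntegral.integral_add]
    · apply circleIntegral.integral_congr hs.le
      intro z hz
      have hz' : ‖z - 0‖ = s := by simpa using hz
      have h1 : z ≠ c := sub_ne_zero.1 (hne z hz')
      simp only [dslope_of_ne _ h1, slope_def_field]
      field_simp [hne z hz']
      ring
    · exact circ_integrable hs.le (fun z hz => hds' z (by simp at hz; linarith)
        (by simp at hz; linarith))
    · apply circ_integrable hs.le
      intro z hz
      exact (((differentiableAt_id).sub_const c).inv (hne z hz)).const_mul _
  rw [split r hr (by linarith) hrc.ne, split R (by linarith) hRρ hcR.ne', hann,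
    circleIntegral.integral_sub_inv_of_mem_ball (c := 0) (w := c) (R := R) (by simpa using hcR)]
  have h0 : (∮ z in C(0, r), (z - c)⁻¹) = 0 := by
    apply circ_zero hr.le
    intro z hz
    apply ((differentiableAt_id).sub_const c).inv
    intro h
    have : z = c := sub_eq_zero.1 h
    subst this
    simp at hz
    linarith
  rw [h0]
  ring

theorem circ_param_diff {G : ℂ → ℂ} {c₀ c : ℂ} {R : ℝ} (hR : 0 ≤ R)
    (hG : ContinuousOn G (Metric.sphere c₀ R)) (hc : ‖c - c₀‖ ≠ R) :
    DifferentiableAt ℂ (fun c => ∮ w in C(c₀, R), G w / (w - c)) c := by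
  set d : ℝ := |‖c - c₀‖ - R| with hd
  have hd0 : 0 < d := abs_pos.2 (sub_ne_zero.2 hc)
  have hfar : ∀ c' ∈ Metric.ball c (d / 2), ∀ θ : ℝ, d / 2 ≤ ‖circleMap c₀ R θ - c'‖ := by
    intro c' hc' θ
    rw [Metric.mem_ball, dist_eq_norm] at hc'
    have h1 : ‖circleMap c₀ R θ - c₀‖ = R := by
      simp [circleMap_sub_center, abs_of_nonneg hR]
    have h2 : d ≤ ‖(c - c₀) - (circleMap c₀ R θ - c₀)‖ := by
      have := abs_norm_sub_norm_le (c - c₀) (circleMap c₀ R θ - c₀)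
      rwa [h1] at this
    have h3 : ‖(c - c₀) - (circleMap c₀ R θ - c₀)‖ ≤ ‖circleMap c₀ R θ - c'‖ + ‖c' - c‖ := by
      have : (c - c₀) - (circleMap c₀ R θ - c₀) =
        -((circleMap c₀ R θ - c') + (c' - c)) := by ring
      rw [this, norm_neg]
      exact norm_add_le _ _
    linarith
  have hGc : Continuous (fun θ => G (circleMap c₀ R θ)) :=
    hG.comp_continuous (continuous_circleMap _ _) (fun θ => circleMap_mem_sphere _ hR θ)
  obtain ⟨C, hC⟩ := (isCompact_sphere c₀ R).exists_bound_of_continuousOn hG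
  have hcont : ∀ c' ∈ Metric.ball c (d / 2), Continuous fun θ : ℝ =>
      deriv (circleMap c₀ R) θ • (G (circleMap c₀ R θ) / (circleMap c₀ R θ - c')) := by
    intro c' hc'
    simp only [deriv_circleMap]
    refine Continuous.smul ((continuous_circleMap _ _).mul continuous_const)
      (hGc.div ?_ ?_)
    · fun_prop
    intro θ h
    have := hfar c' hc' θ
    rw [h, norm_zero] at this
    linarith
  have hcont2 : ∀ c' ∈ Metric.ball c (d / 2), Continuous fun θ : ℝ =>
      deriv (circleMap c₀ R) θ • (G (circleMap c₀ R θ) / (circleMap c₀ R θ - c') ^ 2) := by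
    intro c' hc'
    simp only [deriv_circleMap]
    refine Continuous.smul ((continuous_circleMap _ _).mul continuous_const)
      (hGc.div ?_ ?_)
    · fun_prop
    intro θ h
    have := hfar c' hc' θ
    rw [pow_eq_zero_iff (by norm_num)] at h
    rw [h, norm_zero] at this
    linarith
  have hball : Metric.ball c (d / 2) ∈ nhds c := Metric.ball_mem_nhds _ (by linarith)
  have hcm : c ∈ Metric.ball c (d / 2) := Metric.mem_ball_self (by linarith)
  have := intervalIntegral.hasDerivAt_integral_of_dominated_loc_of_deriv_le (μ := volume)
    (a := 0) (b := 2 * π) (s := Metric.ball c (d / 2)) (x₀ := c)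
    (F := fun c' θ => deriv (circleMap c₀ R) θ • (G (circleMap c₀ R θ) / (circleMap c₀ R θ - c')))
    (F' := fun c' θ =>
      deriv (circleMap c₀ R) θ • (G (circleMap c₀ R θ) / (circleMap c₀ R θ - c') ^ 2))
    (bound := fun _ => R * (C / (d / 2) ^ 2)) hball
    (by filter_upwards [hball] with c' hc'
        exact (hcont c' hc').aestronglyMeasurable)
    ((hcont c hcm).intervalIntegrable _ _)
    ((hcont2 c hcm).aestronglyMeasurable)
    (by
      refine Eventually.of_forall fun θ _ c' hc' => ?_
      rw [norm_smul, norm_div, norm_pow]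
      have h1 : ‖deriv (circleMap c₀ R) θ‖ = R := by simp [deriv_circleMap, abs_of_nonneg hR]
      rw [h1]
      have h2 := hC (circleMap c₀ R θ) (circleMap_mem_sphere _ hR θ)
      have h3 := hfar c' hc' θ
      have h4 : 0 ≤ C := le_trans (norm_nonneg _) h2
      gcongr)
    (by simp)
    (by
      refine Eventually.of_forall fun θ _ c' hc' => ?_
      have hne : circleMap c₀ R θ - c' ≠ 0 := by
        intro h
        have := hfar c' hc' θ
        rw [h, norm_zero] at this
        linarith
      apply HasDerivAt.fun_const_smul
      have h1 : HasDerivAt (fun x => circleMap c₀ R θ - x) (-1) c' := by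
        simpa using (hasDerivAt_id c').const_sub (circleMap c₀ R θ)
      have h2 := (h1.inv hne).const_mul (G (circleMap c₀ R θ))
      refine HasDerivAt.congr_deriv (f' := G (circleMap c₀ R θ) *
        (- -1 / (circleMap c₀ R θ - c') ^ 2)) ?_ ?_
      · exact h2
      · rw [neg_neg, mul_one_div])
  exact this.2.differentiableAt

theorem circ_swap {f : ℂ → ℂ → ℂ} {a b : ℂ} {r s : ℝ} (hr : 0 ≤ r) (hs : 0 ≤ s)
    (hf : ContinuousOn (fun p : ℂ × ℂ => f p.1 p.2) (Metric.sphere a r ×ˢ Metric.sphere b s)) :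
    (∮ x in C(a, r), ∮ y in C(b, s), f x y) = ∮ y in C(b, s), ∮ x in C(a, r), f x y := by
  have hc : Continuous (fun p : ℝ × ℝ => f (circleMap a r p.1) (circleMap b s p.2)) :=
    hf.comp_continuous (f := fun p : ℝ × ℝ => (circleMap a r p.1, circleMap b s p.2))
      (by fun_prop) (fun p => ⟨circleMap_mem_sphere _ hr _, circleMap_mem_sphere _ hs _⟩)
  unfold circleIntegral
  have h1 : ∀ x y : ℝ, deriv (circleMap a r) x • deriv (circleMap b s) y •
      f (circleMap a r x) (circleMap b s y) = deriv (circleMap b s) y • deriv (circleMap a r) x •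
      f (circleMap a r x) (circleMap b s y) := fun x y => smul_comm _ _ _
  simp_rw [← intervalIntegral.integral_smul, h1]
  rw [intervalIntegral_intervalIntegral_swap]
  apply ContinuousOn.integrableOn_of_subset_isCompact (K := Set.uIcc 0 (2 * π) ×ˢ Set.uIcc 0 (2 * π))
  · simp only [deriv_circleMap]
    apply Continuous.continuousOn
    simp only [Function.uncurry_def]
    refine Continuous.smul (((continuous_circleMap _ _).comp continuous_snd).mul continuous_const)
      (Continuous.smul (((continuous_circleMap _ _).comp continuous_fst).mul continuous_const) hc)
  · exact isCompact_uIcc.prod isCompact_uIcc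
  · exact measurableSet_uIoc.prod measurableSet_uIoc
  · exact Set.prod_mono Set.uIoc_subset_uIcc Set.uIoc_subset_uIcc
  · exact ((measure_mono (Set.prod_mono Set.uIoc_subset_uIcc Set.uIoc_subset_uIcc)).trans_lt
      (isCompact_uIcc.prod isCompact_uIcc).measure_lt_top).ne

theorem K1_exact {A B : ℂ → ℂ} (hA : ∀ w, 0 < ‖w‖ → ‖w‖ < 1 → DifferentiableAt ℂ A w)
    (hB : ∀ w, 0 < ‖w‖ → ‖w‖ < 1 → DifferentiableAt ℂ B w)
    {rv rw r1 r2 : ℝ} (hrw : 0 < rw) (hrwv : rw < rv) (h1 : rv < r1) (h2 : rv < 1 - r1)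
    (h3 : 3 * rv < 1) (hr2 : 0 < r2) (h4 : r2 < r1) (h5 : r1 + r2 < 1) :
    (∮ v in C((0 : ℂ), rv), ((∮ w in C((0 : ℂ), rw), A w * B v * ((1 + 2 * v) / ((w + v) * (w - v - 1)))) +
      (∮ w in C(-v, rw), A w * B v * ((1 + 2 * v) / ((w + v) * (w - v - 1)))))) =
    ∮ w in C((0 : ℂ), r1), ∮ v in C((0 : ℂ), r2),
      A w * B v * ((1 + 2 * v) / ((w + v) * (w - v - 1))) := by
  have hrv : 0 < rv := by linarith
  have e1 : (∮ v in C((0 : ℂ), rv), ((∮ w in C((0 : ℂ), rw), A w * B v * ((1 + 2 * v) / ((w + v) * (w - v - 1)))) +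
      (∮ w in C(-v, rw), A w * B v * ((1 + 2 * v) / ((w + v) * (w - v - 1)))))) =
    ∮ v in C((0 : ℂ), rv), ∮ w in C((0 : ℂ), r1),
      A w * B v * ((1 + 2 * v) / ((w + v) * (w - v - 1))) := by
    apply circleIntegral.integral_congr hrv.le
    intro v hv
    have hv' : ‖v‖ = rv := by simpa using hv
    have := circ_two (G := fun w => A w * B v * ((1 + 2 * v) / (w - v - 1))) (c := -v) (ρ := 1 - rv)
      (r := rw) (r' := rw) (R := r1) hrw (by rw [norm_neg]; linarith) hrw
      (by rw [norm_neg]; linarith) (by rw [norm_neg]; linarith) (by rw [norm_neg]; linarith)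
      (by linarith) ?_
    · have e : ∀ w : ℂ, A w * B v * ((1 + 2 * v) / (w - v - 1)) / (w - -v) =
          A w * B v * ((1 + 2 * v) / ((w + v) * (w - v - 1))) := by
        intro w
        rw [sub_neg_eq_add, mul_div_assoc, div_div, mul_comm (w - v - 1)]
      simp only [e] at this
      exact this
    · intro z hz0 hz1
      refine ((hA z hz0 (by linarith)).mul_const _).mul ?_
      refine DifferentiableAt.div (by fun_prop) (by fun_prop) ?_
      intro h
      have : (1 : ℂ) = z - v := by linear_combination -h
      have h' : ‖(1 : ℂ)‖ ≤ ‖z‖ + ‖v‖ := by rw [this]; exact norm_sub_le _ _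
      simp at h'
      linarith
  have ne1 : ∀ v w : ℂ, ‖v‖ < r1 → ‖w‖ = r1 → w + v ≠ 0 := by
    intro v w hv hw h
    have : w = -v := by linear_combination h
    rw [this, norm_neg] at hw
    linarith
  have ne2 : ∀ v w : ℂ, ‖v‖ < 1 - r1 → ‖w‖ = r1 → w - v - 1 ≠ 0 := by
    intro v w hv hw h
    have : (1 : ℂ) = w - v := by linear_combination -h
    have h' : ‖(1 : ℂ)‖ ≤ ‖w‖ + ‖v‖ := by rw [this]; exact norm_sub_le _ _
    simp at h'
    linarith
  rw [e1, circ_swap hrv.le (by linarith)]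
  · apply circleIntegral.integral_congr (by linarith)
    intro w hw
    have hw' : ‖w‖ = r1 := by simpa using hw
    apply circ_annulus (ρ := min r1 (1 - r1)) hr2 hrv (lt_min h4 (by linarith)) (lt_min h1 h2)
    intro v hv0 hv1
    rw [sub_zero] at hv0 hv1
    have hv2 := hv1.trans_le (min_le_left _ _)
    have hv3 := hv1.trans_le (min_le_right _ _)
    refine ((hB v hv0 (by linarith)).const_mul _).mul ?_
    exact DifferentiableAt.div (by fun_prop) (by fun_prop)
      (mul_ne_zero (ne1 v w hv2 hw') (ne2 v w hv3 hw'))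
  · have hAc : ContinuousOn A (Metric.sphere 0 r1) := fun w hw =>
      (hA w (by simp at hw; linarith) (by simp at hw; linarith)).continuousAt.continuousWithinAt
    have hBc : ContinuousOn B (Metric.sphere 0 rv) := fun w hw =>
      (hB w (by simp at hw; linarith) (by simp at hw; linarith)).continuousAt.continuousWithinAt
    refine ((hAc.comp continuousOn_snd (fun p hp => hp.2)).mul
      (hBc.comp continuousOn_fst (fun p hp => hp.1))).mul ?_
    refine ContinuousOn.div (by fun_prop) (by fun_prop) ?_
    rintro ⟨v, w⟩ ⟨hv, hw⟩
    have hv' : ‖v‖ = rv := by simpa using hv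
    have hw' : ‖w‖ = r1 := by simpa using hw
    exact mul_ne_zero (ne1 v w (by linarith) hw') (ne2 v w (by linarith) hw')

/-- `q_j` -/
def qj (α : ℝ) (j : ℕ) (v : ℂ) : ℂ :=
  (2 * v + 2 - (α : ℂ)) / ((v + 1) * (v + 1 - (α : ℂ))) ^ (j + 1)

/-- remainder kernel -/
def remj (α : ℝ) (j : ℕ) (rv : ℝ) (z : ℂ) : ℂ :=
  ∮ v in C((α : ℂ) - 1, rv), qj α j v * ((z + v + 1)⁻¹ - (z + v + 2 - (α : ℂ))⁻¹)

theorem geom_id (x y : ℂ) (hy : y ≠ 0) (hxy : x - y ≠ 0) (M : ℕ) :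
    x ^ M * (y ^ M)⁻¹ * (x - y)⁻¹ = (x - y)⁻¹ + ∑ j ∈ Finset.range M, x ^ j / y ^ (j + 1) := by
  induction M with
  | zero => simp
  | succ n ih =>
    rw [Finset.sum_range_succ, ← add_assoc, ← ih]
    field_simp
    ring

theorem geom_id2 (x y : ℂ) (hy : y ≠ 0) (hx : x ≠ 0) (hxy : x - y ≠ 0) (j : ℕ) :
    (y ^ (j + 1))⁻¹ * (x - y)⁻¹ = (x ^ (j + 1))⁻¹ * (x - y)⁻¹ +
      ∑ i ∈ Finset.range (j + 1), (y ^ (i + 1))⁻¹ * (x ^ (j - i + 1))⁻¹ := by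
  have h := geom_id x y hy hxy (j + 1)
  have hx' : x ^ (j + 1) ≠ 0 := pow_ne_zero _ hx
  have h2 : (y ^ (j + 1))⁻¹ * (x - y)⁻¹ =
      (x ^ (j + 1))⁻¹ * (x ^ (j + 1) * (y ^ (j + 1))⁻¹ * (x - y)⁻¹) := by
    field_simp
  rw [h2, h, mul_add, Finset.mul_sum]
  congr 1
  apply Finset.sum_congr rfl
  intro i hi
  have hij : i ≤ j := by simpa [Nat.lt_succ_iff] using hi
  have : x ^ (j + 1) = x ^ i * x ^ (j - i + 1) := by
    rw [← pow_add]; congr 1; omega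
  rw [this]
  have hxi : x ^ i ≠ 0 := pow_ne_zero _ hx
  field_simp

/-- positions of points near `α - 1` -/
theorem near_facts {α : ℝ} (hα0 : 1 / 2 < α) (hα1 : α < 1) {v : ℂ} {s : ℝ}
    (hv : ‖v - ((α : ℂ) - 1)‖ ≤ s) : α - s ≤ ‖v + 1‖ ∧ ‖v + 1‖ ≤ α + s ∧ 1 - α - s ≤ ‖v‖ ∧
      ‖v‖ ≤ 1 - α + s ∧ 2 * α - 1 - 2 * s ≤ ‖2 * v + 1‖ ∧ ‖v + 1 - α‖ ≤ s := by
  have nα : ‖(α : ℂ)‖ = α := by simp [abs_of_pos (by linarith : 0 < α)]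
  have nα1 : ‖(α : ℂ) - 1‖ = 1 - α := by
    rw [← Complex.ofReal_one, ← Complex.ofReal_sub, Complex.norm_real, Real.norm_eq_abs,
      abs_of_neg (by linarith)]; ring
  have nα2 : ‖2 * (α : ℂ) - 1‖ = 2 * α - 1 := by
    have : 2 * (α : ℂ) - 1 = ((2 * α - 1 : ℝ) : ℂ) := by push_cast; ring
    rw [this, Complex.norm_real, Real.norm_eq_abs, abs_of_pos (by linarith)]
  refine ⟨?_, ?_, ?_, ?_, ?_, ?_⟩
  · have : (α : ℂ) = (v + 1) - (v - (α - 1)) := by ring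
    have h := norm_sub_le (v + 1) (v - (α - 1))
    rw [← this, nα] at h
    linarith
  · have : v + 1 = (α : ℂ) + (v - (α - 1)) := by ring
    rw [this]
    have h := norm_add_le (α : ℂ) (v - (α - 1))
    linarith
  · have : (α : ℂ) - 1 = v - (v - (α - 1)) := by ring
    have h := norm_sub_le v (v - (α - 1))
    rw [← this, nα1] at h
    linarith
  · have : v = ((α : ℂ) - 1) + (v - (α - 1)) := by ring
    rw [this]
    have h := norm_add_le ((α : ℂ) - 1) (v - (α - 1))
    linarith
  · have : 2 * (α : ℂ) - 1 = (2 * v + 1) - 2 * (v - (α - 1)) := by ring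
    have h := norm_sub_le (2 * v + 1) (2 * (v - (α - 1)))
    rw [← this, nα2, norm_mul] at h
    norm_num at h
    linarith
  · have : v + 1 - (α : ℂ) = v - (α - 1) := by ring
    rw [this]; exact hv

theorem qj_diff {α : ℝ} (j : ℕ) {v : ℂ} (h1 : v + 1 ≠ 0) (h2 : v + 1 - (α : ℂ) ≠ 0) :
    DifferentiableAt ℂ (qj α j) v := by
  unfold qj
  exact DifferentiableAt.div (by fun_prop) (by fun_prop) (pow_ne_zero _ (mul_ne_zero h1 h2))

theorem qj_integral {α : ℝ} (hα0 : 1 / 2 < α) (hα1 : α < 1) {rv : ℝ} (hrv : 0 < rv)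
    (hε1 : rv < (1 - α) / 4) (i : ℕ) :
    (∮ v in C((α : ℂ) - 1, rv), qj α i v) = if i = 0 then 2 * (π : ℂ) * I else 0 := by
  have hne : ∀ v : ℂ, ‖v - ((α : ℂ) - 1)‖ = rv → v + 1 ≠ 0 ∧ v + 1 - (α : ℂ) ≠ 0 := by
    intro v hv
    constructor
    · intro h
      have := (near_facts hα0 hα1 hv.le).1
      rw [h, norm_zero] at this
      linarith
    · intro h
      have : v - ((α : ℂ) - 1) = 0 := by linear_combination h
      rw [this, norm_zero] at hv
      linarith
  rcases i with _ | i
  · simp only [if_true]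
    have e : (∮ v in C((α : ℂ) - 1, rv), qj α 0 v) =
        ∮ v in C((α : ℂ) - 1, rv), ((2 * v + 2 - (α : ℂ)) / (v + 1)) / (v - ((α : ℂ) - 1)) := by
      apply circleIntegral.integral_congr hrv.le
      intro v hv
      simp only [qj, zero_add, pow_one]
      rw [div_div]
      congr 2
      ring
    rw [e, circ_cauchy hrv]
    · have : (α : ℂ) ≠ 0 := by
        simp; linarith
      have e2 : (2 * ((α : ℂ) - 1) + 2 - (α : ℂ)) / ((α : ℂ) - 1 + 1) = 1 := by
        rw [div_eq_one_iff_eq]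
        · ring
        · simpa using this
      rw [e2, mul_one]
    · intro z hz
      refine DifferentiableAt.div (by fun_prop) (by fun_prop) ?_
      intro h
      have := (near_facts hα0 hα1 hz).1
      rw [h, norm_zero] at this
      linarith
  · simp only [Nat.add_eq_zero_iff, one_ne_zero, and_false, if_false]
    apply circleIntegral.integral_eq_zero_of_hasDerivWithinAt (f := fun v : ℂ =>
      -((i : ℂ) + 1)⁻¹ * (((v + 1) * (v + 1 - (α : ℂ))) ^ (i + 1))⁻¹) hrv.le
    intro v hv
    have hv' : ‖v - ((α : ℂ) - 1)‖ = rv := by simpa [dist_eq_norm] using hv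
    obtain ⟨h1, h2⟩ := hne v hv'
    have hg : HasDerivAt (fun v : ℂ => (v + 1) * (v + 1 - (α : ℂ))) (2 * v + 2 - (α : ℂ)) v := by
      have := ((hasDerivAt_id v).add_const 1).mul (((hasDerivAt_id v).add_const 1).sub_const (α : ℂ))
      refine HasDerivAt.congr_deriv (f' := 1 * (v + 1 - (α : ℂ)) + (v + 1) * 1) ?_ (by ring)
      exact this
    have hp := ((hg.pow (i + 1)).inv (pow_ne_zero _ (mul_ne_zero h1 h2))).const_mul
      (-((i : ℂ) + 1)⁻¹)
    refine HasDerivAt.hasDerivWithinAt ?_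
    refine HasDerivAt.congr_deriv hp ?_
    have hi : ((i : ℂ) + 1) ≠ 0 := by exact_mod_cast Nat.succ_ne_zero i
    have hgne := mul_ne_zero h1 h2
    set g := (v + 1) * (v + 1 - (α : ℂ)) with hgdef
    simp only [qj, Pi.pow_apply, ← hgdef]
    push_cast
    have hg2 : g ^ (i + 1) ≠ 0 := pow_ne_zero _ hgne
    try simp only [add_tsub_cancel_right]
    field_simp
    ring

theorem qj_kernel {α : ℝ} (hα0 : 1 / 2 < α) (hα1 : α < 1) {rv : ℝ} (hrv : 0 < rv)
    (hε1 : rv < (1 - α) / 4) (hε2 : rv < (2 * α - 1) / 4) (j : ℕ) {z : ℂ} (hz : ‖z‖ < rv) :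
    (∮ v in C((α : ℂ) - 1, rv), qj α j v * ((z - v)⁻¹ + (z + v + 1)⁻¹)) =
      2 * (π : ℂ) * I * qj α j z + remj α j rv z := by
  have hα0' : (0:ℝ) < α := by linarith
  -- nonvanishing facts
  have f1 : ∀ v : ℂ, ‖v - ((α : ℂ) - 1)‖ ≤ rv → v + 1 ≠ 0 := by
    intro v hv h
    have := (near_facts hα0 hα1 hv).1
    rw [h, norm_zero] at this
    linarith
  have f2 : ∀ v : ℂ, ‖v - ((α : ℂ) - 1)‖ = rv → v + 1 - (α : ℂ) ≠ 0 := by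
    intro v hv h
    have : v - ((α : ℂ) - 1) = 0 := by linear_combination h
    rw [this, norm_zero] at hv
    linarith
  have f3 : ∀ v : ℂ, ‖v - ((α : ℂ) - 1)‖ ≤ rv → z - v ≠ 0 := by
    intro v hv h
    have h1 := (near_facts hα0 hα1 hv).2.2.1
    have : z = v := by linear_combination h
    rw [this] at hz
    linarith
  have f4 : ∀ v : ℂ, ‖v - ((α : ℂ) - 1)‖ ≤ rv → z + v + 1 ≠ 0 := by
    intro v hv h
    have h1 := (near_facts hα0 hα1 hv).1
    have : v + 1 = -z := by linear_combination h
    rw [this, norm_neg] at h1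
    linarith
  have f5 : ∀ v : ℂ, ‖v - ((α : ℂ) - 1)‖ ≤ rv → z + v + 2 - (α : ℂ) ≠ 0 := by
    intro v hv h
    have : (1 : ℂ) = -z - (v - ((α : ℂ) - 1)) := by linear_combination h
    have h' : ‖(1 : ℂ)‖ ≤ ‖-z‖ + ‖v - ((α : ℂ) - 1)‖ :=
      (congrArg norm this).le.trans (norm_sub_le _ _)
    rw [norm_neg, norm_one] at h'
    linarith
  have g1 : z + 1 ≠ 0 := by
    intro h
    have : z = -1 := by linear_combination h
    rw [this] at hz
    simp at hz
    linarith
  have g2 : z + 1 - (α : ℂ) ≠ 0 := by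
    intro h
    have : z = ((α - 1 : ℝ) : ℂ) := by push_cast; linear_combination h
    rw [this, Complex.norm_real, Real.norm_eq_abs, abs_of_neg (by linarith)] at hz
    linarith
  have hx : (z + 1) * (z + 1 - (α : ℂ)) ≠ 0 := mul_ne_zero g1 g2
  have dq : ∀ v : ℂ, ‖v - ((α : ℂ) - 1)‖ = rv → ∀ i, DifferentiableAt ℂ (qj α i) v :=
    fun v hv i => qj_diff i (f1 v hv.le) (f2 v hv)
  -- main identity
  have e1 : (∮ v in C((α : ℂ) - 1, rv), qj α j v * ((z - v)⁻¹ + (z + v + 1)⁻¹)) =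
      (∮ v in C((α : ℂ) - 1, rv), (((2 * z + 2 - (α : ℂ)) / ((z + 1) * (z + 1 - (α : ℂ))) ^ (j + 1)) *
          ((2 * v + 2 - (α : ℂ)) / ((z - v) * (z + v + 2 - (α : ℂ)))) +
        ∑ i ∈ Finset.range (j + 1), (2 * z + 2 - (α : ℂ)) *
          (((z + 1) * (z + 1 - (α : ℂ))) ^ (j - i + 1))⁻¹ * qj α i v) +
        qj α j v * ((z + v + 1)⁻¹ - (z + v + 2 - (α : ℂ))⁻¹)) := by
    apply circleIntegral.integral_congr hrv.le
    intro v hv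
    have hv' : ‖v - ((α : ℂ) - 1)‖ = rv := by simpa [dist_eq_norm] using hv
    have hxy : (z + 1) * (z + 1 - (α : ℂ)) - (v + 1) * (v + 1 - (α : ℂ)) =
        (z - v) * (z + v + 2 - (α : ℂ)) := by ring
    have hy := mul_ne_zero (f1 v hv'.le) (f2 v hv')
    have hD := mul_ne_zero (f3 v hv'.le) (f5 v hv'.le)
    have hg := geom_id2 _ _ hy hx (by rw [hxy]; exact hD) j
    have hsum : ∑ i ∈ Finset.range (j + 1), (2 * z + 2 - (α : ℂ)) *
          (((z + 1) * (z + 1 - (α : ℂ))) ^ (j - i + 1))⁻¹ * qj α i v =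
        (2 * z + 2 - (α : ℂ)) * (2 * v + 2 - (α : ℂ)) *
        ∑ i ∈ Finset.range (j + 1), (((v + 1) * (v + 1 - (α : ℂ))) ^ (i + 1))⁻¹ *
          (((z + 1) * (z + 1 - (α : ℂ))) ^ (j - i + 1))⁻¹ := by
      rw [Finset.mul_sum]
      apply Finset.sum_congr rfl
      intro i _
      unfold qj
      ring
    have hpf : (z - v)⁻¹ + (z + v + 2 - (α : ℂ))⁻¹ =
        (2 * z + 2 - (α : ℂ)) * ((z - v) * (z + v + 2 - (α : ℂ)))⁻¹ := by
      have h3 := f3 v hv'.le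
      have h5 := f5 v hv'.le
      field_simp
      ring
    rw [hxy] at hg
    simp only
    rw [hsum]
    have : qj α j v * ((z - v)⁻¹ + (z + v + 1)⁻¹) =
        qj α j v * ((z - v)⁻¹ + (z + v + 2 - (α : ℂ))⁻¹) +
        qj α j v * ((z + v + 1)⁻¹ - (z + v + 2 - (α : ℂ))⁻¹) := by ring
    rw [this, hpf]
    congr 1
    unfold qj
    simp only [div_eq_mul_inv]
    linear_combination (2 * z + 2 - (α : ℂ)) * (2 * v + 2 - (α : ℂ)) * hg
  rw [e1, circleIntegral.integral_add, circleIntegral.integral_add]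
  · congr 1
    have h0 : (∮ v in C((α : ℂ) - 1, rv), ((2 * z + 2 - (α : ℂ)) / ((z + 1) * (z + 1 - (α : ℂ))) ^ (j + 1)) *
          ((2 * v + 2 - (α : ℂ)) / ((z - v) * (z + v + 2 - (α : ℂ))))) = 0 := by
      apply circ_zero hrv.le
      intro v hv
      refine DifferentiableAt.const_mul ?_ _
      exact DifferentiableAt.div (by fun_prop) (by fun_prop) (mul_ne_zero (f3 v hv) (f5 v hv))
    rw [h0, zero_add]
    have h1 : (∮ v in C((α : ℂ) - 1, rv), ∑ i ∈ Finset.range (j + 1), (2 * z + 2 - (α : ℂ)) *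
          (((z + 1) * (z + 1 - (α : ℂ))) ^ (j - i + 1))⁻¹ * qj α i v) =
        ∑ i ∈ Finset.range (j + 1), (2 * z + 2 - (α : ℂ)) *
          (((z + 1) * (z + 1 - (α : ℂ))) ^ (j - i + 1))⁻¹ * ∮ v in C((α : ℂ) - 1, rv), qj α i v := by
      rw [circleIntegral.integral_fun_sum]
      · apply Finset.sum_congr rfl
        intro i _
        rw [circleIntegral.integral_const_mul]
      · intro i _
        exact circ_integrable hrv.le (fun v hv => (dq v hv i).const_mul _)
    rw [h1, Finset.sum_eq_single 0]
    · rw [qj_integral hα0 hα1 hrv hε1]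
      simp only [if_true, Nat.sub_zero]
      unfold qj
      ring
    · intro i _ hi
      rw [qj_integral hα0 hα1 hrv hε1, if_neg hi, mul_zero]
    · simp
  · apply circ_integrable hrv.le
    intro v hv
    refine DifferentiableAt.const_mul ?_ _
    exact DifferentiableAt.div (by fun_prop) (by fun_prop) (mul_ne_zero (f3 v hv.le) (f5 v hv.le))
  · apply circ_integrable hrv.le
    intro v hv
    apply DifferentiableAt.fun_sum
    intro i _
    exact (dq v hv i).const_mul _
  · apply circ_integrable hrv.le
    intro v hv
    refine DifferentiableAt.add (DifferentiableAt.const_mul ?_ _) ?_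
    · exact DifferentiableAt.div (by fun_prop) (by fun_prop) (mul_ne_zero (f3 v hv.le) (f5 v hv.le))
    · apply DifferentiableAt.fun_sum
      intro i _
      exact (dq v hv i).const_mul _
  · apply circ_integrable hrv.le
    intro v hv
    refine (dq v hv j).mul (DifferentiableAt.sub ?_ ?_)
    · exact DifferentiableAt.inv (by fun_prop) (f4 v hv.le)
    · exact DifferentiableAt.inv (by fun_prop) (f5 v hv.le)

theorem remj_diff {α : ℝ} (hα0 : 1 / 2 < α) (hα1 : α < 1) {rv : ℝ} (hrv : 0 < rv)
    (hε1 : rv < (1 - α) / 4) (hε2 : rv < (2 * α - 1) / 4) (j : ℕ) {z : ℂ} (hz : ‖z‖ ≤ 1 - α) :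
    DifferentiableAt ℂ (remj α j rv) z := by
  have f1 : ∀ v : ℂ, ‖v - ((α : ℂ) - 1)‖ ≤ rv → v + 1 ≠ 0 := by
    intro v hv h
    have := (near_facts hα0 hα1 hv).1
    rw [h, norm_zero] at this
    linarith
  have f2 : ∀ v : ℂ, ‖v - ((α : ℂ) - 1)‖ = rv → v + 1 - (α : ℂ) ≠ 0 := by
    intro v hv h
    have : v - ((α : ℂ) - 1) = 0 := by linear_combination h
    rw [this, norm_zero] at hv
    linarith
  have dq : ∀ v : ℂ, ‖v - ((α : ℂ) - 1)‖ = rv → DifferentiableAt ℂ (qj α j) v :=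
    fun v hv => qj_diff j (f1 v hv.le) (f2 v hv)
  have cq : ContinuousOn (qj α j) (Metric.sphere ((α : ℂ) - 1) rv) := fun v hv =>
    (dq v (by simpa [dist_eq_norm] using hv)).continuousAt.continuousWithinAt
  have nα : ‖(α : ℂ)‖ = α := by simp [abs_of_pos (by linarith : 0 < α)]
  have k1 : ∀ z : ℂ, ‖z‖ < α - rv → ∀ v : ℂ, ‖v - ((α : ℂ) - 1)‖ = rv → z + v + 1 ≠ 0 := by
    intro z hz v hv h
    have h1 := (near_facts hα0 hα1 hv.le).1
    have : v + 1 = -z := by linear_combination h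
    rw [this, norm_neg] at h1
    linarith
  have k2 : ∀ z : ℂ, ‖z‖ < 1 - rv → ∀ v : ℂ, ‖v - ((α : ℂ) - 1)‖ = rv → z + v + 2 - (α : ℂ) ≠ 0 := by
    intro z hz v hv h
    have : (1 : ℂ) = -z - (v - ((α : ℂ) - 1)) := by linear_combination h
    have h' : ‖(1 : ℂ)‖ ≤ ‖-z‖ + ‖v - ((α : ℂ) - 1)‖ :=
      (congrArg norm this).le.trans (norm_sub_le _ _)
    rw [norm_neg, norm_one] at h'
    linarith
  have ev : remj α j rv =ᶠ[nhds z] fun z => (∮ v in C((α : ℂ) - 1, rv), qj α j v / (v - (-z - 1))) -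
      ∮ v in C((α : ℂ) - 1, rv), qj α j v / (v - (-z - 2 + (α : ℂ))) := by
    have : ∀ᶠ z' in nhds z, ‖z'‖ < α - rv := by
      apply continuous_norm.continuousAt.eventually_lt continuousAt_const
      linarith
    filter_upwards [this] with z' hz'
    rw [← circleIntegral.integral_sub]
    · unfold remj
      congr 1
      ext v
      rw [mul_sub, div_eq_mul_inv, div_eq_mul_inv]
      congr 3 <;> ring
    · apply circ_integrable hrv.le
      intro v hv
      refine (dq v hv).div (by fun_prop) ?_
      have := k1 z' hz' v hv
      intro h
      apply this
      linear_combination h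
    · apply circ_integrable hrv.le
      intro v hv
      refine (dq v hv).div (by fun_prop) ?_
      have := k2 z' (by linarith) v hv
      intro h
      apply this
      linear_combination h
  refine DifferentiableAt.congr_of_eventuallyEq ?_ ev
  apply DifferentiableAt.sub
  · refine DifferentiableAt.comp z (g := fun c => ∮ v in C((α : ℂ) - 1, rv), qj α j v / (v - c))
      (f := fun z => -z - 1) ?_ (by fun_prop)
    apply circ_param_diff hrv.le cq
    have e : -z - 1 - ((α : ℂ) - 1) = -(z + α) := by ring
    rw [e, norm_neg]
    have : (α : ℂ) = (z + α) - z := by ring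
    have h' : ‖(α : ℂ)‖ ≤ ‖z + α‖ + ‖z‖ := by
      conv_lhs => rw [this]
      exact norm_sub_le _ _
    rw [nα] at h'
    intro h
    linarith
  · refine DifferentiableAt.comp z (g := fun c => ∮ v in C((α : ℂ) - 1, rv), qj α j v / (v - c))
      (f := fun z => -z - 2 + (α : ℂ)) ?_ (by fun_prop)
    apply circ_param_diff hrv.le cq
    have e : -z - 2 + (α : ℂ) - ((α : ℂ) - 1) = -(z + 1) := by ring
    rw [e, norm_neg]
    have : (1 : ℂ) = (z + 1) - z := by ring
    have h' : ‖(1 : ℂ)‖ ≤ ‖z + 1‖ + ‖z‖ := by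
      conv_lhs => rw [this]
      exact norm_sub_le _ _
    rw [norm_one] at h'
    intro h
    linarith

/-- `a_j` -/
def ajI (α : ℝ) (A : ℂ → ℂ) (j : ℕ) (r1 : ℝ) : ℂ :=
  ∮ w in C((0 : ℂ), r1), A w * (w * (w - (α : ℂ))) ^ j

/-- `b_j` -/
def bjI (α : ℝ) (B : ℂ → ℂ) (j : ℕ) (rv r2 ρ : ℝ) : ℂ :=
  2 * (π : ℂ) * I * (∮ z in C((α : ℂ) - 1, ρ), qj α j z * B z) +
    ∮ z in C((0 : ℂ), r2), (2 * (π : ℂ) * I * qj α j z + remj α j rv z) * B z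

theorem K2_exact {α : ℝ} (hα0 : 1 / 2 < α) (hα1 : α < 1) {A B : ℂ → ℂ}
    (hA : ∀ w, 0 < ‖w‖ → ‖w‖ < 1 → DifferentiableAt ℂ A w)
    (hB : ∀ w, 0 < ‖w‖ → ‖w‖ < 1 → DifferentiableAt ℂ B w)
    {rv rw rz r1 r2 ρ : ℝ} (hrw : 0 < rw) (hrwv : rw < rv) (hrz : 0 < rz) (hrzv : rz < rv)
    (hε1 : rv < (1 - α) / 4) (hε2 : rv < (2 * α - 1) / 4)
    (hr1 : 0 < r1) (hr1' : r1 < 1) (hr2 : 0 < r2) (hr2' : r2 < 1 - α)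
    (hρ : 0 < ρ) (hρ' : ρ < 1 - α) (M : ℕ) {F : ℂ → ℂ → ℂ → ℂ}
    (hF : ∀ v z w : ℂ, F v z w = A w * B z * ((w * (w - (α : ℂ))) ^ M *
      (((v + 1) * (v + 1 - (α : ℂ))) ^ M)⁻¹ * ((1 + 2 * z) * (2 * v + 2 - (α : ℂ)) /
      ((z - v) * (z + v + 1) * (w - 1 - v) * (w + 1 - (α : ℂ) + v))))) :
    (∮ v in C((α : ℂ) - 1, rv),
      ((∮ z in C((0 : ℂ), rz),
          ((∮ w in C((0 : ℂ), rw), F v z w) + (∮ w in C((α : ℂ) - 1 - v, rw), F v z w))) +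
       (∮ z in C(v, rz),
          ((∮ w in C((0 : ℂ), rw), F v z w) + (∮ w in C((α : ℂ) - 1 - v, rw), F v z w))))) =
    ∑ j ∈ Finset.range M, ajI α A j r1 * bjI α B j rv r2 ρ := by
  have hrv : 0 < rv := by linarith
  have f1 : ∀ v : ℂ, ‖v - ((α : ℂ) - 1)‖ ≤ rv → v + 1 ≠ 0 := by
    intro v hv h
    have := (near_facts hα0 hα1 hv).1
    rw [h, norm_zero] at this
    linarith
  have f2 : ∀ v : ℂ, ‖v - ((α : ℂ) - 1)‖ = rv → v + 1 - (α : ℂ) ≠ 0 := by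
    intro v hv h
    have : v - ((α : ℂ) - 1) = 0 := by linear_combination h
    rw [this, norm_zero] at hv
    linarith
  have f0 : ∀ v : ℂ, ‖(α : ℂ) - 1 - v‖ = ‖v - ((α : ℂ) - 1)‖ := fun v => norm_sub_rev _ _
  set κ : ℂ → ℂ → ℂ := fun z v => (z - v)⁻¹ + (z + v + 1)⁻¹ with hκ
  set a : ℕ → ℂ := fun j => ajI α A j (1 / 4) with ha
  have dA : ∀ w : ℂ, ‖w‖ = 1 / 4 → DifferentiableAt ℂ A w := fun w hw =>
    hA w (by rw [hw]; norm_num) (by rw [hw]; norm_num)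
  have cA : ContinuousOn A (Metric.sphere 0 (1 / 4)) := fun w hw =>
    (dA w (by simpa using hw)).continuousAt.continuousWithinAt
  set E : ℂ → ℂ := fun v => (∮ w in C((0 : ℂ), 1 / 4), A w / (w - (1 + v))) -
    ∮ w in C((0 : ℂ), 1 / 4), A w / (w - ((α : ℂ) - 1 - v)) with hE
  have n1 : ∀ v : ℂ, ‖v - ((α : ℂ) - 1)‖ ≤ rv → 1 / 2 ≤ ‖1 + v‖ := by
    intro v hv
    have := (near_facts hα0 hα1 hv).1
    rw [add_comm]
    linarith
  have dE : ∀ v : ℂ, ‖v - ((α : ℂ) - 1)‖ ≤ rv → DifferentiableAt ℂ E v := by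
    intro v hv
    apply DifferentiableAt.sub
    · refine DifferentiableAt.comp v (g := fun c => ∮ w in C((0 : ℂ), 1 / 4), A w / (w - c))
        (f := fun v => 1 + v) ?_ (by fun_prop)
      apply circ_param_diff (by norm_num) cA
      rw [sub_zero]
      have := n1 v hv
      intro h
      linarith
    · refine DifferentiableAt.comp v (g := fun c => ∮ w in C((0 : ℂ), 1 / 4), A w / (w - c))
        (f := fun v => (α : ℂ) - 1 - v) ?_ (by fun_prop)
      apply circ_param_diff (by norm_num) cA
      rw [sub_zero, f0]
      intro h
      linarith
  -- the inner w integral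
  have hW : ∀ v : ℂ, ‖v - ((α : ℂ) - 1)‖ = rv → ∀ z : ℂ, z - v ≠ 0 → z + v + 1 ≠ 0 →
      (∮ w in C((0 : ℂ), rw), F v z w) + (∮ w in C((α : ℂ) - 1 - v, rw), F v z w) =
      B z * κ z v * (E v + ∑ j ∈ Finset.range M, a j * qj α j v) := by
    intro v hv z hz1 hz2
    have nec : ∀ w : ℂ, ‖w‖ < 3 / 8 → w - 1 - v ≠ 0 := by
      intro w hw h
      have := n1 v hv.le
      have e : 1 + v = w := by linear_combination -h
      rw [e] at this
      linarith
    have nec2 : ∀ w : ℂ, ‖w‖ = 1 / 4 → w + 1 - (α : ℂ) + v ≠ 0 := by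
      intro w hw h
      have e : w = (α : ℂ) - 1 - v := by linear_combination h
      rw [e, f0] at hw
      linarith
    have h2 := circ_two (G := fun w => A w * B z * ((w * (w - (α : ℂ))) ^ M *
      (((v + 1) * (v + 1 - (α : ℂ))) ^ M)⁻¹ * ((1 + 2 * z) * (2 * v + 2 - (α : ℂ)) /
      ((z - v) * (z + v + 1) * (w - 1 - v))))) (c := (α : ℂ) - 1 - v) (ρ := 3 / 8) (r := rw)
      (r' := rw) (R := 1 / 4) hrw (by rw [f0]; linarith) hrw (by rw [f0]; linarith)
      (by rw [f0]; linarith) (by rw [f0]; linarith) (by norm_num) ?_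
    swap
    · intro w hw0 hw1
      refine ((hA w hw0 (by linarith)).mul_const _).mul (DifferentiableAt.mul (by fun_prop) ?_)
      exact DifferentiableAt.div (by fun_prop) (by fun_prop)
        (mul_ne_zero (mul_ne_zero hz1 hz2) (nec w hw1))
    have eF : ∀ w : ℂ, A w * B z * ((w * (w - (α : ℂ))) ^ M *
      (((v + 1) * (v + 1 - (α : ℂ))) ^ M)⁻¹ * ((1 + 2 * z) * (2 * v + 2 - (α : ℂ)) /
      ((z - v) * (z + v + 1) * (w - 1 - v)))) / (w - ((α : ℂ) - 1 - v)) = F v z w := by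
      intro w
      rw [hF]
      have : w - ((α : ℂ) - 1 - v) = w + 1 - (α : ℂ) + v := by ring
      rw [this]
      simp only [div_eq_mul_inv, mul_inv]
      ring
    simp only [eF] at h2
    rw [h2]
    have e3 : (∮ w in C((0 : ℂ), 1 / 4), F v z w) = ∮ w in C((0 : ℂ), 1 / 4),
        B z * κ z v * ((A w / (w - (1 + v)) - A w / (w - ((α : ℂ) - 1 - v))) +
          ∑ j ∈ Finset.range M, qj α j v * (A w * (w * (w - (α : ℂ))) ^ j)) := by
      apply circleIntegral.integral_congr (by norm_num)
      intro w hw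
      have hw' : ‖w‖ = 1 / 4 := by simpa using hw
      have c1 := nec w (by rw [hw']; norm_num)
      have c2 := nec2 w hw'
      have hxy : w * (w - (α : ℂ)) - (v + 1) * (v + 1 - (α : ℂ)) =
        (w - 1 - v) * (w + 1 - (α : ℂ) + v) := by ring
      have hg := geom_id (w * (w - (α : ℂ))) ((v + 1) * (v + 1 - (α : ℂ)))
        (mul_ne_zero (f1 v hv.le) (f2 v hv)) (by rw [hxy]; exact mul_ne_zero c1 c2) M
      rw [hxy] at hg
      have hsum : ∑ j ∈ Finset.range M, qj α j v * (A w * (w * (w - (α : ℂ))) ^ j) =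
          A w * (2 * v + 2 - (α : ℂ)) * ∑ j ∈ Finset.range M, (w * (w - (α : ℂ))) ^ j /
            ((v + 1) * (v + 1 - (α : ℂ))) ^ (j + 1) := by
        rw [Finset.mul_sum]
        apply Finset.sum_congr rfl
        intro j _
        unfold qj
        ring
      simp only
      rw [hsum, hF]
      have hk : κ z v = (1 + 2 * z) * ((z - v) * (z + v + 1))⁻¹ := by
        simp only [hκ]
        field_simp
        ring
      have hd : A w / (w - (1 + v)) - A w / (w - ((α : ℂ) - 1 - v)) =
          A w * (2 * v + 2 - (α : ℂ)) * ((w - 1 - v) * (w + 1 - (α : ℂ) + v))⁻¹ := by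
        have s1 : w - (1 + v) = w - 1 - v := by ring
        have s2 : w - ((α : ℂ) - 1 - v) = w + 1 - (α : ℂ) + v := by ring
        rw [s1, s2]
        field_simp
        ring
      rw [hk, hd, ← mul_add, ← hg]
      simp only [div_eq_mul_inv, mul_inv]
      ring
    rw [e3, circleIntegral.integral_const_mul]
    congr 1
    have i1 : ∀ w : ℂ, ‖w‖ = 1 / 4 → DifferentiableAt ℂ (fun w => A w / (w - (1 + v))) w := by
      intro w hw
      refine (dA w hw).div (by fun_prop) ?_
      have := nec w (by rw [hw]; norm_num)
      intro h
      apply this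
      linear_combination h
    have i2 : ∀ w : ℂ, ‖w‖ = 1 / 4 → DifferentiableAt ℂ (fun w => A w / (w - ((α : ℂ) - 1 - v))) w := by
      intro w hw
      refine (dA w hw).div (by fun_prop) ?_
      have := nec2 w hw
      intro h
      apply this
      linear_combination h
    have i3 : ∀ w : ℂ, ‖w‖ = 1 / 4 → ∀ j : ℕ,
        DifferentiableAt ℂ (fun w => qj α j v * (A w * (w * (w - (α : ℂ))) ^ j)) w := by
      intro w hw j
      exact ((dA w hw).mul (by fun_prop)).const_mul _
    rw [circleIntegral.integral_add, circleIntegral.integral_sub, circleIntegral.integral_fun_sum]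
    · simp only [hE, ha, ajI]
      congr 1
      apply Finset.sum_congr rfl
      intro j _
      rw [circleIntegral.integral_const_mul, mul_comm]
    · intro j _
      exact circ_integrable (by norm_num) (fun w hw => i3 w (by simpa using hw) j)
    · exact circ_integrable (by norm_num) (fun w hw => i1 w (by simpa using hw))
    · exact circ_integrable (by norm_num) (fun w hw => i2 w (by simpa using hw))
    · exact circ_integrable (by norm_num)
        (fun w hw => (i1 w (by simpa using hw)).sub (i2 w (by simpa using hw)))
    · exact circ_integrable (by norm_num)
        (fun w hw => DifferentiableAt.fun_sum (fun j _ => i3 w (by simpa using hw) j))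
  have dBz : ∀ z : ℂ, ‖z‖ = rz → DifferentiableAt ℂ B z := fun z hz =>
    hB z (by rw [hz]; exact hrz) (by rw [hz]; linarith)
  have cBz : ContinuousOn B (Metric.sphere 0 rz) := fun w hw =>
    (dBz w (by simpa using hw)).continuousAt.continuousWithinAt
  have g1 : ∀ v : ℂ, ‖v - ((α : ℂ) - 1)‖ ≤ rv → ∀ z : ℂ, ‖z‖ = rz → z - v ≠ 0 := by
    intro v hv z hz h
    have h1 := (near_facts hα0 hα1 hv).2.2.1
    have : z = v := by linear_combination h
    rw [this] at hz
    linarith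
  have g2 : ∀ v : ℂ, ‖v - ((α : ℂ) - 1)‖ ≤ rv → ∀ z : ℂ, ‖z‖ = rz → z + v + 1 ≠ 0 := by
    intro v hv z hz h
    have h1 := (near_facts hα0 hα1 hv).1
    have : v + 1 = -z := by linear_combination h
    rw [this, norm_neg] at h1
    linarith
  have g3 : ∀ v : ℂ, ‖v - ((α : ℂ) - 1)‖ ≤ rv → ∀ z : ℂ, ‖z - v‖ ≤ rz → z + v + 1 ≠ 0 := by
    intro v hv z hz h
    have h1 := (near_facts hα0 hα1 hv).2.2.2.2.1
    have : 2 * v + 1 = -(z - v) := by linear_combination h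
    rw [this, norm_neg] at h1
    linarith
  have dBv : ∀ v : ℂ, ‖v - ((α : ℂ) - 1)‖ ≤ rv → ∀ z : ℂ, ‖z - v‖ ≤ rz → DifferentiableAt ℂ B z := by
    intro v hv z hz
    have h1 := (near_facts hα0 hα1 hv).2.2.1
    have h2 := (near_facts hα0 hα1 hv).2.2.2.1
    apply hB
    · have := norm_sub_norm_le v (v - z)
      rw [sub_sub_cancel, norm_sub_rev v z] at this
      linarith
    · have := norm_add_le v (z - v)
      rw [add_sub_cancel] at this
      linarith
  set Z : ℂ → ℂ := fun v => ∮ z in C((0 : ℂ), rz), B z * κ z v with hZ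
  have hS : ∀ v : ℂ, ‖v - ((α : ℂ) - 1)‖ = rv →
      ((∮ z in C((0 : ℂ), rz),
          ((∮ w in C((0 : ℂ), rw), F v z w) + (∮ w in C((α : ℂ) - 1 - v, rw), F v z w))) +
       (∮ z in C(v, rz),
          ((∮ w in C((0 : ℂ), rw), F v z w) + (∮ w in C((α : ℂ) - 1 - v, rw), F v z w)))) =
      (Z v + 2 * (π : ℂ) * I * B v) * (E v + ∑ j ∈ Finset.range M, a j * qj α j v) := by
    intro v hv
    have p1 : (∮ z in C((0 : ℂ), rz),
          ((∮ w in C((0 : ℂ), rw), F v z w) + (∮ w in C((α : ℂ) - 1 - v, rw), F v z w))) =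
        Z v * (E v + ∑ j ∈ Finset.range M, a j * qj α j v) := by
      simp only [hZ]
      rw [mul_comm, ← circleIntegral.integral_const_mul]
      apply circleIntegral.integral_congr hrz.le
      intro z hz
      have hz' : ‖z‖ = rz := by simpa using hz
      simp only
      rw [hW v hv z (g1 v hv.le z hz') (g2 v hv.le z hz'), mul_comm]
    have p2 : (∮ z in C(v, rz),
          ((∮ w in C((0 : ℂ), rw), F v z w) + (∮ w in C((α : ℂ) - 1 - v, rw), F v z w))) =
        (2 * (π : ℂ) * I * B v) * (E v + ∑ j ∈ Finset.range M, a j * qj α j v) := by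
      have : (∮ z in C(v, rz),
          ((∮ w in C((0 : ℂ), rw), F v z w) + (∮ w in C((α : ℂ) - 1 - v, rw), F v z w))) =
          (E v + ∑ j ∈ Finset.range M, a j * qj α j v) *
          ∮ z in C(v, rz), (B z + (z - v) * (B z * (z + v + 1)⁻¹)) / (z - v) := by
        rw [← circleIntegral.integral_const_mul]
        apply circleIntegral.integral_congr hrz.le
        intro z hz
        have hz' : ‖z - v‖ = rz := by simpa [dist_eq_norm] using hz
        have q1 : z - v ≠ 0 := by
          intro h
          rw [h, norm_zero] at hz'
          linarith
        simp only
        rw [hW v hv z q1 (g3 v hv.le z hz'.le), mul_comm]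
        congr 1
        simp only [hκ]
        field_simp
      rw [this, circ_cauchy hrz (f := fun z => B z + (z - v) * (B z * (z + v + 1)⁻¹))]
      · simp only [sub_self, zero_mul, add_zero]
        ring
      · intro z hz
        have d := dBv v hv.le z hz
        refine d.add (DifferentiableAt.mul (by fun_prop) (d.mul ?_))
        exact DifferentiableAt.inv (by fun_prop) (g3 v hv.le z hz)
    rw [p1, p2]
    ring
  have dZ : ∀ v : ℂ, ‖v - ((α : ℂ) - 1)‖ ≤ rv → DifferentiableAt ℂ Z v := by
    intro v hv
    have nf := near_facts hα0 hα1 hv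
    have ev : Z =ᶠ[nhds v] fun v => (∮ z in C((0 : ℂ), rz), B z / (z - v)) +
        ∮ z in C((0 : ℂ), rz), B z / (z - (-v - 1)) := by
      have h1 : ∀ᶠ v' in nhds v, rz < ‖v'‖ :=
        continuousAt_const.eventually_lt continuous_norm.continuousAt (by linarith)
      have h2 : ∀ᶠ v' in nhds v, rz < ‖v' + 1‖ :=
        continuousAt_const.eventually_lt (f := fun _ => rz) (g := fun v' : ℂ => ‖v' + 1‖)
          (by fun_prop) (by linarith)
      filter_upwards [h1, h2] with v' h1 h2
      simp only [hZ, hκ]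
      rw [← circleIntegral.integral_add]
      · congr 1
        ext z
        rw [mul_add, div_eq_mul_inv, div_eq_mul_inv]
        congr 3
        ring
      · apply circ_integrable hrz.le
        intro z hz
        rw [sub_zero] at hz
        refine (dBz z hz).div (by fun_prop) ?_
        intro h
        have : z = v' := by linear_combination h
        rw [this] at hz
        linarith
      · apply circ_integrable hrz.le
        intro z hz
        rw [sub_zero] at hz
        refine (dBz z hz).div (by fun_prop) ?_
        intro h
        have : z = -(v' + 1) := by linear_combination h
        rw [this, norm_neg] at hz
        linarith
    refine DifferentiableAt.congr_of_eventuallyEq ?_ ev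
    apply DifferentiableAt.add
    · apply circ_param_diff hrz.le cBz
      rw [sub_zero]
      intro h
      linarith
    · refine DifferentiableAt.comp v (g := fun c => ∮ z in C((0 : ℂ), rz), B z / (z - c))
        (f := fun v => -v - 1) ?_ (by fun_prop)
      apply circ_param_diff hrz.le cBz
      have : -v - 1 - 0 = -(v + 1) := by ring
      rw [this, norm_neg]
      intro h
      linarith
  have dB0 : ∀ v : ℂ, ‖v - ((α : ℂ) - 1)‖ ≤ rv → DifferentiableAt ℂ B v := fun v hv =>
    dBv v hv v (by simpa using hrz.le)
  have dq : ∀ v : ℂ, ‖v - ((α : ℂ) - 1)‖ = rv → ∀ i, DifferentiableAt ℂ (qj α i) v :=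
    fun v hv i => qj_diff i (f1 v hv.le) (f2 v hv)
  have step1 : (∮ v in C((α : ℂ) - 1, rv),
      ((∮ z in C((0 : ℂ), rz),
          ((∮ w in C((0 : ℂ), rw), F v z w) + (∮ w in C((α : ℂ) - 1 - v, rw), F v z w))) +
       (∮ z in C(v, rz),
          ((∮ w in C((0 : ℂ), rw), F v z w) + (∮ w in C((α : ℂ) - 1 - v, rw), F v z w))))) =
      ∮ v in C((α : ℂ) - 1, rv), ((Z v + 2 * (π : ℂ) * I * B v) * E v +
        ∑ j ∈ Finset.range M, a j * (2 * (π : ℂ) * I * (qj α j v * B v) + qj α j v * Z v)) := by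
    apply circleIntegral.integral_congr hrv.le
    intro v hv
    have hv' : ‖v - ((α : ℂ) - 1)‖ = rv := by simpa [dist_eq_norm] using hv
    simp only
    rw [hS v hv', mul_add, Finset.mul_sum]
    congr 1
    apply Finset.sum_congr rfl
    intro j _
    ring
  have dj1 : ∀ v : ℂ, ‖v - ((α : ℂ) - 1)‖ = rv → ∀ j : ℕ,
      DifferentiableAt ℂ (fun v => 2 * (π : ℂ) * I * (qj α j v * B v)) v := fun v hv j =>
    ((dq v hv j).mul (dB0 v hv.le)).const_mul _
  have dj2 : ∀ v : ℂ, ‖v - ((α : ℂ) - 1)‖ = rv → ∀ j : ℕ,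
      DifferentiableAt ℂ (fun v => qj α j v * Z v) v := fun v hv j =>
    (dq v hv j).mul (dZ v hv.le)
  rw [step1, circleIntegral.integral_add, circleIntegral.integral_fun_sum,
    circ_zero hrv.le (f := fun v => (Z v + 2 * (π : ℂ) * I * B v) * E v), zero_add]
  rotate_left
  · intro v hv
    exact ((dZ v hv).add ((dB0 v hv).const_mul _)).mul (dE v hv)
  · intro j _
    exact circ_integrable hrv.le (fun v hv => ((dj1 v hv j).add (dj2 v hv j)).const_mul _)
  · exact circ_integrable hrv.le
      (fun v hv => ((dZ v hv.le).add ((dB0 v hv.le).const_mul _)).mul (dE v hv.le))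
  · exact circ_integrable hrv.le (fun v hv => DifferentiableAt.fun_sum
      (fun j _ => ((dj1 v hv j).add (dj2 v hv j)).const_mul _))
  apply Finset.sum_congr rfl
  intro j _
  rw [circleIntegral.integral_const_mul, circleIntegral.integral_add
    (circ_integrable hrv.le (fun v hv => dj1 v hv j))
    (circ_integrable hrv.le (fun v hv => dj2 v hv j)), circleIntegral.integral_const_mul]
  have ea : a j = ajI α A j r1 := by
    simp only [ha, ajI]
    apply circ_annulus (ρ := 1) hr1 (by norm_num) hr1' (by norm_num)
    intro w h0 h1
    rw [sub_zero] at h0 h1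
    exact (hA w h0 h1).mul (by fun_prop)
  rw [ea]
  congr 1
  unfold bjI
  congr 1
  · congr 1
    apply circ_annulus (ρ := 1 - α) hρ hrv hρ' (by linarith)
    intro z h0 h1
    have nf := near_facts hα0 hα1 h1.le
    refine (qj_diff j ?_ ?_).mul (hB z ?_ ?_)
    · intro h
      have := nf.1
      rw [h, norm_zero] at this
      linarith
    · intro h
      have : z - ((α : ℂ) - 1) = 0 := by linear_combination h
      rw [this, norm_zero] at h0
      linarith
    · have := (near_facts hα0 hα1 (le_refl ‖z - ((α : ℂ) - 1)‖)).2.2.1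
      linarith
    · linarith [nf.2.2.2.1]
  · have e1 : (∮ v in C((α : ℂ) - 1, rv), qj α j v * Z v) =
        ∮ v in C((α : ℂ) - 1, rv), ∮ z in C((0 : ℂ), rz), B z * (qj α j v * κ z v) := by
      congr 1
      ext v
      simp only [hZ]
      rw [← circleIntegral.integral_const_mul]
      congr 1
      ext z
      ring
    rw [e1, circ_swap hrv.le hrz.le]
    · have e2 : (∮ z in C((0 : ℂ), rz), ∮ v in C((α : ℂ) - 1, rv), B z * (qj α j v * κ z v)) =
          ∮ z in C((0 : ℂ), rz), (2 * (π : ℂ) * I * qj α j z + remj α j rv z) * B z := by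
        apply circleIntegral.integral_congr hrz.le
        intro z hz
        have hz' : ‖z‖ = rz := by simpa using hz
        simp only
        rw [circleIntegral.integral_const_mul, mul_comm]
        congr 1
        exact qj_kernel hα0 hα1 hrv hε1 hε2 j (by linarith)
      rw [e2]
      apply circ_annulus (ρ := 1 - α) hr2 hrz hr2' (by linarith)
      intro z h0 h1
      rw [sub_zero] at h0 h1
      refine DifferentiableAt.mul (DifferentiableAt.add (DifferentiableAt.const_mul (qj_diff j ?_ ?_) _)
        (remj_diff hα0 hα1 hrv hε1 hε2 j h1.le)) (hB z h0 (by linarith))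
      · intro h
        have : z = -1 := by linear_combination h
        rw [this] at h1
        simp at h1
        linarith
      · intro h
        have : z = ((α - 1 : ℝ) : ℂ) := by push_cast; linear_combination h
        rw [this, Complex.norm_real, Real.norm_eq_abs, abs_of_neg (by linarith)] at h1
        linarith
    · have cq : ContinuousOn (qj α j) (Metric.sphere ((α : ℂ) - 1) rv) := fun v hv =>
        (dq v (by simpa [dist_eq_norm] using hv) j).continuousAt.continuousWithinAt
      refine (cBz.comp continuousOn_snd (fun p hp => hp.2)).mul
        ((cq.comp continuousOn_fst (fun p hp => hp.1)).mul ?_)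
      simp only [hκ]
      apply ContinuousOn.add
      · apply ContinuousOn.inv₀ (by fun_prop)
        rintro ⟨v, z⟩ ⟨hv, hz⟩
        exact g1 v (by simpa [dist_eq_norm] using (le_of_eq hv)) z (by simpa using hz)
      · apply ContinuousOn.inv₀ (by fun_prop)
        rintro ⟨v, z⟩ ⟨hv, hz⟩
        exact g2 v (by simpa [dist_eq_norm] using (le_of_eq hv)) z (by simpa using hz)

/-- normalised exponential factor -/
def Phi (t : ℝ) (n m : ℤ) (β : ℝ) (w : ℂ) : ℂ :=
  Complex.exp ((t : ℂ) * (w - (β : ℂ))) * ((1 - w) / (1 - (β : ℂ))) ^ n * (w / (β : ℂ)) ^ (-m)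

theorem Phi_diff (t : ℝ) (n m : ℤ) {β : ℝ} (h0 : 0 < β) (h1 : β < 1) {w : ℂ} (hw0 : 0 < ‖w‖)
    (hw1 : ‖w‖ < 1) : DifferentiableAt ℂ (Phi t n m β) w := by
  have a1 : (1 - w) ≠ 0 := by
    intro h
    have : w = 1 := by linear_combination -h
    rw [this] at hw1
    simp at hw1
  have a2 : w ≠ 0 := by
    rintro rfl
    simp at hw0
  have b1 : (β : ℂ) ≠ 0 := by exact_mod_cast h0.ne'
  have b2 : (1 - (β : ℂ)) ≠ 0 := by
    have : (1 - β : ℝ) ≠ 0 := by linarith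
    exact_mod_cast this
  unfold Phi
  refine DifferentiableAt.mul (DifferentiableAt.mul (by fun_prop) ?_) ?_
  · exact DifferentiableAt.zpow (by fun_prop) (Or.inl (div_ne_zero a1 b2))
  · exact DifferentiableAt.zpow (by fun_prop) (Or.inl (div_ne_zero a2 b1))

/-- conjugation factor -/
def cnj (α t : ℝ) (n m : ℤ) : ℝ := Real.exp (α * t) * (α - 1) ^ n * α ^ (-m)

theorem cnj_ne {α t : ℝ} {n m : ℤ} (h0 : 0 < α) (h1 : α < 1) : (cnj α t n m : ℂ) ≠ 0 := by
  have : cnj α t n m ≠ 0 := by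
    unfold cnj
    have : α - 1 ≠ 0 := by linarith
    have := zpow_ne_zero n this
    have := zpow_ne_zero (-m) h0.ne'
    have := Real.exp_ne_zero (α * t)
    positivity
  exact_mod_cast this

theorem left_factor {α t : ℝ} {N x : ℤ} (h0 : 0 < α) (h1 : α < 1) (w : ℂ) :
    w⁻¹ * Complex.exp ((t : ℂ) * w) * (w * (w - 1)) ^ N * w ^ (-(x + 2 * N)) =
      (cnj α t N (x + N) : ℂ) * (w⁻¹ * Phi t N (x + N) α w) := by
  by_cases hw : w = 0
  · simp [hw]
  have b1 : (α : ℂ) ≠ 0 := by exact_mod_cast h0.ne'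
  have b2 : (1 - (α : ℂ)) ≠ 0 := by
    have : (1 - α : ℝ) ≠ 0 := by linarith
    exact_mod_cast this
  have b3 : ((α : ℂ) - 1) ≠ 0 := by
    intro h
    apply b2
    linear_combination -h
  have e1 : (1 - w) / (1 - (α : ℂ)) = (w - 1) / ((α : ℂ) - 1) := by
    rw [div_eq_div_iff b2 b3]; ring
  have e2 : Complex.exp ((t : ℂ) * w) =
      Complex.exp ((α : ℂ) * t) * Complex.exp ((t : ℂ) * (w - (α : ℂ))) := by
    rw [← Complex.exp_add]; congr 1; ring
  have e3 : w ^ (-(x + 2 * N)) = w ^ (-(x + N)) * (w ^ N)⁻¹ := by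
    rw [← zpow_neg, ← zpow_add₀ hw]; congr 1; ring
  unfold cnj Phi
  push_cast
  rw [e1, e2, e3, mul_zpow, div_zpow, div_zpow]
  have z1 : w ^ N ≠ 0 := zpow_ne_zero _ hw
  have z2 : ((α : ℂ) - 1) ^ N ≠ 0 := zpow_ne_zero _ b3
  have z3 : (α : ℂ) ^ (-(x + N)) ≠ 0 := zpow_ne_zero _ b1
  generalize (α : ℂ) ^ (-(x + N)) = p3 at *
  generalize w ^ (-(x + N)) = p4 at *
  field_simp

theorem right_factor {α t : ℝ} {N x : ℤ} (h0 : 0 < α) (h1 : α < 1) (v : ℂ) (hv : 1 + v ≠ 0) :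
    (cnj α t N (x + N) : ℂ) * ((1 + v) ^ (x + 2 * N) * Complex.exp (-((t : ℂ) * (v + 1))) *
    (v * (v + 1)) ^ (-N)) = Phi t (x + N) N (1 - α) (-v) := by
  have b1 : (α : ℂ) ≠ 0 := by exact_mod_cast h0.ne'
  have b2 : (1 - (α : ℂ)) ≠ 0 := by
    have : (1 - α : ℝ) ≠ 0 := by linarith
    exact_mod_cast this
  have b3 : ((α : ℂ) - 1) ≠ 0 := by
    intro h
    apply b2
    linear_combination -h
  have e1 : -v / (1 - (α : ℂ)) = v / ((α : ℂ) - 1) := by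
    rw [div_eq_div_iff b2 b3]; ring
  have e1' : (1 - -v) / (1 - (1 - (α : ℂ))) = (1 + v) / (α : ℂ) := by
    rw [sub_sub_cancel, sub_neg_eq_add]
  have e2 : Complex.exp ((t : ℂ) * (-v - (1 - (α : ℂ)))) =
      Complex.exp ((α : ℂ) * t) * Complex.exp (-((t : ℂ) * (v + 1))) := by
    rw [← Complex.exp_add]; congr 1; ring
  have e3 : (1 + v) ^ (x + 2 * N) = (1 + v) ^ (x + N) * (1 + v) ^ N := by
    rw [← zpow_add₀ hv]; congr 1; ring
  unfold cnj Phi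
  push_cast
  rw [e1, e1', e2, e3, mul_zpow, div_zpow, div_zpow, add_comm v 1, zpow_neg, zpow_neg, zpow_neg,
    zpow_neg]
  have z1 : (1 + v) ^ N ≠ 0 := zpow_ne_zero _ hv
  have z2 : ((α : ℂ) - 1) ^ N ≠ 0 := zpow_ne_zero _ b3
  have z3 : (α : ℂ) ^ (x + N) ≠ 0 := zpow_ne_zero _ b1
  field_simp

/-- the `w`-side function -/
def AF (α t : ℝ) (n m : ℤ) (w : ℂ) : ℂ := w⁻¹ * Phi t n m α w
/-- the `v`-side function -/
def BF (α t : ℝ) (n m : ℤ) (v : ℂ) : ℂ := Phi t m n (1 - α) (-v)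

theorem AF_diff {α t : ℝ} {n m : ℤ} (h0 : 0 < α) (h1 : α < 1) :
    ∀ w, 0 < ‖w‖ → ‖w‖ < 1 → DifferentiableAt ℂ (AF α t n m) w := by
  intro w h2 h3
  refine DifferentiableAt.mul (DifferentiableAt.inv (by fun_prop) ?_) (Phi_diff t n m h0 h1 h2 h3)
  rintro rfl
  simp at h2

theorem BF_diff {α t : ℝ} {n m : ℤ} (h0 : 0 < α) (h1 : α < 1) :
    ∀ w, 0 < ‖w‖ → ‖w‖ < 1 → DifferentiableAt ℂ (BF α t n m) w := by
  intro w h2 h3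
  have := Phi_diff t m n (β := 1 - α) (by linarith) (by linarith) (w := -w) (by simpa using h2)
    (by simpa using h3)
  exact DifferentiableAt.comp (g := Phi t m n (1 - α)) (f := fun w => -w) w this (by fun_prop)

set_option maxHeartbeats 1000000 in
theorem Kker_exact {α : ℝ} (hα0 : 1 / 2 < α) (hα1 : α < 1) (M : ℕ) (n₁ n₂ : ℤ) (t₁ t₂ : ℝ)
    (x₁ x₂ : ℤ) {r0 rv1 rw1 rv2 rz2 rw2 r1 r2 ρ : ℝ}
    (h0 : 0 < r0) (h0' : r0 < 1) (hw1 : 0 < rw1) (hwv1 : rw1 < rv1)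
    (hv1 : rv1 < r1) (hv1' : rv1 < 1 - r1) (hv1'' : 3 * rv1 < 1)
    (hz2 : 0 < rz2) (hzv2 : rz2 < rv2) (hw2 : 0 < rw2) (hwv2 : rw2 < rv2)
    (hε1 : rv2 < (1 - α) / 4) (hε2 : rv2 < (2 * α - 1) / 4)
    (hr1 : r1 < α) (hr2 : 0 < r2) (hr2' : r2 < 1 - α) (hr21 : r2 < r1)
    (hρ : 0 < ρ) (hρ' : ρ < 1 - α)
    {N₁ N₂ m₁ m₂ : ℤ} (hN₁ : N₁ = n₁ - M) (hN₂ : N₂ = n₂ - M) (hm₁ : m₁ = x₁ + N₁)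
    (hm₂ : m₂ = x₂ + N₂) :
    ((cnj α t₂ N₂ m₂ / cnj α t₁ N₁ m₁ : ℝ) : ℂ) *
      Kker (M : ℤ) α n₁ n₂ t₁ t₂ x₁ x₂ r0 rv1 rw1 rv2 rz2 rw2 =
    -(if n₁ ≤ n₂ ∧ t₂ ≤ t₁ ∧ ¬(n₁ = n₂ ∧ t₁ = t₂) then (1 : ℂ) else 0) *
      ((2 * (π : ℂ) * I)⁻¹ * ∮ w in C((0 : ℂ), α), AF α t₁ N₁ m₁ w * BF α t₂ N₂ m₂ (w - 1)) +
    ((2 * (π : ℂ) * I)⁻¹) ^ 2 * (∮ w in C((0 : ℂ), r1), ∮ v in C((0 : ℂ), r2),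
      AF α t₁ N₁ m₁ w * BF α t₂ N₂ m₂ v * ((1 + 2 * v) / ((w + v) * (w - v - 1)))) +
    ((2 * (π : ℂ) * I)⁻¹) ^ 3 * ∑ j ∈ Finset.range M, ajI α (AF α t₁ N₁ m₁) j r1 *
      bjI α (BF α t₂ N₂ m₂) j rv2 r2 ρ := by
  have hα : 0 < α := by linarith
  have c1 : (cnj α t₁ N₁ m₁ : ℂ) ≠ 0 := cnj_ne hα hα1
  have c2 : (cnj α t₂ N₂ m₂ : ℂ) ≠ 0 := cnj_ne hα hα1
  have hLx : ∀ w : ℂ, w⁻¹ * Complex.exp ((t₁ : ℂ) * w) * (w * (w - 1)) ^ (n₁ - (M : ℤ)) *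
      w ^ (-(x₁ + 2 * n₁ - 2 * (M : ℤ))) = (cnj α t₁ N₁ m₁ : ℂ) * AF α t₁ N₁ m₁ w := by
    intro w
    have : x₁ + 2 * n₁ - 2 * (M : ℤ) = x₁ + 2 * N₁ := by rw [hN₁]; ring
    rw [this, ← hN₁, hm₁]
    exact left_factor hα hα1 w
  have hRx : ∀ v : ℂ, 1 + v ≠ 0 → (1 + v) ^ (x₂ + 2 * n₂ - 2 * (M : ℤ)) *
      Complex.exp (-((t₂ : ℂ) * (v + 1))) * (v * (v + 1)) ^ (-(n₂ - (M : ℤ))) =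
      (cnj α t₂ N₂ m₂ : ℂ)⁻¹ * BF α t₂ N₂ m₂ v := by
    intro v hv
    have : x₂ + 2 * n₂ - 2 * (M : ℤ) = x₂ + 2 * N₂ := by rw [hN₂]; ring
    rw [this, ← hN₂, hm₂, eq_inv_mul_iff_mul_eq₀ (by rw [← hm₂]; exact c2)]
    exact right_factor hα hα1 v hv
  set A := AF α t₁ N₁ m₁ with hA
  set B := BF α t₂ N₂ m₂ with hB
  set C1 := (cnj α t₁ N₁ m₁ : ℂ) with hC1
  set C2 := (cnj α t₂ N₂ m₂ : ℂ) with hC2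
  have dA : ∀ w, 0 < ‖w‖ → ‖w‖ < 1 → DifferentiableAt ℂ A w := AF_diff hα hα1
  have dB : ∀ w, 0 < ‖w‖ → ‖w‖ < 1 → DifferentiableAt ℂ B w := BF_diff hα hα1
  have small : ∀ v : ℂ, ‖v‖ < 1 → 1 + v ≠ 0 := by
    intro v hv h
    have : v = -1 := by linear_combination h
    rw [this] at hv
    simp at hv
  push_cast
  rw [← hC1, ← hC2]
  unfold Kker
  -- phi
  have Hphi : C2 / C1 * phiHat n₁ n₂ t₁ t₂ x₁ x₂ r0 =
      (2 * (π : ℂ) * I)⁻¹ * ∮ w in C((0 : ℂ), α), A w * B (w - 1) := by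
    have e1 : (∮ w in C((0 : ℂ), α), A w * B (w - 1)) = ∮ w in C((0 : ℂ), r0), A w * B (w - 1) := by
      apply circ_annulus (ρ := 1) h0 hα h0' hα1
      intro w hw0 hw1
      rw [sub_zero] at hw0 hw1
      refine (dA w hw0 hw1).mul ?_
      have b1 : (1 - (α : ℂ)) ≠ 0 := by
        have : (1 - α : ℝ) ≠ 0 := by linarith
        exact_mod_cast this
      have w0 : w ≠ 0 := by
        rintro rfl
        simp at hw0
      have w1 : 1 - w ≠ 0 := by
        have := small (-w) (by simpa using hw1)
        rwa [← sub_eq_add_neg] at this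
      have b2 : (α : ℂ) ≠ 0 := by exact_mod_cast hα.ne'
      simp only [hB, BF, Phi]
      push_cast
      refine DifferentiableAt.mul (DifferentiableAt.mul (by fun_prop) ?_) ?_
      · refine DifferentiableAt.zpow (by fun_prop) (Or.inl (div_ne_zero ?_ ?_))
        · simpa using w0
        · simpa using b2
      · refine DifferentiableAt.zpow (by fun_prop) (Or.inl (div_ne_zero ?_ b1))
        simpa using w1
    rw [e1]
    unfold phiHat
    rw [mul_left_comm, ← circleIntegral.integral_const_mul]
    congr 1
    apply circleIntegral.integral_congr h0.le
    intro w hw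
    have hw' : ‖w‖ = r0 := by simpa using hw
    have w0 : w ≠ 0 := by
      rintro rfl
      simp at hw'
      linarith
    have w1 : w - 1 ≠ 0 := by
      intro h
      have : w = 1 := by linear_combination h
      rw [this] at hw'
      simp at hw'
      linarith
    have k1 := hLx w
    have k2 := hRx (w - 1) (by simpa using w0)
    have k2' : B (w - 1) = C2 * ((1 + (w - 1)) ^ (x₂ + 2 * n₂ - 2 * (M : ℤ)) *
      Complex.exp (-((t₂ : ℂ) * (w - 1 + 1))) * ((w - 1) * (w - 1 + 1)) ^ (-(n₂ - (M : ℤ)))) := by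
      rw [k2, mul_inv_cancel_left₀ c2]
    have k1' : A w = C1⁻¹ * (w⁻¹ * Complex.exp ((t₁ : ℂ) * w) * (w * (w - 1)) ^ (n₁ - (M : ℤ)) *
      w ^ (-(x₁ + 2 * n₁ - 2 * (M : ℤ)))) := by
      rw [k1, inv_mul_cancel_left₀ c1]
    simp only
    rw [k1', k2', add_sub_cancel, sub_add_cancel, mul_comm (w - 1) w]
    have e2 : Complex.exp (((t₁ - t₂ : ℝ) : ℂ) * w) =
        Complex.exp ((t₁ : ℂ) * w) * Complex.exp (-((t₂ : ℂ) * w)) := by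
      rw [← Complex.exp_add]; congr 1; push_cast; ring
    have e3 : (w * (w - 1)) ^ (n₁ - n₂) =
        (w * (w - 1)) ^ (n₁ - (M : ℤ)) * (w * (w - 1)) ^ (-(n₂ - (M : ℤ))) := by
      rw [← zpow_add₀ (mul_ne_zero w0 w1)]; congr 1; ring
    have e4 : w ^ (-(x₁ + 2 * n₁ - x₂ - 2 * n₂)) =
        w ^ (-(x₁ + 2 * n₁ - 2 * (M : ℤ))) * w ^ (x₂ + 2 * n₂ - 2 * (M : ℤ)) := by
      rw [← zpow_add₀ w0]; congr 1; ring
    rw [e2, e3, e4]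
    ring
  have HK1 : C2 / C1 * Khat1 M n₁ n₂ t₁ t₂ x₁ x₂ rv1 rw1 =
      ((2 * (π : ℂ) * I)⁻¹) ^ 2 * (∮ w in C((0 : ℂ), r1), ∮ v in C((0 : ℂ), r2),
      A w * B v * ((1 + 2 * v) / ((w + v) * (w - v - 1)))) := by
    rw [← K1_exact dA dB hw1 hwv1 hv1 hv1' hv1'' hr2 hr21 (by linarith)]
    unfold Khat1
    rw [circleIntegral.integral_const_mul]
    have : ∀ a b : ℂ, C2 / C1 * (a * (a * b)) = a ^ 2 * (C2 / C1 * b) := by intros; ring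
    rw [this, ← circleIntegral.integral_const_mul]
    congr 1
    apply circleIntegral.integral_congr (by linarith)
    intro v hv
    have hv' : ‖v‖ = rv1 := by simpa using hv
    have hintg : ∀ w : ℂ, C2 / C1 * K1Int M n₁ n₂ t₁ t₂ x₁ x₂ v w =
        A w * B v * ((1 + 2 * v) / ((w + v) * (w - v - 1))) := by
      intro w
      have k1 := hLx w
      have k2 := hRx v (small v (by linarith))
      unfold K1Int
      rw [k1]
      have e : C1 * A w * (1 + v) ^ (x₂ + 2 * n₂ - 2 * (M : ℤ)) *
        Complex.exp (-((t₂ : ℂ) * (v + 1))) * (v * (v + 1)) ^ (-(n₂ - (M : ℤ))) =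
        C1 * A w * (C2⁻¹ * B v) := by
        rw [← k2]; ring
      rw [e]
      field_simp
    simp only
    rw [mul_add, ← circleIntegral.integral_const_mul, ← circleIntegral.integral_const_mul]
    simp only [hintg]
  have this2 : ∀ P Q R S D : ℂ, C2 / C1 * ((C1 * P) * (C2⁻¹ * Q) * R * S / D) =
      P * Q * (R * (S / D)) := by
    intro P Q R S D
    have h : C2 / C1 * ((C1 * P) * (C2⁻¹ * Q) * R * S / D) =
      (C2 * C2⁻¹) * (C1 * C1⁻¹) * (P * Q * (R * (S / D))) := by ring
    rw [h, mul_inv_cancel₀ c1, mul_inv_cancel₀ c2, one_mul, one_mul]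
  have HK2 : C2 / C1 * Khat2 M α n₁ n₂ t₁ t₂ x₁ x₂ rv2 rz2 rw2 =
      ((2 * (π : ℂ) * I)⁻¹) ^ 3 * ∑ j ∈ Finset.range M, ajI α A j r1 *
      bjI α B j rv2 r2 ρ := by
    rw [← K2_exact hα0 hα1 dA dB hw2 hwv2 hz2 hzv2 hε1 hε2 (by linarith) (by linarith) hr2 hr2'
      hρ hρ' M (F := fun v z w => A w * B z * ((w * (w - (α : ℂ))) ^ M *
      (((v + 1) * (v + 1 - (α : ℂ))) ^ M)⁻¹ * ((1 + 2 * z) * (2 * v + 2 - (α : ℂ)) /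
      ((z - v) * (z + v + 1) * (w - 1 - v) * (w + 1 - (α : ℂ) + v))))) (fun _ _ _ => rfl)]
    unfold Khat2
    simp only [circleIntegral.integral_const_mul, ← mul_add]
    have : ∀ a b : ℂ, C2 / C1 * (a * (a * (a * b))) = a ^ 3 * (C2 / C1 * b) := by intros; ring
    rw [this, ← circleIntegral.integral_const_mul]
    congr 1
    apply circleIntegral.integral_congr (by linarith)
    intro v hv
    have hv' : ‖v - ((α : ℂ) - 1)‖ = rv2 := by simpa [dist_eq_norm] using hv
    have nf := near_facts hα0 hα1 hv'.le
    have hintg : ∀ z w : ℂ, ‖z‖ < 1 → C2 / C1 * K2Int M α n₁ n₂ t₁ t₂ x₁ x₂ v z w =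
        A w * B z * ((w * (w - (α : ℂ))) ^ M *
      (((v + 1) * (v + 1 - (α : ℂ))) ^ M)⁻¹ * ((1 + 2 * z) * (2 * v + 2 - (α : ℂ)) /
      ((z - v) * (z + v + 1) * (w - 1 - v) * (w + 1 - (α : ℂ) + v)))) := by
      intro z w hz
      have k1 := hLx w
      have k2 := hRx z (small z hz)
      unfold K2Int
      have e : w⁻¹ * Complex.exp ((t₁ : ℂ) * w) * (w * (w - 1)) ^ (n₁ - (M : ℤ)) *
          (w * (w - (α : ℂ))) ^ (M : ℤ) * w ^ (-(x₁ + 2 * n₁ - 2 * (M : ℤ))) *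
          (1 + z) ^ (x₂ + 2 * n₂ - 2 * (M : ℤ)) * Complex.exp (-((t₂ : ℂ) * (z + 1))) *
          (z * (z + 1)) ^ (-(n₂ - (M : ℤ))) * ((v + 1) * (v + 1 - (α : ℂ))) ^ (-(M : ℤ)) =
          (C1 * A w) * (C2⁻¹ * B z) * ((w * (w - (α : ℂ))) ^ M *
            (((v + 1) * (v + 1 - (α : ℂ))) ^ M)⁻¹) := by
        rw [← k1, ← k2, zpow_neg _ (M : ℤ), zpow_natCast, zpow_natCast]
        ring
      rw [e]
      exact this2 _ _ _ _ _
    have hin2 : ∀ z : ℂ, ‖z‖ < 1 → C2 / C1 *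
        ((∮ w in C((0 : ℂ), rw2), K2Int M α n₁ n₂ t₁ t₂ x₁ x₂ v z w) +
           (∮ w in C((α : ℂ) - 1 - v, rw2), K2Int M α n₁ n₂ t₁ t₂ x₁ x₂ v z w)) =
        (∮ w in C((0 : ℂ), rw2), A w * B z * ((w * (w - (α : ℂ))) ^ M *
      (((v + 1) * (v + 1 - (α : ℂ))) ^ M)⁻¹ * ((1 + 2 * z) * (2 * v + 2 - (α : ℂ)) /
      ((z - v) * (z + v + 1) * (w - 1 - v) * (w + 1 - (α : ℂ) + v))))) +
        ∮ w in C((α : ℂ) - 1 - v, rw2), A w * B z * ((w * (w - (α : ℂ))) ^ M *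
      (((v + 1) * (v + 1 - (α : ℂ))) ^ M)⁻¹ * ((1 + 2 * z) * (2 * v + 2 - (α : ℂ)) /
      ((z - v) * (z + v + 1) * (w - 1 - v) * (w + 1 - (α : ℂ) + v)))) := by
      intro z hz
      rw [mul_add, ← circleIntegral.integral_const_mul, ← circleIntegral.integral_const_mul]
      simp only [hintg z _ hz]
    simp only
    rw [mul_add, ← circleIntegral.integral_const_mul, ← circleIntegral.integral_const_mul]
    congr 1
    · apply circleIntegral.integral_congr hz2.le
      intro z hz
      have hz' : ‖z‖ = rz2 := by simpa using hz
      exact hin2 z (by linarith)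
    · apply circleIntegral.integral_congr hz2.le
      intro z hz
      have hz' : ‖z - v‖ = rz2 := by simpa [dist_eq_norm] using hz
      apply hin2 z
      have := norm_add_le v (z - v)
      rw [add_sub_cancel] at this
      linarith [nf.2.2.2.1]
  rw [← Hphi, ← HK1, ← HK2]
  ring

/-- scaling regime -/
structure Reg {ι : Type} (l : Filter ι) (S t : ι → ℝ) (n m : ι → ℤ) (β u d e q : ℝ) : Prop where
  hS : Tendsto S l atTop
  hn : Tendsto (fun i => (n i : ℝ) / S i ^ 3) l (nhds ((1 - β) ^ 2 * u))
  hm : Tendsto (fun i => (m i : ℝ) / S i ^ 3) l (nhds (β ^ 2 * u))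
  hd : Tendsto (fun i => (t i - n i / (1 - β) ^ 2) / S i ^ 2) l (nhds d)
  hl : Tendsto (fun i => (t i - n i / (1 - β) - m i / β) / S i) l (nhds e)
  hq : Tendsto (fun i => (m i / β ^ 2 - n i / (1 - β) ^ 2) / (2 * S i ^ 2)) l (nhds q)

theorem Reg.comp {ι κ : Type} {l : Filter ι} {S t : ι → ℝ} {n m : ι → ℤ} {β u d e q : ℝ}
    (h : Reg l S t n m β u d e q) {L : Filter κ} {f : κ → ι} (hf : Tendsto f L l) :
    Reg L (fun k => S (f k)) (fun k => t (f k)) (fun k => n (f k)) (fun k => m (f k)) β u d e q :=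
  ⟨h.hS.comp hf, h.hn.comp hf, h.hm.comp hf, h.hd.comp hf, h.hl.comp hf, h.hq.comp hf⟩

theorem Reg.symm {ι : Type} {l : Filter ι} {S t : ι → ℝ} {n m : ι → ℤ} {β u d e q : ℝ}
    (h : Reg l S t n m β u d e q) : Reg l S t m n (1 - β) u (d - 2 * q) e (-q) := by
  have e1 : (1 - (1 - β)) = β := by ring
  refine ⟨h.hS, ?_, h.hn, ?_, ?_, ?_⟩
  · rw [e1]; exact h.hm
  · rw [e1]
    refine (h.hd.sub (h.hq.const_mul 2)).congr' ?_
    filter_upwards [h.hS.eventually_gt_atTop 0] with i hi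
    field_simp
    ring
  · rw [e1]
    refine h.hl.congr (fun i => ?_)
    ring
  · rw [e1]
    refine h.hq.neg.congr (fun i => ?_)
    ring

theorem log_lim {ι : Type} {l : Filter ι} {S : ι → ℝ} (hS : Tendsto S l atTop) {κ : ι → ℂ} {κ0 : ℂ}
    (hκ : Tendsto κ l (nhds κ0)) (c : ℂ) :
    Tendsto (fun i => (S i : ℂ) ^ 3 * (Complex.log (1 + c * (κ i / S i)) -
      (c * (κ i / S i) - (c * (κ i / S i)) ^ 2 / 2 + (c * (κ i / S i)) ^ 3 / 3))) l (nhds 0) := by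
  have hSi : Tendsto (fun i => (S i)⁻¹) l (nhds 0) := tendsto_inv_atTop_zero.comp hS
  have hz : Tendsto (fun i => ‖c * (κ i / S i)‖) l (nhds 0) := by
    have : Tendsto (fun i => ‖c‖ * (‖κ i‖ * (S i)⁻¹)) l (nhds (‖c‖ * (‖κ0‖ * 0))) :=
      (hκ.norm.mul hSi).const_mul _
    rw [mul_zero, mul_zero] at this
    refine this.congr' ?_
    filter_upwards [hS.eventually_gt_atTop 0] with i hi
    rw [norm_mul, norm_div, Complex.norm_real, Real.norm_eq_abs, abs_of_pos hi, div_eq_mul_inv]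
  have hb : Tendsto (fun i => (‖c‖ * ‖κ i‖) ^ 4 * (S i)⁻¹) l (nhds 0) := by
    have := (((hκ.norm.const_mul ‖c‖).pow 4).mul hSi)
    rwa [mul_zero] at this
  apply squeeze_zero_norm' _ hb
  filter_upwards [hS.eventually_gt_atTop 0, hz.eventually (gt_mem_nhds (by norm_num : (0:ℝ) < 1 / 2))]
    with i hi hi2
  have h := Complex.norm_log_sub_logTaylor_le 3 (z := c * (κ i / S i)) (by linarith)
  have hT : Complex.logTaylor (3 + 1) (c * (κ i / S i)) =
      c * (κ i / S i) - (c * (κ i / S i)) ^ 2 / 2 + (c * (κ i / S i)) ^ 3 / 3 := by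
    simp [Complex.logTaylor, Finset.sum_range_succ]
    ring
  rw [hT] at h
  rw [norm_mul, norm_pow, Complex.norm_real, Real.norm_eq_abs, abs_of_pos hi]
  have hinv : (1 - ‖c * (κ i / S i)‖)⁻¹ ≤ 2 := by
    rw [inv_le_comm₀ (by linarith) (by norm_num)]
    linarith
  have h4 : ‖c * (κ i / S i)‖ ^ (3 + 1) * (1 - ‖c * (κ i / S i)‖)⁻¹ / ((3 : ℕ) + 1) ≤
      ‖c * (κ i / S i)‖ ^ 4 := by
    have p : 0 ≤ ‖c * (κ i / S i)‖ ^ 4 := by positivity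
    push_cast
    have : ‖c * (κ i / S i)‖ ^ (3 + 1) * (1 - ‖c * (κ i / S i)‖)⁻¹ ≤ ‖c * (κ i / S i)‖ ^ 4 * 2 :=
      mul_le_mul_of_nonneg_left hinv p
    rw [div_le_iff₀ (by norm_num)]
    linarith
  calc S i ^ 3 * _ ≤ S i ^ 3 * ‖c * (κ i / S i)‖ ^ 4 :=
        mul_le_mul_of_nonneg_left (h.trans h4) (by positivity)
    _ = (‖c‖ * ‖κ i‖) ^ 4 * (S i)⁻¹ := by
        rw [norm_mul, norm_div, Complex.norm_real, Real.norm_eq_abs, abs_of_pos hi]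
        field_simp

theorem Phi_lim {ι : Type} {l : Filter ι} {S t : ι → ℝ} {n m : ι → ℤ} {β u d e q : ℝ}
    (hβ0 : 0 < β) (hβ1 : β < 1) (h : Reg l S t n m β u d e q) {κ : ι → ℂ} {κ0 : ℂ}
    (hκ : Tendsto κ l (nhds κ0)) :
    Tendsto (fun i => Phi (t i) (n i) (m i) β (β + κ i / S i)) l
      (nhds (Complex.exp (e * κ0 + q * κ0 ^ 2 - ((u / (3 * β * (1 - β)) : ℝ) : ℂ) * κ0 ^ 3))) := by
  have hS := h.hS
  have hβ1' : (0 : ℝ) < 1 - β := by linarith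
  have b0 : (β : ℂ) ≠ 0 := by exact_mod_cast hβ0.ne'
  have b1 : (1 - β : ℂ) ≠ 0 := by exact_mod_cast hβ1'.ne'
  have L1 := log_lim hS hκ (-(1 - β : ℂ)⁻¹)
  have L2 := log_lim hS hκ ((β : ℂ)⁻¹)
  have cr : ∀ {f : ι → ℝ} {x : ℝ}, Tendsto f l (nhds x) →
      Tendsto (fun i => ((f i : ℝ) : ℂ)) l (nhds (x : ℂ)) := fun hf =>
    (Complex.continuous_ofReal.tendsto _).comp hf
  have E1 := (cr h.hl).mul hκ
  have E2 := (cr h.hq).mul (hκ.pow 2)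
  have E3 : Tendsto (fun i => ((((n i : ℝ) / S i ^ 3) / (3 * (1 - β) ^ 3) +
      ((m i : ℝ) / S i ^ 3) / (3 * β ^ 3) : ℝ) : ℂ) * κ i ^ 3) l
      (nhds (((u / (3 * β * (1 - β)) : ℝ) : ℂ) * κ0 ^ 3)) := by
    refine (cr ?_).mul (hκ.pow 3)
    have := (h.hn.div_const (3 * (1 - β) ^ 3)).add (h.hm.div_const (3 * β ^ 3))
    convert this using 2
    field_simp
    ring
  have E4 := (cr h.hn).mul L1
  have E5 := (cr h.hm).mul L2
  have Etot := ((((E1.add E2).sub E3).add E4).sub E5)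
  rw [mul_zero, mul_zero, add_zero, sub_zero] at Etot
  refine ((Complex.continuous_exp.tendsto _).comp Etot).congr' ?_
  have hz : Tendsto (fun i => κ i / (S i : ℂ)) l (nhds 0) := by
    have hSi : Tendsto (fun i => (((S i)⁻¹ : ℝ) : ℂ)) l (nhds ((0 : ℝ) : ℂ)) :=
      cr (tendsto_inv_atTop_zero.comp hS)
    have := hκ.mul hSi
    simp only [Complex.ofReal_zero, mul_zero] at this
    refine this.congr (fun i => ?_)
    push_cast
    rw [div_eq_mul_inv]
  have z1 : ∀ᶠ i in l, 1 + -(1 - β : ℂ)⁻¹ * (κ i / S i) ≠ 0 := by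
    have : Tendsto (fun i => 1 + -(1 - β : ℂ)⁻¹ * (κ i / S i)) l (nhds (1 + -(1 - β : ℂ)⁻¹ * 0)) :=
      (hz.const_mul _).const_add 1
    rw [mul_zero, add_zero] at this
    exact this.eventually_ne one_ne_zero
  have z2 : ∀ᶠ i in l, 1 + (β : ℂ)⁻¹ * (κ i / S i) ≠ 0 := by
    have : Tendsto (fun i => 1 + (β : ℂ)⁻¹ * (κ i / S i)) l (nhds (1 + (β : ℂ)⁻¹ * 0)) :=
      (hz.const_mul _).const_add 1
    rw [mul_zero, add_zero] at this
    exact this.eventually_ne one_ne_zero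
  filter_upwards [hS.eventually_gt_atTop 0, z1, z2] with i hi h1 h2
  have s0 : (S i : ℂ) ≠ 0 := by exact_mod_cast hi.ne'
  have f1 : (1 - (β + κ i / S i)) / (1 - (β : ℂ)) = 1 + -(1 - β : ℂ)⁻¹ * (κ i / S i) := by
    field_simp
    ring
  have f2 : (β + κ i / S i) / (β : ℂ) = 1 + (β : ℂ)⁻¹ * (κ i / S i) := by
    field_simp
  have zp : ∀ (x : ℂ) (k : ℤ), x ≠ 0 → x ^ k = Complex.exp (k * Complex.log x) := by
    intro x k hx
    rw [Complex.exp_int_mul, Complex.exp_log hx]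
  simp only [Function.comp, Phi]
  rw [f1, f2, zp _ _ h1, zp _ _ h2, ← Complex.exp_add, ← Complex.exp_add]
  congr 1
  push_cast
  generalize Complex.log (1 + -(1 - β : ℂ)⁻¹ * (κ i / S i)) = X1
  generalize Complex.log (1 + (β : ℂ)⁻¹ * (κ i / S i)) = X2
  field_simp
  ring

theorem Phi_bdd {S t : ℝ → ℝ} {n m : ℝ → ℤ} {β u d e q : ℝ}
    (hβ0 : 0 < β) (hβ1 : β < 1) (h : Reg atTop S t n m β u d e q) (R : ℝ) :
    ∃ C, ∀ᶠ T in atTop, ∀ k : ℂ, ‖k‖ ≤ R →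
      ‖Phi (t T) (n T) (m T) β (β + k / S T)‖ ≤ C := by
  obtain ⟨L, hL⟩ : ∃ L : ℂ → ℂ, L = fun κ0 : ℂ =>
    Complex.exp (e * κ0 + q * κ0 ^ 2 - ((u / (3 * β * (1 - β)) : ℝ) : ℂ) * κ0 ^ 3) := ⟨_, rfl⟩
  have hLc : Continuous L := by rw [hL]; fun_prop
  obtain ⟨C, hC⟩ := (isCompact_closedBall (0 : ℂ) R).exists_bound_of_continuousOn hLc.continuousOn
  refine ⟨C + 1, ?_⟩
  obtain ⟨Q, hQ⟩ : ∃ Q : ℝ × ℂ → ℝ, Q = fun x =>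
    ‖Phi (t x.1) (n x.1) (m x.1) β (β + x.2 / S x.1)‖ := ⟨_, rfl⟩
  have key : ∀ k ∈ Metric.closedBall (0 : ℂ) R, {x : ℝ × ℂ | Q x ≤ C + 1} ∈ atTop ×ˢ nhds k := by
    intro k hk
    have h1 := (Phi_lim hβ0 hβ1 (h.comp (tendsto_fst (f := atTop) (g := nhds k)))
      (κ := fun x => x.2) (κ0 := k) tendsto_snd).norm
    have h3 : Tendsto Q (atTop ×ˢ nhds k) (nhds ‖L k‖) := by
      rw [hQ, hL]; exact h1
    have h2 := h3.eventually (gt_mem_nhds (lt_of_le_of_lt (hC k hk) (lt_add_one C)))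
    filter_upwards [h2] with x hx using hx.le
  have k2 : {x : ℝ × ℂ | Q x ≤ C + 1} ∈
      (atTop : Filter ℝ) ×ˢ nhdsSet (Metric.closedBall (0 : ℂ) R) :=
    (isCompact_closedBall (0 : ℂ) R).mem_prod_nhdsSet_of_forall key
  obtain ⟨U, hU, V, hV, hUV⟩ := mem_prod_iff.1 k2
  filter_upwards [hU] with T hT k hk
  have h5 : Q (T, k) ≤ C + 1 :=
    hUV (Set.mk_mem_prod hT (subset_of_mem_nhdsSet hV (by simpa using hk)))
  rw [hQ] at h5
  exact h5

theorem circ_rescale {f : ℂ → ℂ} {r S : ℝ} (hS : 0 < S) :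
    (S : ℂ) * (∮ z in C((0 : ℂ), r), f z) = ∫ y : ℝ, (Set.Ioc (-(π * S)) (π * S)).indicator
      (fun y => I * circleMap 0 r (y / S) * f (circleMap 0 r (y / S))) y := by
  rw [integral_indicator measurableSet_Ioc, ← intervalIntegral.integral_of_le
    (by have := mul_pos Real.pi_pos hS; linarith)]
  rw [intervalIntegral.integral_comp_div (fun x => I * circleMap 0 r x * f (circleMap 0 r x)) hS.ne']
  have e1 : -(π * S) / S = -π := by field_simp
  have e2 : π * S / S = -π + 2 * π := by field_simp; ring
  rw [e1, e2]
  have hp : Function.Periodic (fun x => I * circleMap 0 r x * f (circleMap 0 r x)) (2 * π) := by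
    intro x
    simp only [periodic_circleMap 0 r x]
  rw [hp.intervalIntegral_add_eq (-π) 0, zero_add]
  unfold circleIntegral
  simp only [deriv_circleMap, smul_eq_mul, Complex.real_smul]
  congr 1
  congr 1
  ext x
  ring

theorem circ_lim {S r : ℝ → ℝ} {β : ℝ} (hS : Tendsto S atTop atTop) (hr : Tendsto r atTop (nhds β))
    {H : ℝ → ℂ → ℂ} {h : ℝ → ℂ} {g : ℝ → ℝ} (hg : Integrable g)
    (hc : ∀ᶠ T in atTop, Continuous (fun θ : ℝ => H T (circleMap 0 (r T) θ)))
    (hb : ∀ᶠ T in atTop, ∀ y, |y| ≤ π * S T → ‖H T (circleMap 0 (r T) (y / S T))‖ ≤ g y)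
    (hl : ∀ y, Tendsto (fun T => H T (circleMap 0 (r T) (y / S T))) atTop (nhds (h y))) :
    Tendsto (fun T => (S T : ℂ) * ∮ z in C((0 : ℂ), r T), H T z) atTop
      (nhds (I * β * ∫ y, h y)) := by
  have hcong : (fun T => ∫ y : ℝ, (Set.Ioc (-(π * S T)) (π * S T)).indicator
      (fun y => I * circleMap 0 (r T) (y / S T) * H T (circleMap 0 (r T) (y / S T))) y) =ᶠ[atTop]
      (fun T => (S T : ℂ) * ∮ z in C((0 : ℂ), r T), H T z) := by
    filter_upwards [hS.eventually_gt_atTop 0] with T hT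
    rw [circ_rescale hT]
  refine Tendsto.congr' hcong ?_
  rw [← integral_const_mul]
  have hrb : ∀ᶠ T in atTop, |r T| ≤ |β| + 1 := by
    have := (hr.abs).eventually (gt_mem_nhds (lt_add_one |β|))
    filter_upwards [this] with T hT using hT.le
  apply tendsto_integral_filter_of_dominated_convergence (fun y => (|β| + 1) * |g y|)
  · filter_upwards [hc] with T hT
    apply AEStronglyMeasurable.indicator _ measurableSet_Ioc
    apply Continuous.aestronglyMeasurable
    exact (continuous_const.mul ((continuous_circleMap 0 (r T)).comp (continuous_id.div_const _))).mul
      (hT.comp (continuous_id.div_const (S T)))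
  · filter_upwards [hb, hrb] with T hT hrT
    apply Eventually.of_forall
    intro y
    rw [Set.indicator_apply]
    split_ifs with hy
    · rw [norm_mul, norm_mul, Complex.norm_I, one_mul, norm_circleMap_zero]
      exact mul_le_mul hrT ((hT y (abs_le.2 ⟨by linarith [hy.1], hy.2⟩)).trans (le_abs_self _))
        (norm_nonneg _) (by positivity)
    · rw [norm_zero]; positivity
  · exact hg.abs.const_mul _
  · apply Eventually.of_forall
    intro y
    have h1 : Tendsto (fun T => I * circleMap 0 (r T) (y / S T) * H T (circleMap 0 (r T) (y / S T)))
        atTop (nhds (I * β * h y)) := by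
      refine Tendsto.mul (tendsto_const_nhds.mul ?_) (hl y)
      have a1 : Tendsto (fun T => y / S T) atTop (nhds 0) := tendsto_const_nhds.div_atTop hS
      have a2 : Tendsto (fun T => (r T : ℂ) * Complex.exp ((y / S T : ℝ) * I)) atTop
          (nhds ((β : ℂ) * Complex.exp (((0 : ℝ) : ℂ) * I))) :=
        ((Complex.continuous_ofReal.tendsto _).comp hr).mul
          (((by fun_prop : Continuous (fun x : ℝ => Complex.exp ((x : ℂ) * I))).tendsto 0).comp a1)
      simp only [Complex.ofReal_zero, zero_mul, Complex.exp_zero, mul_one] at a2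
      refine a2.congr (fun T => ?_)
      simp [circleMap]
    refine h1.congr' ?_
    have hy1 : ∀ᶠ T in atTop, |y| < π * S T :=
      (hS.const_mul_atTop Real.pi_pos).eventually_gt_atTop _
    filter_upwards [hy1] with T hT
    rw [Set.indicator_of_mem]
    exact ⟨by linarith [neg_abs_le y], by linarith [le_abs_self y]⟩

theorem circ_bound {f : ℂ → ℂ} {r S : ℝ} (hS : 0 < S) (hr : 0 ≤ r) {g : ℝ → ℝ} (hg : Integrable g)
    (hg0 : ∀ y, 0 ≤ g y)
    (hb : ∀ y, |y| ≤ π * S → ‖f (circleMap 0 r (y / S))‖ ≤ g y) :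
    ‖(S : ℂ) * (∮ z in C((0 : ℂ), r), f z)‖ ≤ r * ∫ y, g y := by
  rw [circ_rescale hS, ← integral_const_mul]
  apply norm_integral_le_of_norm_le (hg.const_mul r)
  apply Eventually.of_forall
  intro y
  rw [Set.indicator_apply]
  split_ifs with hy
  · rw [norm_mul, norm_mul, Complex.norm_I, one_mul, norm_circleMap_zero, abs_of_nonneg hr]
    exact mul_le_mul_of_nonneg_left (hb y (abs_le.2 ⟨by linarith [hy.1], hy.2⟩)) hr
  · rw [norm_zero]
    exact mul_nonneg hr (hg0 y)

theorem kappa_lim {S : ℝ → ℝ} (hS : Tendsto S atTop atTop) (β b y : ℝ) :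
    Tendsto (fun T => (S T : ℂ) * (circleMap 0 (β - b / S T) (y / S T) - β)) atTop
      (nhds (-b + I * β * y)) := by
  have hSi : Tendsto (fun T => (((S T)⁻¹ : ℝ) : ℂ)) atTop (nhds ((0 : ℝ) : ℂ)) :=
    (Complex.continuous_ofReal.tendsto _).comp (tendsto_inv_atTop_zero.comp hS)
  rw [Complex.ofReal_zero] at hSi
  have h0 : Tendsto (fun T => (S T : ℂ) * (Complex.exp (y * I * ((S T)⁻¹ : ℝ)) - 1)) atTop
      (nhds (y * I)) := by
    have h1 : Tendsto (fun T => (S T : ℂ) * (Complex.exp (y * I * ((S T)⁻¹ : ℝ)) - 1) - y * I) atTop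
        (nhds 0) := by
      have hb : Tendsto (fun T => |y| ^ 2 * (S T)⁻¹) atTop (nhds 0) := by
        have := (tendsto_inv_atTop_zero.comp hS).const_mul (|y| ^ 2)
        rwa [mul_zero] at this
      apply squeeze_zero_norm' _ hb
      filter_upwards [hS.eventually_gt_atTop 0, hS.eventually_gt_atTop |y|] with T h1 h2
      have nx : ‖(y : ℂ) * I * ((S T)⁻¹ : ℝ)‖ = |y| * (S T)⁻¹ := by
        rw [norm_mul, norm_mul, Complex.norm_I, Complex.norm_real, Complex.norm_real,
          Real.norm_eq_abs, Real.norm_eq_abs, abs_of_pos (inv_pos.2 h1), mul_one]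
      have h3 := Complex.norm_exp_sub_one_sub_id_le (x := (y : ℂ) * I * ((S T)⁻¹ : ℝ)) (by
        rw [nx, ← div_eq_mul_inv, div_le_one h1]; exact h2.le)
      have s0 : (S T : ℂ) ≠ 0 := by exact_mod_cast h1.ne'
      have e : (S T : ℂ) * (Complex.exp (y * I * ((S T)⁻¹ : ℝ)) - 1) - y * I =
          (S T : ℂ) * (Complex.exp (y * I * ((S T)⁻¹ : ℝ)) - 1 - y * I * ((S T)⁻¹ : ℝ)) := by
        push_cast
        field_simp
      rw [e, norm_mul, Complex.norm_real, Real.norm_eq_abs, abs_of_pos h1]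
      rw [nx] at h3
      calc S T * _ ≤ S T * (|y| * (S T)⁻¹) ^ 2 := mul_le_mul_of_nonneg_left h3 h1.le
        _ = _ := by field_simp
    have := h1.add_const (y * I : ℂ)
    simpa using this
  have hr : Tendsto (fun T => ((β : ℂ) - b * (((S T)⁻¹ : ℝ) : ℂ))) atTop (nhds ((β : ℂ) - b * 0)) :=
    tendsto_const_nhds.sub (hSi.const_mul _)
  have ht := (hr.mul h0).sub_const (b : ℂ)
  have e : ((β : ℂ) - b * 0) * (y * I) - b = -b + I * β * y := by ring
  rw [e] at ht
  refine ht.congr' ?_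
  filter_upwards [hS.eventually_gt_atTop 0] with T h1
  have s0 : (S T : ℂ) ≠ 0 := by exact_mod_cast h1.ne'
  have ee : Complex.exp (y * I * ((S T)⁻¹ : ℝ)) = Complex.exp (((y / S T : ℝ) : ℂ) * I) := by
    congr 1
    push_cast
    ring
  rw [ee]
  simp only [circleMap, zero_add]
  push_cast
  field_simp
  ring

theorem Phi_abs_le (t : ℝ) (n m : ℤ) {β r : ℝ} (hβ0 : 0 < β) (hβ1 : β < 1) (hr0 : 0 < r)
    (hr1 : r < 1) (hn : 0 ≤ n) (φ : ℝ) :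
    ‖Phi t n m β (circleMap 0 r φ)‖ ≤ ‖Phi t n m β (β + ((r - β : ℝ) : ℂ))‖ *
      Real.exp (-(r * (1 - Real.cos φ) * (t - n / (1 - r) ^ 2))) := by
  have hw : circleMap 0 r φ = ((r * Real.cos φ : ℝ) : ℂ) + ((r * Real.sin φ : ℝ) : ℂ) * I := by
    simp only [circleMap, zero_add]
    rw [Complex.exp_mul_I]
    push_cast
    ring
  have hre : (β : ℂ) + ((r - β : ℝ) : ℂ) = (r : ℂ) := by push_cast; ring
  rw [hre]
  have nβ : ‖(1 : ℂ) - β‖ = 1 - β := by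
    rw [← Complex.ofReal_one, ← Complex.ofReal_sub, Complex.norm_real, Real.norm_eq_abs,
      abs_of_pos (by linarith)]
  have nr : ‖(1 : ℂ) - r‖ = 1 - r := by
    rw [← Complex.ofReal_one, ← Complex.ofReal_sub, Complex.norm_real, Real.norm_eq_abs,
      abs_of_pos (by linarith)]
  unfold Phi
  simp only [norm_mul, norm_zpow, norm_div, norm_circleMap_zero, nβ, nr, Complex.norm_real,
    Real.norm_eq_abs, abs_of_pos hr0, abs_of_pos hβ0, Complex.norm_exp]
  have r1 : ((t : ℂ) * (circleMap 0 r φ - β)).re = t * (r * Real.cos φ - β) := by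
    rw [hw]
    generalize r * Real.cos φ = x1
    generalize r * Real.sin φ = x2
    simp
  have r2 : ((t : ℂ) * ((r : ℂ) - β)).re = t * (r - β) := by
    simp
  rw [r1, r2]
  have hc : 0 ≤ 1 - Real.cos φ := by linarith [Real.cos_le_one φ]
  have hsq : ‖1 - circleMap 0 r φ‖ ^ 2 = (1 - r) ^ 2 + 2 * r * (1 - Real.cos φ) := by
    have e0 : (r * Real.cos φ) ^ 2 + (r * Real.sin φ) ^ 2 = r ^ 2 := by
      have := Real.sin_sq_add_cos_sq φ
      calc _ = r ^ 2 * (Real.sin φ ^ 2 + Real.cos φ ^ 2) := by ring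
        _ = _ := by rw [this, mul_one]
    have e1 : (1 - r) ^ 2 + 2 * r * (1 - Real.cos φ) = 1 + r ^ 2 - 2 * (r * Real.cos φ) := by ring
    rw [← Complex.normSq_eq_norm_sq, hw, Complex.normSq_apply, e1]
    generalize r * Real.cos φ = x1 at *
    generalize r * Real.sin φ = x2 at *
    simp
    nlinarith
  have h1r : 0 < 1 - r := by linarith
  have hq : ‖1 - circleMap 0 r φ‖ / (1 - r) ≤
      Real.exp (r * (1 - Real.cos φ) / (1 - r) ^ 2) := by
    have h0 : (‖1 - circleMap 0 r φ‖ / (1 - r)) ^ 2 ≤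
        (Real.exp (r * (1 - Real.cos φ) / (1 - r) ^ 2)) ^ 2 := by
      rw [div_pow, hsq, ← Real.exp_nat_mul]
      have : ((1 - r) ^ 2 + 2 * r * (1 - Real.cos φ)) / (1 - r) ^ 2 =
          ((2 : ℕ) : ℝ) * (r * (1 - Real.cos φ) / (1 - r) ^ 2) + 1 := by
        push_cast
        field_simp
        ring
      rw [this]
      exact Real.add_one_le_exp _
    exact le_of_sq_le_sq h0 (Real.exp_pos _).le
  have hq2 : (‖1 - circleMap 0 r φ‖ / (1 - β)) ^ n ≤ ((1 - r) / (1 - β)) ^ n *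
      Real.exp (n * (r * (1 - Real.cos φ) / (1 - r) ^ 2)) := by
    have : ‖1 - circleMap 0 r φ‖ / (1 - β) = ((1 - r) / (1 - β)) *
        (‖1 - circleMap 0 r φ‖ / (1 - r)) := by
      have : 1 - β ≠ 0 := by linarith
      field_simp
    have hex : Real.exp (n * (r * (1 - Real.cos φ) / (1 - r) ^ 2)) =
        Real.exp (r * (1 - Real.cos φ) / (1 - r) ^ 2) ^ n := by
      lift n to ℕ using hn
      rw [zpow_natCast, ← Real.exp_nat_mul, Int.cast_natCast]
    rw [this, mul_zpow, hex]
    have hx : 0 ≤ (1 - r) / (1 - β) := div_nonneg h1r.le (by linarith)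
    apply mul_le_mul_of_nonneg_left _ (zpow_nonneg hx _)
    exact zpow_le_zpow_left₀ hn (by positivity) hq
  have e1 : Real.exp (t * (r * Real.cos φ - β)) *
      Real.exp (n * (r * (1 - Real.cos φ) / (1 - r) ^ 2)) = Real.exp (t * (r - β)) *
      Real.exp (-(r * (1 - Real.cos φ) * (t - n / (1 - r) ^ 2))) := by
    rw [← Real.exp_add, ← Real.exp_add]
    congr 1
    ring
  have hz : 0 ≤ (r / β) ^ (-m) := zpow_nonneg (div_nonneg hr0.le hβ0.le) _
  calc Real.exp (t * (r * Real.cos φ - β)) * (‖1 - circleMap 0 r φ‖ / (1 - β)) ^ n * (r / β) ^ (-m)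
      ≤ Real.exp (t * (r * Real.cos φ - β)) * (((1 - r) / (1 - β)) ^ n *
      Real.exp (n * (r * (1 - Real.cos φ) / (1 - r) ^ 2))) * (r / β) ^ (-m) := by
        apply mul_le_mul_of_nonneg_right _ hz
        exact mul_le_mul_of_nonneg_left hq2 (Real.exp_pos _).le
    _ = (Real.exp (t * (r * Real.cos φ - β)) *
      Real.exp (n * (r * (1 - Real.cos φ) / (1 - r) ^ 2))) * (((1 - r) / (1 - β)) ^ n *
       (r / β) ^ (-m)) := by ring
    _ = _ := by rw [e1]; ring

theorem Phi_dom {S t : ℝ → ℝ} {n m : ℝ → ℤ} {β u d e q : ℝ}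
    (hβ0 : 0 < β) (hβ1 : β < 1) (hu : 0 < u) (h : Reg atTop S t n m β u d e q) (b : ℝ)
    (hb : 0 < d + 2 * u * b / (1 - β)) :
    ∃ C c, 0 ≤ C ∧ 0 < c ∧ ∀ᶠ T in atTop, ∀ y : ℝ, |y| ≤ π * S T →
      ‖Phi (t T) (n T) (m T) β (circleMap 0 (β - b / S T) (y / S T))‖ ≤ C * Real.exp (-c * y ^ 2) := by
  obtain ⟨C, hC⟩ := Phi_bdd hβ0 hβ1 h ‖(-b : ℂ)‖
  set D := d + 2 * u * b / (1 - β) with hD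
  have hβ1' : 0 < 1 - β := by linarith
  have hbS : Tendsto (fun T => b / S T) atTop (nhds 0) := tendsto_const_nhds.div_atTop h.hS
  have hr : Tendsto (fun T => β - b / S T) atTop (nhds β) := by
    have := hbS.const_sub β
    rwa [sub_zero] at this
  have hX : Tendsto (fun T => (t T - n T / (1 - (β - b / S T)) ^ 2) / S T ^ 2) atTop (nhds D) := by
    have l1 : Tendsto (fun T => (2 * (1 - β) * b + b * (b / S T)) /
        ((1 - β) ^ 2 * (1 - (β - b / S T)) ^ 2)) atTop
        (nhds ((2 * (1 - β) * b + b * 0) / ((1 - β) ^ 2 * (1 - β) ^ 2))) := by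
      refine Tendsto.div ?_ ?_ (by positivity)
      · exact (hbS.const_mul b).const_add _
      · exact ((hr.const_sub 1).pow 2).const_mul _
    have l2 := h.hd.add (h.hn.mul l1)
    have e1 : d + (1 - β) ^ 2 * u * ((2 * (1 - β) * b + b * 0) / ((1 - β) ^ 2 * (1 - β) ^ 2)) = D := by
      rw [hD]
      field_simp
      ring
    rw [e1] at l2
    refine l2.congr' ?_
    filter_upwards [h.hS.eventually_gt_atTop 0, hr.eventually (gt_mem_nhds hβ1)] with T h1 h2
    have h3 : 1 - (β - b / S T) ≠ 0 := by linarith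
    have h4 : b / S T = (1 - (β - b / S T)) - (1 - β) := by ring
    have h5 : b = S T * ((1 - (β - b / S T)) - (1 - β)) := by field_simp; ring
    generalize 1 - (β - b / S T) = x at *
    rw [h4, h5]
    field_simp
    ring
  refine ⟨max C 0, β * D / (2 * π ^ 2), le_max_right _ _, by positivity, ?_⟩
  have hn0 : ∀ᶠ T in atTop, 0 < (n T : ℝ) / S T ^ 3 :=
    h.hn.eventually (lt_mem_nhds (by positivity))
  filter_upwards [hC, h.hS.eventually_gt_atTop 0, hr.eventually (gt_mem_nhds hβ1),
    hr.eventually (lt_mem_nhds (half_lt_self hβ0)), hX.eventually (lt_mem_nhds (half_lt_self hb)), hn0]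
    with T h1 h2 h3 h4 h5 h6 y hy
  have hn : 0 ≤ n T := by
    have : 0 < (n T : ℝ) := by
      rcases div_pos_iff.1 h6 with h | h
      · exact h.1
      · have : 0 < S T ^ 3 := by positivity
        linarith [h.2]
    exact_mod_cast this.le
  have hr0 : 0 < β - b / S T := by linarith
  refine (Phi_abs_le (t T) (n T) (m T) hβ0 hβ1 hr0 h3 hn (y / S T)).trans ?_
  have k1 : ‖Phi (t T) (n T) (m T) β (β + ((β - b / S T - β : ℝ) : ℂ))‖ ≤ max C 0 := by
    have := h1 (-b) le_rfl
    have e : (-b : ℂ) / S T = ((β - b / S T - β : ℝ) : ℂ) := by push_cast; ring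
    rw [e] at this
    exact this.trans (le_max_left _ _)
  refine mul_le_mul k1 ?_ (Real.exp_pos _).le (le_max_right _ _)
  apply Real.exp_le_exp.2
  have hc : 2 / π ^ 2 * (y / S T) ^ 2 ≤ 1 - Real.cos (y / S T) := by
    have := Real.cos_le_one_sub_mul_cos_sq (x := y / S T) (by
      rw [abs_div, abs_of_pos h2, div_le_iff₀ h2]; exact hy)
    linarith
  have hX2 : t T - n T / (1 - (β - b / S T)) ^ 2 =
      S T ^ 2 * ((t T - n T / (1 - (β - b / S T)) ^ 2) / S T ^ 2) := by field_simp
  have hge : S T ^ 2 * (D / 2) ≤ t T - n T / (1 - (β - b / S T)) ^ 2 := by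
    rw [hX2]
    exact mul_le_mul_of_nonneg_left h5.le (by positivity)
  have : β * D / (2 * π ^ 2) * y ^ 2 ≤
      (β - b / S T) * (1 - Real.cos (y / S T)) * (t T - n T / (1 - (β - b / S T)) ^ 2) := by
    calc β * D / (2 * π ^ 2) * y ^ 2 = (β / 2) * (2 / π ^ 2 * (y / S T) ^ 2) * (S T ^ 2 * (D / 2)) := by
          field_simp
      _ ≤ _ := by
          apply mul_le_mul _ hge (by positivity)
          · exact mul_nonneg hr0.le (by linarith [Real.cos_le_one (y / S T)])
          · exact mul_le_mul h4.le hc (by positivity) hr0.le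
  linarith

/-- the limiting exponential -/
def fE (e q c : ℝ) (κ : ℂ) : ℂ := Complex.exp (e * κ + q * κ ^ 2 - (c : ℂ) * κ ^ 3)

theorem poly_exp (k : ℕ) {c : ℝ} (hc : 0 < c) (y : ℝ) :
    (1 + |y|) ^ k * Real.exp (-c * y ^ 2) ≤
      Real.exp (k ^ 2 / (2 * c)) * Real.exp (-(c / 2) * y ^ 2) := by
  have h1 : (1 + |y|) ^ k ≤ Real.exp (k * |y|) := by
    rw [Real.exp_nat_mul]
    exact pow_le_pow_left₀ (by positivity) (by linarith [Real.add_one_le_exp |y|]) k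
  have h2 : (k : ℝ) * |y| ≤ k ^ 2 / (2 * c) + c / 2 * y ^ 2 := by
    have e : (k : ℝ) ^ 2 / (2 * c) + c / 2 * y ^ 2 - k * |y| = (k - c * |y|) ^ 2 / (2 * c) := by
      rw [← sq_abs y]
      field_simp
      ring
    have : 0 ≤ (k - c * |y|) ^ 2 / (2 * c) := by positivity
    linarith
  calc (1 + |y|) ^ k * Real.exp (-c * y ^ 2) ≤ Real.exp (k * |y|) * Real.exp (-c * y ^ 2) :=
        mul_le_mul_of_nonneg_right h1 (Real.exp_pos _).le
    _ = Real.exp (k * |y| + -c * y ^ 2) := (Real.exp_add _ _).symm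
    _ ≤ Real.exp (k ^ 2 / (2 * c) + -(c / 2) * y ^ 2) := by
        apply Real.exp_le_exp.2
        nlinarith
    _ = _ := Real.exp_add _ _

theorem circ_cont {f : ℂ → ℂ} {r : ℝ} (hr : 0 ≤ r) (hf : ContinuousOn f (Metric.sphere 0 r)) :
    Continuous (fun θ : ℝ => f (circleMap 0 r θ)) :=
  hf.comp_continuous (continuous_circleMap 0 r) (fun θ => circleMap_mem_sphere 0 hr θ)

theorem rad_lim {S : ℝ → ℝ} (hS : Tendsto S atTop atTop) (β b : ℝ) :
    Tendsto (fun T => β - b / S T) atTop (nhds β) := by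
  have := (tendsto_const_nhds.div_atTop hS : Tendsto (fun T => b / S T) atTop (nhds 0)).const_sub β
  rwa [sub_zero] at this

theorem Phi_cont (t : ℝ) (n m : ℤ) {β r : ℝ} (h0 : 0 < β) (h1 : β < 1) (hr : 0 < r) (hr1 : r < 1) :
    ContinuousOn (Phi t n m β) (Metric.sphere 0 r) := by
  intro z hz
  have hz' : ‖z‖ = r := by simpa using hz
  exact (Phi_diff t n m h0 h1 (by linarith) (by linarith)).continuousAt.continuousWithinAt

theorem P_lim {S t : ℝ → ℝ} {n m : ℝ → ℤ} {β u d e q : ℝ}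
    (hβ0 : 0 < β) (hβ1 : β < 1) (hu : 0 < u) (h : Reg atTop S t n m β u d e q) (b : ℝ)
    (hb : 0 < d + 2 * u * b / (1 - β)) {g : ℝ → ℂ → ℂ} {hh : ℝ → ℂ} {C : ℝ} (k : ℕ)
    (hgc : ∀ᶠ T in atTop, ContinuousOn (g T) (Metric.sphere 0 (β - b / S T)))
    (hgb : ∀ᶠ T in atTop, ∀ y : ℝ, |y| ≤ π * S T →
      ‖g T (circleMap 0 (β - b / S T) (y / S T))‖ ≤ C * (1 + |y|) ^ k)
    (hgl : ∀ y : ℝ, Tendsto (fun T => g T (circleMap 0 (β - b / S T) (y / S T))) atTop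
      (nhds (hh y))) :
    Tendsto (fun T => (S T : ℂ) * ∮ z in C((0 : ℂ), β - b / S T),
      Phi (t T) (n T) (m T) β z * g T z) atTop
      (nhds (I * β * ∫ y : ℝ, fE e q (u / (3 * β * (1 - β))) (-b + I * β * y) * hh y)) := by
  obtain ⟨C1, c, hC1, hc, hdom⟩ := Phi_dom hβ0 hβ1 hu h b hb
  have hr := rad_lim h.hS β b
  have hr0 := hr.eventually (lt_mem_nhds hβ0)
  have hr1 := hr.eventually (gt_mem_nhds hβ1)
  refine circ_lim (H := fun T z => Phi (t T) (n T) (m T) β z * g T z) h.hS hr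
    (g := fun y => (C1 * |C| * Real.exp (k ^ 2 / (2 * c))) *
    Real.exp (-(c / 2) * y ^ 2)) ((integrable_exp_neg_mul_sq (by positivity)).const_mul _) ?_ ?_ ?_
  · filter_upwards [hgc, hr0, hr1] with T h1 h2 h3
    exact circ_cont h2.le ((Phi_cont _ _ _ hβ0 hβ1 h2 h3).mul h1)
  · filter_upwards [hgb, hdom] with T h1 h2 y hy
    rw [norm_mul]
    calc _ ≤ (C1 * Real.exp (-c * y ^ 2)) * (|C| * (1 + |y|) ^ k) := by
          refine mul_le_mul (h2 y hy) ((h1 y hy).trans ?_) (norm_nonneg _) (by positivity)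
          exact mul_le_mul_of_nonneg_right (le_abs_self _) (by positivity)
      _ = C1 * |C| * ((1 + |y|) ^ k * Real.exp (-c * y ^ 2)) := by ring
      _ ≤ C1 * |C| * (Real.exp (k ^ 2 / (2 * c)) * Real.exp (-(c / 2) * y ^ 2)) :=
          mul_le_mul_of_nonneg_left (poly_exp k hc y) (by positivity)
      _ = _ := by ring
  · intro y
    refine Tendsto.mul ?_ (hgl y)
    have := Phi_lim hβ0 hβ1 h (kappa_lim h.hS β b y)
    refine this.congr' ?_
    filter_upwards [h.hS.eventually_gt_atTop 0] with T hT
    congr 1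
    have : (S T : ℂ) ≠ 0 := by exact_mod_cast hT.ne'
    field_simp
    ring

theorem P_bound {S t : ℝ → ℝ} {n m : ℝ → ℤ} {β u d e q : ℝ}
    (hβ0 : 0 < β) (hβ1 : β < 1) (hu : 0 < u) (h : Reg atTop S t n m β u d e q) (b : ℝ)
    (hb : 0 < d + 2 * u * b / (1 - β)) :
    ∃ K, 0 ≤ K ∧ ∀ᶠ T in atTop, ∀ (g : ℂ → ℂ) (C : ℝ), 0 ≤ C → (∀ y : ℝ, |y| ≤ π * S T →
      ‖g (circleMap 0 (β - b / S T) (y / S T))‖ ≤ C) →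
      ‖(S T : ℂ) * ∮ z in C((0 : ℂ), β - b / S T), Phi (t T) (n T) (m T) β z * g z‖ ≤ K * C := by
  obtain ⟨C1, c, hC1, hc, hdom⟩ := Phi_dom hβ0 hβ1 hu h b hb
  have hr := rad_lim h.hS β b
  have hr0 := hr.eventually (lt_mem_nhds hβ0)
  have hr1 := hr.eventually (gt_mem_nhds hβ1)
  have hintg : Integrable (fun y : ℝ => C1 * Real.exp (-c * y ^ 2)) :=
    (integrable_exp_neg_mul_sq hc).const_mul _
  have hnn : ∀ y : ℝ, 0 ≤ C1 * Real.exp (-c * y ^ 2) := fun y => by positivity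
  refine ⟨∫ y : ℝ, C1 * Real.exp (-c * y ^ 2), integral_nonneg hnn, ?_⟩
  filter_upwards [hdom, hr0, hr1, h.hS.eventually_gt_atTop 0] with T h1 h2 h3 h4 g C hC hg
  have := circ_bound h4 h2.le (f := fun z => Phi (t T) (n T) (m T) β z * g z)
    (g := fun y => (C1 * Real.exp (-c * y ^ 2)) * C) (hintg.mul_const C)
    (fun y => mul_nonneg (hnn y) hC) (fun y hy => by
      rw [norm_mul]
      exact mul_le_mul (h1 y hy) (hg y hy) (norm_nonneg _) (hnn y))
  refine this.trans ?_
  rw [integral_mul_const]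
  have h5 : 0 ≤ (∫ y : ℝ, C1 * Real.exp (-c * y ^ 2)) * C := mul_nonneg (integral_nonneg hnn) hC
  nlinarith

theorem circ_near {S β b y : ℝ} (hS : 0 < S) (hr : 0 ≤ β - b / S) (hr1 : β - b / S ≤ 1) :
    ‖(S : ℂ) * (circleMap 0 (β - b / S) (y / S) - β)‖ ≤ (|b| + 1) * (1 + |y|) := by
  have h1 : ‖Complex.exp (((y / S : ℝ) : ℂ) * I) - 1‖ ≤ |y| / S := by
    have := Real.norm_exp_I_mul_ofReal_sub_one_le (x := y / S)
    rw [mul_comm]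
    refine this.trans ?_
    rw [Real.norm_eq_abs, abs_div, abs_of_pos hS]
  have e : (S : ℂ) * (circleMap 0 (β - b / S) (y / S) - β) =
      (S : ℂ) * (((β - b / S : ℝ) : ℂ) * (Complex.exp (((y / S : ℝ) : ℂ) * I) - 1)) - b := by
    have : (S : ℂ) ≠ 0 := by exact_mod_cast hS.ne'
    simp only [circleMap, zero_add]
    push_cast
    field_simp
    ring
  rw [e]
  refine (norm_sub_le _ _).trans ?_
  rw [norm_mul, norm_mul, Complex.norm_real, Complex.norm_real, Complex.norm_real, Real.norm_eq_abs,
    Real.norm_eq_abs, Real.norm_eq_abs, abs_of_pos hS, abs_of_nonneg hr]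
  have h2 : S * ((β - b / S) * ‖Complex.exp (((y / S : ℝ) : ℂ) * I) - 1‖) ≤ |y| := by
    calc _ ≤ S * (1 * (|y| / S)) := by gcongr
      _ = |y| := by field_simp
  nlinarith [abs_nonneg b, abs_nonneg y]

theorem circ_tend {S : ℝ → ℝ} (hS : Tendsto S atTop atTop) (β b y : ℝ) :
    Tendsto (fun T => circleMap 0 (β - b / S T) (y / S T)) atTop (nhds (β : ℂ)) := by
  have hSi : Tendsto (fun T => (((S T)⁻¹ : ℝ) : ℂ)) atTop (nhds ((0 : ℝ) : ℂ)) :=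
    (Complex.continuous_ofReal.tendsto _).comp (tendsto_inv_atTop_zero.comp hS)
  have := ((hSi.mul (kappa_lim hS β b y)).add_const (β : ℂ))
  rw [Complex.ofReal_zero, zero_mul, zero_add] at this
  refine this.congr' ?_
  filter_upwards [hS.eventually_gt_atTop 0] with T hT
  have : (S T : ℂ) ≠ 0 := by exact_mod_cast hT.ne'
  push_cast
  field_simp
  ring

theorem aj_lim {S t : ℝ → ℝ} {n m : ℝ → ℤ} {α u d e q : ℝ}
    (hβ0 : 0 < α) (hβ1 : α < 1) (hu : 0 < u) (h : Reg atTop S t n m α u d e q) (b : ℝ)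
    (hb : 0 < d + 2 * u * b / (1 - α)) (j : ℕ) :
    Tendsto (fun T => (S T : ℂ) ^ (j + 1) * ajI α (AF α (t T) (n T) (m T)) j (α - b / S T)) atTop
      (nhds (I * α * ∫ y : ℝ, fE e q (u / (3 * α * (1 - α))) (-b + I * α * y) *
        ((α : ℂ)⁻¹ * (α * (-b + I * α * y)) ^ j))) := by
  have hr := rad_lim h.hS α b
  have hr0 := hr.eventually (lt_mem_nhds (half_lt_self hβ0))
  have hr1 := hr.eventually (gt_mem_nhds hβ1)
  have := P_lim hβ0 hβ1 hu h b hb (g := fun T w => w⁻¹ * (w * (S T * (w - α))) ^ j)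
    (hh := fun y => (α : ℂ)⁻¹ * (α * (-b + I * α * y)) ^ j) (C := (α / 2)⁻¹ * (|b| + 1) ^ j) j ?_ ?_ ?_
  · refine this.congr (fun T => ?_)
    unfold ajI AF
    rw [pow_succ, mul_comm (_ ^ j), mul_assoc, ← circleIntegral.integral_const_mul ((S T : ℂ) ^ j)]
    refine congrArg _ (congrArg (fun f : ℂ → ℂ => circleIntegral f 0 (α - b / S T)) (funext fun w => ?_))
    simp only [mul_pow]
    ring
  · filter_upwards [hr0] with T h1 z hz
    have hz' : ‖z‖ = α - b / S T := by simpa using hz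
    have hz0 : z ≠ 0 := by
      rintro rfl
      rw [norm_zero] at hz'
      linarith
    have : DifferentiableAt ℂ (fun w : ℂ => w⁻¹ * (w * (S T * (w - α))) ^ j) z :=
      DifferentiableAt.mul (DifferentiableAt.inv (by fun_prop) hz0) (by fun_prop)
    exact this.continuousAt.continuousWithinAt
  · filter_upwards [hr0, hr1, h.hS.eventually_gt_atTop 0] with T h1 h2 h3 y hy
    have h4 : 0 < α - b / S T := by linarith
    rw [norm_mul, norm_inv, norm_pow, norm_mul, norm_circleMap_zero, abs_of_pos h4]
    have h5 := circ_near (y := y) h3 h4.le h2.le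
    have h6 : (α - b / S T)⁻¹ ≤ (α / 2)⁻¹ := by gcongr
    calc _ ≤ (α / 2)⁻¹ * (1 * ((|b| + 1) * (1 + |y|))) ^ j := by gcongr
      _ = _ := by rw [one_mul, mul_pow]; ring
  · intro y
    have h1 := circ_tend h.hS α b y
    exact (h1.inv₀ (by exact_mod_cast hβ0.ne')).mul ((h1.mul (kappa_lim h.hS α b y)).pow j)

theorem circ_neg (f : ℂ → ℂ) (r : ℝ) :
    (∮ z in C((0 : ℂ), r), f z) = -∮ z in C((0 : ℂ), r), f (-z) := by
  unfold circleIntegral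
  have hp : Function.Periodic (fun x => deriv (circleMap 0 r) x • f (circleMap 0 r x)) (2 * π) := by
    intro x
    simp only [deriv_circleMap, periodic_circleMap 0 r x]
  have h1 := hp.intervalIntegral_add_eq 0 π
  rw [zero_add] at h1
  have hneg : ∀ θ : ℝ, circleMap 0 r (θ + π) = -circleMap 0 r θ := by
    intro θ
    simp only [circleMap, zero_add]
    push_cast
    rw [add_mul, Complex.exp_add, Complex.exp_pi_mul_I]
    ring
  rw [h1, ← intervalIntegral.integral_neg]
  have h2 := intervalIntegral.integral_comp_add_right (a := 0) (b := 2 * π)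
    (fun x => deriv (circleMap 0 r) x • f (circleMap 0 r x)) π
  rw [zero_add, add_comm (2 * π) π] at h2
  rw [← h2]
  congr 1
  ext θ
  simp only [deriv_circleMap, hneg, smul_eq_mul]
  ring

theorem circ_scale (f : ℂ → ℂ) (c : ℂ) (r : ℝ) {S : ℝ} (hS : S ≠ 0) :
    (∮ z in C(c, r / S), f z) = ∮ ζ in C((0 : ℂ), r), (S : ℂ)⁻¹ * f (c + ζ / S) := by
  have hS' : (S : ℂ) ≠ 0 := by exact_mod_cast hS
  unfold circleIntegral
  congr 1
  ext θ
  have : circleMap c (r / S) θ = c + circleMap 0 r θ / S := by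
    simp only [circleMap, zero_add]
    push_cast
    ring
  simp only [deriv_circleMap, smul_eq_mul, this]
  simp only [circleMap, zero_add]
  push_cast
  field_simp

theorem circ_fix_lim {r : ℝ} {H : ℝ → ℂ → ℂ} {h : ℂ → ℂ} {C : ℝ}
    (hc : ∀ᶠ T in atTop, Continuous (fun θ : ℝ => H T (circleMap 0 r θ)))
    (hb : ∀ᶠ T in atTop, ∀ z : ℂ, ‖z‖ = |r| → ‖H T z‖ ≤ C)
    (hl : ∀ z : ℂ, ‖z‖ = |r| → Tendsto (fun T => H T z) atTop (nhds (h z))) :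
    Tendsto (fun T => ∮ z in C((0 : ℂ), r), H T z) atTop (nhds (∮ z in C((0 : ℂ), r), h z)) := by
  unfold circleIntegral
  apply intervalIntegral.tendsto_integral_filter_of_dominated_convergence (fun _ => |r| * C)
  · filter_upwards [hc] with T hT
    apply Continuous.aestronglyMeasurable
    simp only [deriv_circleMap]
    exact ((continuous_circleMap 0 r).mul continuous_const).smul hT
  · filter_upwards [hb] with T hT
    apply Eventually.of_forall
    intro θ _
    rw [norm_smul]
    have : ‖deriv (circleMap 0 r) θ‖ = |r| := by simp [deriv_circleMap]
    rw [this]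
    exact mul_le_mul_of_nonneg_left (hT _ (by simp)) (abs_nonneg _)
  · exact intervalIntegrable_const
  · apply Eventually.of_forall
    intro θ _
    exact (hl _ (by simp)).const_smul _

theorem Sinv_tend {S : ℝ → ℝ} (hS : Tendsto S atTop atTop) :
    Tendsto (fun T => ((S T : ℂ))⁻¹) atTop (nhds 0) := by
  have : Tendsto (fun T => (((S T)⁻¹ : ℝ) : ℂ)) atTop (nhds ((0 : ℝ) : ℂ)) :=
    (Complex.continuous_ofReal.tendsto _).comp (tendsto_inv_atTop_zero.comp hS)
  simpa using this

theorem qj_scale {α : ℝ} (j : ℕ) {S : ℂ} (hS : S ≠ 0) (k : ℂ) :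
    (S ^ (j + 1))⁻¹ * qj α j (α - 1 + k / S) =
      (α + 2 * (k / S)) / ((α + k / S) * k) ^ (j + 1) := by
  unfold qj
  have e1 : 2 * ((α : ℂ) - 1 + k / S) + 2 - α = α + 2 * (k / S) := by ring
  have e2 : ((α : ℂ) - 1 + k / S + 1) * ((α : ℂ) - 1 + k / S + 1 - α) =
      ((α + k / S) * k) / S := by
    field_simp
    ring
  rw [e1, e2, div_pow]
  have : S ^ (j + 1) ≠ 0 := pow_ne_zero _ hS
  field_simp

theorem qj_scale_lim {α : ℝ} (hα : 0 < α) {S : ℝ → ℝ} (hS : Tendsto S atTop atTop) (j : ℕ)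
    {k : ℝ → ℂ} {k0 : ℂ} (hk : Tendsto k atTop (nhds k0)) (hk0 : k0 ≠ 0) :
    Tendsto (fun T => ((S T : ℂ) ^ (j + 1))⁻¹ * qj α j (α - 1 + k T / S T)) atTop
      (nhds (α / (α * k0) ^ (j + 1))) := by
  have h1 : Tendsto (fun T => k T / (S T : ℂ)) atTop (nhds 0) := by
    have := hk.mul (Sinv_tend hS)
    rw [mul_zero] at this
    exact this
  have h2 : Tendsto (fun T => (α + 2 * (k T / S T)) / ((α + k T / S T) * k T) ^ (j + 1)) atTop
      (nhds (((α : ℂ) + 2 * 0) / (((α : ℂ) + 0) * k0) ^ (j + 1))) := by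
    refine Tendsto.div ((h1.const_mul 2).const_add _) (((h1.const_add _).mul hk).pow _) ?_
    have : (α : ℂ) ≠ 0 := by exact_mod_cast hα.ne'
    simp [this, hk0]
  rw [mul_zero, add_zero] at h2
  refine h2.congr' ?_
  filter_upwards [hS.eventually_gt_atTop 0] with T hT
  rw [qj_scale j (by exact_mod_cast hT.ne')]

theorem bj_small_lim {S t : ℝ → ℝ} {n m : ℝ → ℤ} {α u d e q : ℝ}
    (hα0 : 0 < α) (hα1 : α < 1) (h : Reg atTop S t m n (1 - α) u d e q) {c0 : ℝ}
    (hc0 : 0 < c0) (j : ℕ) :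
    Tendsto (fun T => ((S T : ℂ) ^ j)⁻¹ * ∮ z in C((α : ℂ) - 1, c0 / S T),
      qj α j z * BF α (t T) (n T) (m T) z) atTop
      (nhds (∮ ζ in C((0 : ℂ), c0), α / (α * ζ) ^ (j + 1) *
        fE e q (u / (3 * (1 - α) * (1 - (1 - α)))) (-ζ))) := by
  have hS := h.hS
  obtain ⟨C, hC⟩ := Phi_bdd (by linarith : 0 < 1 - α) (by linarith) h c0
  have key : Tendsto (fun T => ∮ ζ in C((0 : ℂ), c0), (((S T : ℂ) ^ (j + 1))⁻¹ *
      qj α j (α - 1 + ζ / S T)) * BF α (t T) (n T) (m T) (α - 1 + ζ / S T)) atTop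
      (nhds (∮ ζ in C((0 : ℂ), c0), α / (α * ζ) ^ (j + 1) *
        fE e q (u / (3 * (1 - α) * (1 - (1 - α)))) (-ζ))) := by
    have hsm : ∀ᶠ T in atTop, c0 / S T < min (α / 2) (1 - α) :=
      (tendsto_const_nhds.div_atTop hS).eventually (gt_mem_nhds (lt_min (by linarith) (by linarith)))
    have nk : ∀ T, 0 < S T → ∀ k : ℂ, ‖k‖ = c0 → ‖k / S T‖ = c0 / S T := by
      intro T hT k hk
      rw [norm_div, hk, Complex.norm_real, Real.norm_eq_abs, abs_of_pos hT]
    have hBF : ∀ T (k : ℂ), BF α (t T) (n T) (m T) (α - 1 + k / S T) =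
        Phi (t T) (m T) (n T) (1 - α) (((1 - α : ℝ) : ℂ) + (-k) / S T) := by
      intro T k
      unfold BF
      congr 1
      push_cast
      ring
    have na : ‖(α : ℂ)‖ = α := by rw [Complex.norm_real, Real.norm_eq_abs, abs_of_pos hα0]
    have na1 : ‖(α : ℂ) - 1‖ = 1 - α := by
      rw [← Complex.ofReal_one, ← Complex.ofReal_sub, Complex.norm_real, Real.norm_eq_abs,
        abs_of_neg (by linarith)]; ring
    refine circ_fix_lim (C := 4 / (α / 2 * c0) ^ (j + 1) * |C|) ?_ ?_ ?_
    · filter_upwards [hsm, hS.eventually_gt_atTop 0] with T h1 h2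
      rw [lt_min_iff] at h1
      refine circ_cont (f := fun ζ : ℂ => (((S T : ℂ) ^ (j + 1))⁻¹ *
        qj α j (α - 1 + ζ / S T)) * BF α (t T) (n T) (m T) (α - 1 + ζ / S T)) hc0.le ?_
      intro k hk
      have hk' : ‖k‖ = c0 := by simpa using hk
      have nk' := nk T h2 k hk'
      have hk0 : k ≠ 0 := by rintro rfl; rw [norm_zero] at hk'; linarith
      have hS0 : (S T : ℂ) ≠ 0 := by exact_mod_cast h2.ne'
      have n1 : ‖(α : ℂ) - 1 + k / S T‖ ≤ 1 - α + c0 / S T := by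
        rw [← nk', ← na1]; exact norm_add_le _ _
      have n2 : 1 - α - c0 / S T ≤ ‖(α : ℂ) - 1 + k / S T‖ := by
        rw [← nk', ← na1]
        have := norm_sub_le ((α : ℂ) - 1 + k / S T) (k / S T)
        rw [add_sub_cancel_right] at this
        linarith
      have d1 : DifferentiableAt ℂ (fun k : ℂ => (α : ℂ) - 1 + k / S T) k := by fun_prop
      have d2 : DifferentiableAt ℂ (fun k : ℂ => qj α j ((α : ℂ) - 1 + k / S T)) k := by
        refine DifferentiableAt.comp (g := qj α j) k (qj_diff j ?_ ?_) d1
        · intro hh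
          have : (α : ℂ) = -(k / S T) := by linear_combination hh
          have := congrArg norm this
          rw [norm_neg, nk', na] at this
          linarith
        · intro hh
          have : k / S T = 0 := by linear_combination hh
          rw [div_eq_zero_iff] at this
          tauto
      have d3 : DifferentiableAt ℂ (fun k : ℂ => BF α (t T) (n T) (m T) ((α : ℂ) - 1 + k / S T)) k := by
        refine DifferentiableAt.comp (g := BF α (t T) (n T) (m T)) k
          (BF_diff hα0 hα1 _ (by linarith) (by linarith)) d1
      exact ((d2.const_mul _).mul d3).continuousAt.continuousWithinAt
    · filter_upwards [hsm, hS.eventually_gt_atTop 0, hC] with T h1 h2 h3 k hk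
      rw [lt_min_iff] at h1
      rw [abs_of_pos hc0] at hk
      have nk' := nk T h2 k hk
      rw [norm_mul, qj_scale j (by exact_mod_cast h2.ne'), hBF]
      refine mul_le_mul ?_ ((h3 (-k) (by rw [norm_neg, hk])).trans (le_abs_self _))
        (norm_nonneg _) (by positivity)
      rw [norm_div, norm_pow, norm_mul, hk]
      have n1 : ‖(α : ℂ) + 2 * (k / S T)‖ ≤ 4 := by
        refine (norm_add_le _ _).trans ?_
        rw [norm_mul, nk', na, Complex.norm_ofNat]
        linarith
      have n2 : α / 2 ≤ ‖(α : ℂ) + k / S T‖ := by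
        have := norm_sub_le ((α : ℂ) + k / S T) (k / S T)
        rw [add_sub_cancel_right, na, nk'] at this
        linarith
      gcongr
    · intro k hk
      rw [abs_of_pos hc0] at hk
      have hk0 : k ≠ 0 := by rintro rfl; rw [norm_zero] at hk; linarith
      refine (qj_scale_lim hα0 hS j tendsto_const_nhds hk0).mul ?_
      simp_rw [hBF]
      exact Phi_lim (by linarith : 0 < 1 - α) (by linarith) h tendsto_const_nhds
  refine key.congr' ?_
  filter_upwards [hS.eventually_gt_atTop 0] with T hT
  have hS0 : (S T : ℂ) ≠ 0 := by exact_mod_cast hT.ne'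
  rw [circ_scale _ _ _ hT.ne', ← circleIntegral.integral_const_mul]
  refine congrArg (fun f : ℂ → ℂ => circleIntegral f 0 c0) (funext fun k => ?_)
  rw [pow_succ]
  field_simp

theorem bj_big_lim {S t : ℝ → ℝ} {n m : ℝ → ℤ} {α u d e q : ℝ}
    (hα0 : 1 / 2 < α) (hα1 : α < 1) (hu : 0 < u) (h : Reg atTop S t m n (1 - α) u d e q) (b : ℝ)
    (hb0 : 0 < b) (hb : 0 < d + 2 * u * b / (1 - (1 - α))) {rv : ℝ} (hrv : 0 < rv)
    (hε1 : rv < (1 - α) / 4) (hε2 : rv < (2 * α - 1) / 4) (j : ℕ) :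
    Tendsto (fun T => ((S T : ℂ) ^ j)⁻¹ * ∮ z in C((0 : ℂ), 1 - α - b / S T),
      (2 * (π : ℂ) * I * qj α j z + remj α j rv z) * BF α (t T) (n T) (m T) z) atTop
      (nhds (-(I * ((1 - α : ℝ) : ℂ) * ∫ y : ℝ, fE e q (u / (3 * (1 - α) * (1 - (1 - α))))
        (-b + I * ((1 - α : ℝ) : ℂ) * y) *
        (2 * (π : ℂ) * I * (α / (α * -(-b + I * ((1 - α : ℝ) : ℂ) * y)) ^ (j + 1)))))) := by
  have hS := h.hS
  have hα : 0 < α := by linarith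
  have hr := rad_lim hS (1 - α) b
  have hr0 := hr.eventually (lt_mem_nhds (by linarith : 0 < 1 - α))
  have hrem : ContinuousOn (remj α j rv) (Metric.closedBall 0 (1 - α)) := by
    intro z hz
    exact (remj_diff hα0 hα1 hrv hε1 hε2 j (by simpa using hz)).continuousAt.continuousWithinAt
  obtain ⟨Cr, hCr⟩ := (isCompact_closedBall (0 : ℂ) (1 - α)).exists_bound_of_continuousOn hrem
  have na : ‖(α : ℂ)‖ = α := by rw [Complex.norm_real, Real.norm_eq_abs, abs_of_pos hα]
  have na1 : ‖1 - (α : ℂ)‖ = 1 - α := by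
    rw [← Complex.ofReal_one, ← Complex.ofReal_sub, Complex.norm_real, Real.norm_eq_abs,
      abs_of_pos (by linarith)]
  have geo : ∀ T, 0 < S T → 0 < 1 - α - b / S T → ∀ z : ℂ, ‖z‖ = 1 - α - b / S T →
      α ≤ ‖-z + 1‖ ∧ b / S T ≤ ‖-z + 1 - α‖ ∧ ‖2 * (-z) + 2 - α‖ ≤ 4 ∧ -z + 1 ≠ 0 ∧ -z + 1 - (α : ℂ) ≠ 0 := by
    intro T h1 h2 z hz
    have hbS : 0 < b / S T := div_pos hb0 h1
    have a1 : α ≤ ‖-z + 1‖ := by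
      have := norm_add_le (-z + 1) z
      rw [neg_add_cancel_comm, norm_one] at this
      linarith
    have a2 : b / S T ≤ ‖-z + 1 - α‖ := by
      have := norm_add_le (-z + 1 - α) z
      have e : (-z + 1 - α + z : ℂ) = 1 - α := by ring
      rw [e, na1] at this
      linarith
    refine ⟨a1, a2, ?_, ?_, ?_⟩
    · have e : (2 * (-z) + 2 - α : ℂ) = 2 * (1 - z) - α := by ring
      rw [e]
      refine (norm_sub_le _ _).trans ?_
      rw [norm_mul, Complex.norm_ofNat, na]
      have := norm_sub_le 1 z
      rw [norm_one] at this
      linarith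
    · intro hh; rw [hh, norm_zero] at a1; linarith
    · intro hh; rw [hh, norm_zero] at a2; linarith
  have := P_lim (by linarith : 0 < 1 - α) (by linarith) hu h b hb
    (g := fun T w => ((S T : ℂ) ^ (j + 1))⁻¹ * (2 * (π : ℂ) * I * qj α j (-w) + remj α j rv (-w)))
    (hh := fun y => 2 * (π : ℂ) * I * (α / (α * -(-b + I * ((1 - α : ℝ) : ℂ) * y)) ^ (j + 1)))
    (C := 2 * π * (4 / (α * b) ^ (j + 1)) + |Cr|) 0 ?_ ?_ ?_
  · refine this.neg.congr' ?_
    filter_upwards [hS.eventually_gt_atTop 0] with T hT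
    have hS0 : (S T : ℂ) ≠ 0 := by exact_mod_cast hT.ne'
    rw [circ_neg (fun z => (2 * (π : ℂ) * I * qj α j z + remj α j rv z) * BF α (t T) (n T) (m T) z),
      mul_neg, ← circleIntegral.integral_const_mul, ← circleIntegral.integral_const_mul]
    refine congrArg Neg.neg (congrArg (fun f : ℂ → ℂ => circleIntegral f 0 (1 - α - b / S T))
      (funext fun k => ?_))
    unfold BF
    rw [neg_neg, pow_succ]
    field_simp
  · filter_upwards [hr0, hS.eventually_gt_atTop 0] with T h1 h2 z hz
    have hz' : ‖z‖ = 1 - α - b / S T := by simpa using hz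
    obtain ⟨_, _, _, g4, g5⟩ := geo T h2 h1 z hz'
    have d1 : DifferentiableAt ℂ (fun z => qj α j (-z)) z :=
      DifferentiableAt.comp (g := qj α j) (f := fun z => -z) z (qj_diff j g4 g5) (by fun_prop)
    have d2 : DifferentiableAt ℂ (fun z => remj α j rv (-z)) z :=
      DifferentiableAt.comp (g := remj α j rv) (f := fun z => -z) z
        (remj_diff hα0 hα1 hrv hε1 hε2 j (by
          rw [norm_neg, hz']
          have : 0 < b / S T := div_pos hb0 h2
          linarith)) (by fun_prop)
    exact (((d1.const_mul _).add d2).const_mul _).continuousAt.continuousWithinAt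
  · filter_upwards [hr0, hS.eventually_ge_atTop 1] with T h1 h2 y hy
    have h2' : 0 < S T := by linarith
    have hz' : ‖circleMap 0 (1 - α - b / S T) (y / S T)‖ = 1 - α - b / S T := by
      rw [norm_circleMap_zero, abs_of_pos h1]
    generalize circleMap 0 (1 - α - b / S T) (y / S T) = z at *
    obtain ⟨g1, g2, g3, g4, g5⟩ := geo T h2' h1 z hz'
    have hbS : 0 < b / S T := div_pos hb0 h2'
    rw [pow_zero, mul_one, mul_add]
    refine (norm_add_le _ _).trans (add_le_add ?_ ?_)
    · have e : ((S T : ℂ) ^ (j + 1))⁻¹ * (2 * (π : ℂ) * I * qj α j (-z)) =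
        (2 * (π : ℂ) * I) * ((2 * (-z) + 2 - α) / ((-z + 1) * (S T * (-z + 1 - α))) ^ (j + 1)) := by
        have hS0 : (S T : ℂ) ≠ 0 := by exact_mod_cast h2'.ne'
        unfold qj
        simp only [mul_pow]
        field_simp
      rw [e, norm_mul, norm_div, norm_pow, norm_mul (-z + 1), norm_mul (S T : ℂ)]
      have e2 : ‖2 * (π : ℂ) * I‖ = 2 * π := by simp [abs_of_pos Real.pi_pos]
      rw [e2, Complex.norm_real, Real.norm_eq_abs, abs_of_pos h2']
      have e3 : b ≤ S T * ‖-z + 1 - α‖ := by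
        calc b = S T * (b / S T) := by field_simp
          _ ≤ _ := by gcongr
      gcongr
    · rw [norm_mul, norm_inv, norm_pow, Complex.norm_real, Real.norm_eq_abs, abs_of_pos h2']
      have e4 : (S T ^ (j + 1))⁻¹ ≤ 1 := inv_le_one_of_one_le₀ (one_le_pow₀ h2)
      have e5 : ‖remj α j rv (-z)‖ ≤ |Cr| := (hCr (-z) (by
        simp only [Metric.mem_closedBall, dist_zero_right, norm_neg]; linarith)).trans (le_abs_self _)
      calc _ ≤ 1 * |Cr| := by gcongr
        _ = _ := one_mul _
  · intro y
    have k1 := kappa_lim hS (1 - α) b y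
    have k2 := qj_scale_lim hα hS j k1.neg (by
      intro hh
      have := congrArg Complex.re hh
      simp at this
      linarith)
    have k3 := circ_tend hS (1 - α) b y
    have k4 : Tendsto (fun T => remj α j rv (-(circleMap 0 (1 - α - b / S T) (y / S T)))) atTop
        (nhds (remj α j rv (-((1 - α : ℝ) : ℂ)))) := by
      have : ContinuousAt (remj α j rv) (-((1 - α : ℝ) : ℂ)) :=
        (remj_diff hα0 hα1 hrv hε1 hε2 j (by
          rw [norm_neg, Complex.norm_real, Real.norm_eq_abs, abs_of_pos (by linarith)])).continuousAt
      exact this.tendsto.comp k3.neg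
    have k5 := ((Sinv_tend hS).pow (j + 1)).mul k4
    rw [zero_pow (by omega), zero_mul] at k5
    have k6 := (k2.const_mul (2 * (π : ℂ) * I)).add k5
    rw [add_zero] at k6
    refine k6.congr' ?_
    filter_upwards [hS.eventually_gt_atTop 0] with T hT
    have hS0 : (S T : ℂ) ≠ 0 := by exact_mod_cast hT.ne'
    have e : (α : ℂ) - 1 + -(S T * (circleMap 0 (1 - α - b / S T) (y / S T) - ((1 - α : ℝ) : ℂ))) / S T
        = -circleMap 0 (1 - α - b / S T) (y / S T) := by
      push_cast
      field_simp
      ring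
    rw [e, inv_pow]
    ring

/-- inner integral -/
def JT (α t : ℝ) (n m : ℤ) (r1 : ℝ) (ω : ℂ) : ℂ :=
  ∮ w in C((0 : ℂ), r1), AF α t n m w * ((w + ω - 1)⁻¹ - (w - ω)⁻¹)

theorem JT_geo {α r1 r2 : ℝ} (hr2 : r2 < 1 - α) (hr1 : r1 < α) {w ω : ℂ}
    (hw : ‖w‖ = r1) (hω : ‖ω‖ = r2) :
    1 - r1 - r2 ≤ ‖w + ω - 1‖ ∧ r1 - r2 ≤ ‖w - ω‖ := by
  constructor
  · have e : (1 : ℂ) = w + ω - (w + ω - 1) := by ring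
    have h1 := (congrArg norm e).le.trans (norm_sub_le _ _)
    have h2 := norm_add_le w ω
    rw [norm_one] at h1
    linarith
  · have := norm_sub_norm_le w ω
    linarith

theorem JT_cont {α t : ℝ} {n m : ℤ} {r1 r2 : ℝ} (hα0 : 0 < α) (hα1 : α < 1) (hr1 : 0 < r1)
    (hr1' : r1 < α) (hr2' : r2 < 1 - α) (hr21 : r2 < r1) :
    ContinuousOn (JT α t n m r1) (Metric.sphere 0 r2) := by
  have hA : ContinuousOn (AF α t n m) (Metric.sphere 0 r1) := by
    intro z hz
    have hz' : ‖z‖ = r1 := by simpa using hz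
    exact (AF_diff hα0 hα1 z (by linarith) (by linarith)).continuousAt.continuousWithinAt
  have e : ∀ ω ∈ Metric.sphere (0 : ℂ) r2, JT α t n m r1 ω =
      (∮ w in C((0 : ℂ), r1), AF α t n m w / (w - (1 - ω))) -
      (∮ w in C((0 : ℂ), r1), AF α t n m w / (w - ω)) := by
    intro ω hω
    have hω' : ‖ω‖ = r2 := by simpa using hω
    unfold JT
    rw [← circleIntegral.integral_sub]
    · refine congrArg (fun f : ℂ → ℂ => circleIntegral f 0 r1) (funext fun w => ?_)
      rw [mul_sub, div_eq_mul_inv, div_eq_mul_inv]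
      congr 3
      ring
    · apply ContinuousOn.circleIntegrable hr1.le
      refine hA.div (by fun_prop) (fun w hw => ?_)
      have := (JT_geo hr2' hr1' (by simpa using hw) hω').1
      intro h0
      have e : w + ω - 1 = 0 := by linear_combination h0
      rw [e, norm_zero] at this
      linarith
    · apply ContinuousOn.circleIntegrable hr1.le
      refine hA.div (by fun_prop) (fun w hw => ?_)
      have := (JT_geo hr2' hr1' (by simpa using hw) hω').2
      intro h0
      rw [h0, norm_zero] at this
      linarith
  refine ContinuousOn.congr ?_ e
  intro ω hω
  have hω' : ‖ω‖ = r2 := by simpa using hω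
  have n1 : ‖(1 - ω) - 0‖ ≠ r1 := by
    have := norm_sub_norm_le 1 ω
    rw [norm_one] at this
    rw [sub_zero]
    intro h
    linarith
  have d1 := circ_param_diff hr1.le hA n1
  have d1' := DifferentiableAt.comp (f := fun ω : ℂ => 1 - ω) ω d1 (by fun_prop)
  have d2 := circ_param_diff hr1.le hA (c := ω) (by rw [sub_zero, hω']; exact hr21.ne)
  exact (d1'.sub d2).continuousAt.continuousWithinAt

theorem K1_swap {α t₁ t₂ : ℝ} {n₁ m₁ n₂ m₂ : ℤ} {r1 r2 : ℝ} (hα0 : 0 < α) (hα1 : α < 1)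
    (hr1 : 0 < r1) (hr2 : 0 < r2) (hr1' : r1 < α) (hr2' : r2 < 1 - α) (hr21 : r2 < r1) :
    (∮ w in C((0 : ℂ), r1), ∮ v in C((0 : ℂ), r2),
      AF α t₁ n₁ m₁ w * BF α t₂ n₂ m₂ v * ((1 + 2 * v) / ((w + v) * (w - v - 1)))) =
    -∮ ω in C((0 : ℂ), r2), Phi t₂ m₂ n₂ (1 - α) ω * JT α t₁ n₁ m₁ r1 ω := by
  have hA : ContinuousOn (AF α t₁ n₁ m₁) (Metric.sphere 0 r1) := by
    intro z hz
    have hz' : ‖z‖ = r1 := by simpa using hz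
    exact (AF_diff hα0 hα1 z (by linarith) (by linarith)).continuousAt.continuousWithinAt
  have hB : ContinuousOn (BF α t₂ n₂ m₂) (Metric.sphere 0 r2) := by
    intro z hz
    have hz' : ‖z‖ = r2 := by simpa using hz
    exact (BF_diff hα0 hα1 z (by linarith) (by linarith)).continuousAt.continuousWithinAt
  have nz : ∀ w v : ℂ, ‖w‖ = r1 → ‖v‖ = r2 → w + v ≠ 0 ∧ w - v - 1 ≠ 0 := by
    intro w v hw hv
    obtain ⟨g1, g2⟩ := JT_geo hr2' hr1' hw (ω := -v) (by rw [norm_neg, hv])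
    constructor
    · intro h0
      rw [sub_neg_eq_add, h0, norm_zero] at g2
      linarith
    · intro h0
      rw [← sub_eq_add_neg, h0, norm_zero] at g1
      linarith
  rw [circ_swap hr1.le hr2.le, circ_neg]
  · congr 1
    apply circleIntegral.integral_congr hr2.le
    intro ω hω
    have hω' : ‖ω‖ = r2 := by simpa using hω
    unfold JT
    simp only
    rw [← circleIntegral.integral_const_mul]
    apply circleIntegral.integral_congr hr1.le
    intro w hw
    have hw' : ‖w‖ = r1 := by simpa using hw
    obtain ⟨g1, g2⟩ := nz w (-ω) hw' (by rw [norm_neg, hω'])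
    have g1' : w - ω ≠ 0 := by rwa [← sub_eq_add_neg] at g1
    have g2' : w + ω - 1 ≠ 0 := by rwa [sub_neg_eq_add] at g2
    simp only [BF, neg_neg]
    have e : (1 + 2 * -ω) / ((w + -ω) * (w - -ω - 1)) = (w + ω - 1)⁻¹ - (w - ω)⁻¹ := by
      rw [← sub_eq_add_neg w ω, sub_neg_eq_add]
      field_simp
      ring
    rw [e]
    ring
  · refine ContinuousOn.mul (ContinuousOn.mul ?_ ?_) ?_
    · exact hA.comp continuousOn_fst (fun p hp => hp.1)
    · exact hB.comp continuousOn_snd (fun p hp => hp.2)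
    · refine ContinuousOn.div (by fun_prop) (by fun_prop) (fun p hp => ?_)
      obtain ⟨g1, g2⟩ := nz p.1 p.2 (by simpa using hp.1) (by simpa using hp.2)
      exact mul_ne_zero g1 g2

theorem K1_lim {S t₁ t₂ : ℝ → ℝ} {n₁ m₁ n₂ m₂ : ℝ → ℤ} {α u d₁ e₁ q₁ d₂ e₂ q₂ : ℝ}
    (hα0 : 1 / 2 < α) (hα1 : α < 1) (hu : 0 < u) (h1 : Reg atTop S t₁ n₁ m₁ α u d₁ e₁ q₁)
    (h2 : Reg atTop S t₂ m₂ n₂ (1 - α) u d₂ e₂ q₂) (b1 b2 : ℝ) (hb1 : 0 < b1) (hb2 : 0 < b2)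
    (hd1 : 0 < d₁ + 2 * u * b1 / (1 - α)) (hd2 : 0 < d₂ + 2 * u * b2 / (1 - (1 - α))) :
    Tendsto (fun T => (S T : ℂ) * ∮ w in C((0 : ℂ), α - b1 / S T),
      ∮ v in C((0 : ℂ), 1 - α - b2 / S T),
      AF α (t₁ T) (n₁ T) (m₁ T) w * BF α (t₂ T) (n₂ T) (m₂ T) v *
        ((1 + 2 * v) / ((w + v) * (w - v - 1)))) atTop
      (nhds (-(I * ((1 - α : ℝ) : ℂ) * ∫ y₂ : ℝ, fE e₂ q₂ (u / (3 * (1 - α) * (1 - (1 - α))))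
        (-b2 + I * ((1 - α : ℝ) : ℂ) * y₂) *
        (I * α * ∫ y₁ : ℝ, fE e₁ q₁ (u / (3 * α * (1 - α))) (-b1 + I * α * y₁) *
        ((α : ℂ)⁻¹ * ((-b1 + I * α * y₁) + (-b2 + I * ((1 - α : ℝ) : ℂ) * y₂))⁻¹))))) := by
  have hS := h1.hS
  have hα : 0 < α := by linarith
  have hr1 := rad_lim hS α b1
  have hr2 := rad_lim hS (1 - α) b2
  have hr1e := hr1.eventually (lt_mem_nhds (half_lt_self hα))
  have hr2e := hr2.eventually (lt_mem_nhds (by linarith : 0 < 1 - α))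
  have hr12 := (hr1.sub hr2).eventually (lt_mem_nhds
    (by linarith : (2 * α - 1) / 2 < α - (1 - α)))
  obtain ⟨K, hK0, hK⟩ := P_bound hα hα1 hu h1 b1 hd1
  have hJ : ∀ T, 0 < S T → ∀ ω, JT α (t₁ T) (n₁ T) (m₁ T) (α - b1 / S T) ω =
      S T * ∮ w in C((0 : ℂ), α - b1 / S T), Phi (t₁ T) (n₁ T) (m₁ T) α w *
        ((S T : ℂ)⁻¹ * w⁻¹ * ((w + ω - 1)⁻¹ - (w - ω)⁻¹)) := by
    intro T hT ω
    have hS0 : (S T : ℂ) ≠ 0 := by exact_mod_cast hT.ne'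
    unfold JT AF
    rw [← circleIntegral.integral_const_mul]
    refine congrArg (fun f : ℂ → ℂ => circleIntegral f 0 (α - b1 / S T)) (funext fun w => ?_)
    field_simp
  have hgb : ∀ᶠ T in atTop, ∀ w ω : ℂ, ‖w‖ = α - b1 / S T → ‖ω‖ = 1 - α - b2 / S T →
      ‖(S T : ℂ)⁻¹ * w⁻¹ * ((w + ω - 1)⁻¹ - (w - ω)⁻¹)‖ ≤
        (α / 2)⁻¹ * ((b1 + b2)⁻¹ + ((2 * α - 1) / 2)⁻¹) := by
    filter_upwards [hr1e, hr2e, hr12, hS.eventually_ge_atTop 1] with T k1 k2 k3 k4 w ω hw hω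
    have k5 : 0 < S T := by linarith
    have b1S : 0 < b1 / S T := div_pos hb1 k5
    have b2S : 0 < b2 / S T := div_pos hb2 k5
    obtain ⟨g1, g2⟩ := JT_geo (α := α) (by linarith) (by linarith) hw hω
    have e1 : (b1 + b2) / S T ≤ ‖w + ω - 1‖ := by
      refine le_trans (le_of_eq ?_) g1
      ring
    have e1' : 0 < (b1 + b2) / S T := by positivity
    have e2 : (2 * α - 1) / 2 ≤ ‖w - ω‖ := by linarith
    have e2' : 0 < (2 * α - 1) / 2 := by linarith
    rw [norm_mul, norm_mul, norm_inv, norm_inv, hw, Complex.norm_real, Real.norm_eq_abs,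
      abs_of_pos k5]
    have e3 : ‖(w + ω - 1)⁻¹ - (w - ω)⁻¹‖ ≤ ((b1 + b2) / S T)⁻¹ + ((2 * α - 1) / 2)⁻¹ := by
      refine (norm_sub_le _ _).trans ?_
      rw [norm_inv, norm_inv]
      gcongr
    have e4 : (α - b1 / S T)⁻¹ ≤ (α / 2)⁻¹ := by gcongr
    have e5 : 0 ≤ (α - b1 / S T)⁻¹ := inv_nonneg.2 (by linarith)
    calc (S T)⁻¹ * (α - b1 / S T)⁻¹ * ‖(w + ω - 1)⁻¹ - (w - ω)⁻¹‖
        ≤ (S T)⁻¹ * (α / 2)⁻¹ * (((b1 + b2) / S T)⁻¹ + ((2 * α - 1) / 2)⁻¹) := by gcongr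
      _ = (α / 2)⁻¹ * ((b1 + b2)⁻¹ + (S T)⁻¹ * ((2 * α - 1) / 2)⁻¹) := by
          have : b1 + b2 ≠ 0 := by linarith
          have : 2 * α - 1 ≠ 0 := by linarith
          field_simp
      _ ≤ (α / 2)⁻¹ * ((b1 + b2)⁻¹ + 1 * ((2 * α - 1) / 2)⁻¹) := by
          have := inv_le_one_of_one_le₀ k4
          gcongr
      _ = _ := by rw [one_mul]
  have hCpos : 0 ≤ (α / 2)⁻¹ * ((b1 + b2)⁻¹ + ((2 * α - 1) / 2)⁻¹) := by
    have : 0 < 2 * α - 1 := by linarith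
    positivity
  have main := P_lim (by linarith : 0 < 1 - α) (by linarith) hu h2 b2 hd2
    (g := fun T ω => JT α (t₁ T) (n₁ T) (m₁ T) (α - b1 / S T) ω)
    (hh := fun y₂ => I * α * ∫ y₁ : ℝ, fE e₁ q₁ (u / (3 * α * (1 - α))) (-b1 + I * α * y₁) *
        ((α : ℂ)⁻¹ * ((-b1 + I * α * y₁) + (-b2 + I * ((1 - α : ℝ) : ℂ) * y₂))⁻¹))
    (C := K * ((α / 2)⁻¹ * ((b1 + b2)⁻¹ + ((2 * α - 1) / 2)⁻¹))) 0 ?_ ?_ ?_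
  · refine main.neg.congr' ?_
    filter_upwards [hr1e, hr2e, hr12, hS.eventually_ge_atTop 1] with T k1 k2 k3 k4
    have k5 : 0 < S T := by linarith
    have b1S : 0 < b1 / S T := div_pos hb1 k5
    have b2S : 0 < b2 / S T := div_pos hb2 k5
    rw [K1_swap hα hα1 (by linarith) (by linarith) (by linarith) (by linarith) (by linarith), mul_neg]
  · filter_upwards [hr1e, hr2e, hr12, hS.eventually_ge_atTop 1] with T k1 k2 k3 k4
    have k5 : 0 < S T := by linarith
    have b1S : 0 < b1 / S T := div_pos hb1 k5
    have b2S : 0 < b2 / S T := div_pos hb2 k5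
    exact JT_cont hα hα1 (by linarith) (by linarith) (by linarith) (by linarith)
  · filter_upwards [hr1e, hr2e, hgb, hK, hS.eventually_ge_atTop 1] with T k1 k2 k3 k4 k5 y hy
    rw [pow_zero, mul_one, hJ T (by linarith)]
    refine k4 _ _ hCpos (fun y' hy' => k3 _ _ ?_ ?_)
    · rw [norm_circleMap_zero, abs_of_pos (by linarith)]
    · rw [norm_circleMap_zero, abs_of_pos (by linarith)]
  · intro y₂
    have inner := P_lim hα hα1 hu h1 b1 hd1
      (g := fun T w => (S T : ℂ)⁻¹ * w⁻¹ *
        ((w + circleMap 0 (1 - α - b2 / S T) (y₂ / S T) - 1)⁻¹ -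
          (w - circleMap 0 (1 - α - b2 / S T) (y₂ / S T))⁻¹))
      (hh := fun y₁ => ((α : ℂ)⁻¹ * ((-b1 + I * α * y₁) + (-b2 + I * ((1 - α : ℝ) : ℂ) * y₂))⁻¹))
      (C := (α / 2)⁻¹ * ((b1 + b2)⁻¹ + ((2 * α - 1) / 2)⁻¹)) 0 ?_ ?_ ?_
    · refine inner.congr' ?_
      filter_upwards [hS.eventually_gt_atTop 0] with T hT
      rw [hJ T hT]
    · filter_upwards [hr1e, hr2e, hr12, hS.eventually_ge_atTop 1] with T k1 k2 k3 k4 w hw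
      have k5 : 0 < S T := by linarith
      have b1S : 0 < b1 / S T := div_pos hb1 k5
      have b2S : 0 < b2 / S T := div_pos hb2 k5
      have hw' : ‖w‖ = α - b1 / S T := by simpa using hw
      have hω : ‖circleMap 0 (1 - α - b2 / S T) (y₂ / S T)‖ = 1 - α - b2 / S T := by
        rw [norm_circleMap_zero, abs_of_pos k2]
      generalize circleMap 0 (1 - α - b2 / S T) (y₂ / S T) = ω at *
      obtain ⟨g1, g2⟩ := JT_geo (α := α) (by linarith) (by linarith) hw' hω
      have z1 : w ≠ 0 := by rintro rfl; rw [norm_zero] at hw'; linarith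
      have z2 : w + ω - 1 ≠ 0 := by intro h; rw [h, norm_zero] at g1; linarith
      have z3 : w - ω ≠ 0 := by intro h; rw [h, norm_zero] at g2; linarith
      have : DifferentiableAt ℂ (fun w : ℂ => (S T : ℂ)⁻¹ * w⁻¹ * ((w + ω - 1)⁻¹ - (w - ω)⁻¹)) w :=
        DifferentiableAt.mul (DifferentiableAt.const_mul (DifferentiableAt.inv (by fun_prop) z1) _)
          (DifferentiableAt.sub (DifferentiableAt.inv (by fun_prop) z2)
            (DifferentiableAt.inv (by fun_prop) z3))
      exact this.continuousAt.continuousWithinAt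
    · filter_upwards [hr1e, hr2e, hgb] with T k1 k2 k3 y hy
      rw [pow_zero, mul_one]
      refine k3 _ _ ?_ ?_
      · rw [norm_circleMap_zero, abs_of_pos (by linarith)]
      · rw [norm_circleMap_zero, abs_of_pos (by linarith)]
    · intro y₁
      have l1 := kappa_lim hS α b1 y₁
      have l2 := kappa_lim hS (1 - α) b2 y₂
      have c1 := circ_tend hS α b1 y₁
      have c2 := circ_tend hS (1 - α) b2 y₂
      have s1 := (l1.add l2).inv₀ (by
        intro hh
        have := congrArg Complex.re hh
        simp at this
        linarith)
      have s2 := c1.inv₀ (by exact_mod_cast hα.ne' : (α : ℂ) ≠ 0)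
      have s3 := (c1.sub c2).inv₀ (by
        have : (α : ℂ) - ((1 - α : ℝ) : ℂ) = ((2 * α - 1 : ℝ) : ℂ) := by push_cast; ring
        rw [this]
        have : 2 * α - 1 ≠ 0 := by linarith
        exact_mod_cast this)
      have s4 := (s2.mul s1).sub (((Sinv_tend hS).mul s2).mul s3)
      rw [zero_mul, zero_mul, sub_zero] at s4
      refine s4.congr' ?_
      filter_upwards [hS.eventually_gt_atTop 0] with T hT
      have hS0 : (S T : ℂ) ≠ 0 := by exact_mod_cast hT.ne'
      have e : ∀ w ω : ℂ, (S T : ℂ) * (w - α) + S T * (ω - ((1 - α : ℝ) : ℂ)) =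
          S T * (w + ω - 1) := by intro w ω; push_cast; ring
      rw [e, mul_inv]
      ring

theorem phi_prod {α t₁ t₂ : ℝ} {n₁ m₁ n₂ m₂ : ℤ} (hα0 : 0 < α) (hα1 : α < 1) {w : ℂ}
    (hw : ‖w‖ = α) :
    Phi t₁ n₁ m₁ α w * Phi t₂ m₂ n₂ (1 - α) (1 - w) = Phi (t₁ - t₂) (n₁ - n₂) (m₁ - m₂) α w := by
  have w0 : w ≠ 0 := by rintro rfl; rw [norm_zero] at hw; linarith
  have w1 : 1 - w ≠ 0 := by
    intro h
    have : w = 1 := by linear_combination -h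
    rw [this, norm_one] at hw; linarith
  have a0 : (α : ℂ) ≠ 0 := by exact_mod_cast hα0.ne'
  have a1 : 1 - (α : ℂ) ≠ 0 := by
    have : 1 - α ≠ 0 := by linarith
    exact_mod_cast this
  unfold Phi
  have x1 : (1 - w) / (1 - (α : ℂ)) ≠ 0 := div_ne_zero w1 a1
  have x2 : w / (α : ℂ) ≠ 0 := div_ne_zero w0 a0
  have e1 : (1 - (1 - w)) / (1 - ((1 - α : ℝ) : ℂ)) = w / α := by
    push_cast; congr 1 <;> ring
  have e2 : (1 - w) / ((1 - α : ℝ) : ℂ) = (1 - w) / (1 - (α : ℂ)) := by push_cast; ring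
  rw [e1, e2]
  have e3 : -(m₁ - m₂) = -m₁ + m₂ := by ring
  have e4 : n₁ - n₂ = n₁ + -n₂ := by ring
  rw [e3, e4, zpow_add₀ x1, zpow_add₀ x2]
  have e5 : Complex.exp (((t₁ - t₂ : ℝ) : ℂ) * (w - α)) = Complex.exp ((t₁ : ℂ) * (w - α)) *
      Complex.exp ((t₂ : ℂ) * (1 - w - ((1 - α : ℝ) : ℂ))) := by
    rw [← Complex.exp_add]
    congr 1
    push_cast
    ring
  rw [e5]
  ring

theorem Phi_abs_le2 (t : ℝ) (n m : ℤ) {α : ℝ} (hα0 : 0 < α) (hα1 : α < 1)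
    (hn : n ≤ 0) (φ : ℝ) :
    ‖Phi t n m α (circleMap 0 α φ)‖ ≤
      Real.exp (-(α * (1 - Real.cos φ) * (t - n / (1 + α) ^ 2))) := by
  have hw : circleMap 0 α φ = ((α * Real.cos φ : ℝ) : ℂ) + ((α * Real.sin φ : ℝ) : ℂ) * I := by
    simp only [circleMap, zero_add]
    rw [Complex.exp_mul_I]
    push_cast
    ring
  have nβ : ‖(1 : ℂ) - α‖ = 1 - α := by
    rw [← Complex.ofReal_one, ← Complex.ofReal_sub, Complex.norm_real, Real.norm_eq_abs,
      abs_of_pos (by linarith)]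
  unfold Phi
  simp only [norm_mul, norm_zpow, norm_div, norm_circleMap_zero, nβ, Complex.norm_real,
    Real.norm_eq_abs, abs_of_pos hα0, Complex.norm_exp]
  rw [div_self hα0.ne', one_zpow, mul_one]
  have r1 : ((t : ℂ) * (circleMap 0 α φ - α)).re = t * (α * Real.cos φ - α) := by
    rw [hw]
    generalize α * Real.cos φ = x1
    generalize α * Real.sin φ = x2
    simp
  rw [r1]
  have hc : 0 ≤ 1 - Real.cos φ := by linarith [Real.cos_le_one φ]
  have hc2 : 1 - Real.cos φ ≤ 2 := by linarith [Real.neg_one_le_cos φ]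
  have h1r : 0 < 1 - α := by linarith
  have hsq : (‖1 - circleMap 0 α φ‖ / (1 - α)) ^ 2 =
      1 + 2 * α * (1 - Real.cos φ) / (1 - α) ^ 2 := by
    have hsq : ‖1 - circleMap 0 α φ‖ ^ 2 = (1 - α) ^ 2 + 2 * α * (1 - Real.cos φ) := by
      have e0 : (α * Real.cos φ) ^ 2 + (α * Real.sin φ) ^ 2 = α ^ 2 := by
        have := Real.sin_sq_add_cos_sq φ
        calc _ = α ^ 2 * (Real.sin φ ^ 2 + Real.cos φ ^ 2) := by ring
          _ = _ := by rw [this, mul_one]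
      have e1 : (1 - α) ^ 2 + 2 * α * (1 - Real.cos φ) = 1 + α ^ 2 - 2 * (α * Real.cos φ) := by ring
      rw [← Complex.normSq_eq_norm_sq, hw, Complex.normSq_apply, e1]
      generalize α * Real.cos φ = x1 at *
      generalize α * Real.sin φ = x2 at *
      simp
      nlinarith
    rw [div_pow, hsq]
    field_simp
  have hlow : Real.exp (α * (1 - Real.cos φ) / (1 + α) ^ 2) ≤ ‖1 - circleMap 0 α φ‖ / (1 - α) := by
    have h0 : (Real.exp (α * (1 - Real.cos φ) / (1 + α) ^ 2)) ^ 2 ≤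
        (‖1 - circleMap 0 α φ‖ / (1 - α)) ^ 2 := by
      rw [hsq, ← Real.exp_nat_mul]
      set x := 2 * α * (1 - Real.cos φ) / (1 - α) ^ 2 with hx
      have hx0 : 0 ≤ x := by positivity
      have h3 := Real.one_sub_inv_le_log_of_pos (by linarith : 0 < 1 + x)
      rw [← Real.le_log_iff_exp_le (by linarith)]
      refine le_trans ?_ h3
      have hx2 : (1 + x) * (1 - α) ^ 2 ≤ (1 + α) ^ 2 := by
        rw [hx, add_mul, div_mul_cancel₀ _ (by positivity)]
        nlinarith
      have e : 1 - (1 + x)⁻¹ = 2 * α * (1 - Real.cos φ) / ((1 + x) * (1 - α) ^ 2) := by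
        have : 1 + x ≠ 0 := by linarith
        have h4 : 2 * α * (1 - Real.cos φ) = x * (1 - α) ^ 2 := by
          rw [hx]; field_simp
        rw [h4]
        field_simp
        ring
      rw [e]
      push_cast
      rw [← mul_div_assoc, ← mul_assoc]
      apply div_le_div_of_nonneg_left _ _ hx2
      · positivity
      · positivity
    exact le_of_sq_le_sq h0 (by positivity)
  obtain ⟨k, hk⟩ : ∃ k : ℕ, n = -(k : ℤ) := ⟨n.natAbs, by omega⟩
  subst hk
  have hz : (‖1 - circleMap 0 α φ‖ / (1 - α)) ^ (-(k : ℤ)) ≤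
      Real.exp (-(k * (α * (1 - Real.cos φ) / (1 + α) ^ 2))) := by
    rw [zpow_neg, zpow_natCast, Real.exp_neg, Real.exp_nat_mul]
    gcongr
  calc _ ≤ Real.exp (t * (α * Real.cos φ - α)) *
        Real.exp (-(k * (α * (1 - Real.cos φ) / (1 + α) ^ 2))) := by gcongr
    _ = _ := by
      rw [← Real.exp_add]
      congr 1
      push_cast
      ring

theorem phi_lim {S t₁ t₂ : ℝ → ℝ} {n₁ m₁ n₂ m₂ : ℝ → ℤ} {α u d₁ e₁ q₁ d₂ e₂ q₂ : ℝ}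
    (hα0 : 0 < α) (hα1 : α < 1) (h1 : Reg atTop S t₁ n₁ m₁ α u d₁ e₁ q₁)
    (h2 : Reg atTop S t₂ n₂ m₂ α u d₂ e₂ q₂) (hd : 0 < d₁ - d₂) (hQ : 0 < q₁ - q₂)
    (ht : ∀ᶠ T in atTop, t₂ T ≤ t₁ T) (hn : ∀ᶠ T in atTop, n₁ T ≤ n₂ T) :
    Tendsto (fun T => (S T : ℂ) * ∮ w in C((0 : ℂ), α),
      AF α (t₁ T) (n₁ T) (m₁ T) w * BF α (t₂ T) (n₂ T) (m₂ T) (w - 1)) atTop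
      (nhds (I * ((Real.sqrt (π / ((q₁ - q₂) * α ^ 2)) *
        Real.exp (-(e₁ - e₂) ^ 2 / (4 * (q₁ - q₂))) : ℝ) : ℂ))) := by
  have hS := h1.hS
  have a0 : (α : ℂ) ≠ 0 := by exact_mod_cast hα0.ne'
  have main := circ_lim (r := fun _ => α) (β := α) hS tendsto_const_nhds
    (H := fun T w => AF α (t₁ T) (n₁ T) (m₁ T) w * BF α (t₂ T) (n₂ T) (m₂ T) (w - 1))
    (h := fun y => (α : ℂ)⁻¹ * Complex.exp (-(((q₁ - q₂) * α ^ 2 : ℝ) : ℂ) * (y : ℂ) ^ 2 +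
      (I * α * (e₁ - e₂)) * y + 0))
    (g := fun y => α⁻¹ * Real.exp (-(α * (2 / π ^ 2) * ((1 - α) ^ 2 / (1 + α) ^ 2 *
      ((d₁ - d₂) / 2))) * y ^ 2)) ?_ ?_ ?_ ?_
  · have hintg := integral_cexp_quadratic (b := -(((q₁ - q₂) * α ^ 2 : ℝ) : ℂ)) (by
      rw [Complex.neg_re, Complex.ofReal_re]
      have : 0 < (q₁ - q₂) * α ^ 2 := by positivity
      linarith) (I * α * (e₁ - e₂)) 0
    rw [integral_const_mul, hintg] at main
    refine main.congr' ?_ |>.trans (le_of_eq (congrArg nhds ?_))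
    · exact EventuallyEq.refl _ _
    · have hp : 0 ≤ π / ((q₁ - q₂) * α ^ 2) := by positivity
      have hR : ((Real.sqrt (π / ((q₁ - q₂) * α ^ 2)) *
          Real.exp (-(e₁ - e₂) ^ 2 / (4 * (q₁ - q₂))) : ℝ) : ℂ) =
          ((π / ((q₁ - q₂) * α ^ 2) : ℝ) : ℂ) ^ (1 / 2 : ℂ) *
          Complex.exp ((-(e₁ - e₂) ^ 2 / (4 * (q₁ - q₂)) : ℝ) : ℂ) := by
        rw [Real.sqrt_eq_rpow, Complex.ofReal_mul, Complex.ofReal_cpow hp, Complex.ofReal_exp]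
        norm_num
      have e : (0 : ℂ) - (I * α * (e₁ - e₂)) ^ 2 / (4 * -(((q₁ - q₂) * α ^ 2 : ℝ) : ℂ)) =
          ((-(e₁ - e₂) ^ 2 / (4 * (q₁ - q₂)) : ℝ) : ℂ) := by
        have q0 : (q₁ : ℂ) - q₂ ≠ 0 := by exact_mod_cast hQ.ne'
        rw [mul_pow, mul_pow, Complex.I_sq]
        push_cast
        field_simp
        ring
      rw [neg_neg, ← Complex.ofReal_div, hR, e]
      generalize Complex.exp _ = X
      generalize (_ : ℂ) ^ (1 / 2 : ℂ) = Y
      field_simp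
  · apply Integrable.const_mul
    apply integrable_exp_neg_mul_sq
    have : 0 < 1 - α := by linarith
    have := Real.pi_pos
    positivity
  · apply Eventually.of_forall
    intro T
    refine circ_cont (f := fun w => AF α (t₁ T) (n₁ T) (m₁ T) w * BF α (t₂ T) (n₂ T) (m₂ T) (w - 1))
      hα0.le ?_
    have : ∀ w ∈ Metric.sphere (0 : ℂ) α, AF α (t₁ T) (n₁ T) (m₁ T) w *
        BF α (t₂ T) (n₂ T) (m₂ T) (w - 1) =
        w⁻¹ * Phi (t₁ T - t₂ T) (n₁ T - n₂ T) (m₁ T - m₂ T) α w := by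
      intro w hw
      rw [← phi_prod hα0 hα1 (by simpa using hw)]
      unfold AF BF
      rw [neg_sub]
      ring
    refine ContinuousOn.congr ?_ this
    refine ContinuousOn.mul (ContinuousOn.inv₀ continuousOn_id ?_) (Phi_cont _ _ _ hα0 hα1 hα0 hα1)
    intro w hw h0
    have hw' : ‖w‖ = α := by simpa using hw
    rw [show w = 0 from h0, norm_zero] at hw'
    linarith
  · have hX := (h1.hd.sub h2.hd).eventually (lt_mem_nhds (half_lt_self hd))
    filter_upwards [hX, ht, hn, hS.eventually_gt_atTop 0] with T k1 k2 k3 k4 y hy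
    have hw : ‖circleMap 0 α (y / S T)‖ = α := by rw [norm_circleMap_zero, abs_of_pos hα0]
    have e : AF α (t₁ T) (n₁ T) (m₁ T) (circleMap 0 α (y / S T)) *
        BF α (t₂ T) (n₂ T) (m₂ T) (circleMap 0 α (y / S T) - 1) =
        (circleMap 0 α (y / S T))⁻¹ * Phi (t₁ T - t₂ T) (n₁ T - n₂ T) (m₁ T - m₂ T) α
          (circleMap 0 α (y / S T)) := by
      rw [← phi_prod hα0 hα1 hw]
      unfold AF BF
      rw [neg_sub]
      ring
    rw [e, norm_mul, norm_inv, hw]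
    refine mul_le_mul_of_nonneg_left ?_ (by positivity)
    refine (Phi_abs_le2 _ _ _ hα0 hα1 (by omega) _).trans ?_
    apply Real.exp_le_exp.2
    have hc : 2 / π ^ 2 * (y / S T) ^ 2 ≤ 1 - Real.cos (y / S T) := by
      have := Real.cos_le_one_sub_mul_cos_sq (x := y / S T) (by
        rw [abs_div, abs_of_pos k4, div_le_iff₀ k4]; exact hy)
      linarith
    have hα1' : 0 < 1 - α := by linarith
    have f1 : S T ^ 2 * ((d₁ - d₂) / 2) ≤ (t₁ T - t₂ T) + (n₂ T - n₁ T) / (1 - α) ^ 2 := by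
      rw [← sub_div, lt_div_iff₀ (by positivity)] at k1
      have : t₁ T - n₁ T / (1 - α) ^ 2 - (t₂ T - n₂ T / (1 - α) ^ 2) =
        (t₁ T - t₂ T) + (n₂ T - n₁ T) / (1 - α) ^ 2 := by ring
      rw [this] at k1
      linarith
    have k3' : (0 : ℝ) ≤ (n₂ T : ℝ) - n₁ T := by
      have : (n₁ T : ℝ) ≤ n₂ T := by exact_mod_cast k3
      linarith
    have f2 : (1 - α) ^ 2 / (1 + α) ^ 2 * ((t₁ T - t₂ T) + (n₂ T - n₁ T) / (1 - α) ^ 2) ≤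
        (t₁ T - t₂ T) - ((n₁ T - n₂ T : ℤ) : ℝ) / (1 + α) ^ 2 := by
      have g1 : (1 - α) ^ 2 / (1 + α) ^ 2 ≤ 1 := by
        rw [div_le_one (by positivity)]
        nlinarith
      have g2 : (1 - α) ^ 2 / (1 + α) ^ 2 * (t₁ T - t₂ T) ≤ 1 * (t₁ T - t₂ T) :=
        mul_le_mul_of_nonneg_right g1 (by linarith)
      have g3 : (1 - α) ^ 2 / (1 + α) ^ 2 * (((n₂ T : ℝ) - n₁ T) / (1 - α) ^ 2) =
          ((n₂ T : ℝ) - n₁ T) / (1 + α) ^ 2 := by field_simp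
      rw [mul_add, g3]
      push_cast
      have g4 : ((n₁ T : ℝ) - n₂ T) / (1 + α) ^ 2 = -(((n₂ T : ℝ) - n₁ T) / (1 + α) ^ 2) := by ring
      rw [g4]
      linarith
    have f3 : (1 - α) ^ 2 / (1 + α) ^ 2 * (S T ^ 2 * ((d₁ - d₂) / 2)) ≤
        (t₁ T - t₂ T) - ((n₁ T - n₂ T : ℤ) : ℝ) / (1 + α) ^ 2 :=
      le_trans (mul_le_mul_of_nonneg_left f1 (by positivity)) f2
    have f4 : (α * (2 / π ^ 2) * ((1 - α) ^ 2 / (1 + α) ^ 2 * ((d₁ - d₂) / 2))) * y ^ 2 ≤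
        α * (1 - Real.cos (y / S T)) * ((t₁ T - t₂ T) - ((n₁ T - n₂ T : ℤ) : ℝ) / (1 + α) ^ 2) := by
      calc _ = α * (2 / π ^ 2 * (y / S T) ^ 2) *
            ((1 - α) ^ 2 / (1 + α) ^ 2 * (S T ^ 2 * ((d₁ - d₂) / 2))) := by field_simp
        _ ≤ _ := by
          apply mul_le_mul _ f3 (by positivity)
          · exact mul_nonneg hα0.le (by linarith [Real.cos_le_one (y / S T)])
          · exact mul_le_mul_of_nonneg_left hc hα0.le
    linarith
  · intro y
    have kl := kappa_lim hS α 0 y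
    have ct := circ_tend hS α 0 y
    simp only [zero_div, sub_zero, Complex.ofReal_zero, neg_zero, zero_add] at kl ct
    have p1 := Phi_lim hα0 hα1 h1 kl
    have p2 := Phi_lim (by linarith : 0 < 1 - α) (by linarith) h2.symm kl.neg
    have p3 := ((ct.inv₀ a0).mul p1).mul p2
    have elim : (α : ℂ)⁻¹ * Complex.exp (e₁ * (I * α * y) + q₁ * (I * α * y) ^ 2 -
        ((u / (3 * α * (1 - α)) : ℝ) : ℂ) * (I * α * y) ^ 3) *
        Complex.exp (e₂ * -(I * α * y) + ((-q₂ : ℝ) : ℂ) * (-(I * α * y)) ^ 2 -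
        ((u / (3 * (1 - α) * (1 - (1 - α))) : ℝ) : ℂ) * (-(I * α * y)) ^ 3) =
        (α : ℂ)⁻¹ * Complex.exp (-(((q₁ - q₂) * α ^ 2 : ℝ) : ℂ) * (y : ℂ) ^ 2 +
      (I * α * (e₁ - e₂)) * y + 0) := by
      rw [mul_assoc, ← Complex.exp_add]
      congr 2
      have : u / (3 * (1 - α) * (1 - (1 - α))) = u / (3 * α * (1 - α)) := by
        congr 1; ring
      rw [this]
      push_cast
      have hI : I ^ 2 = -1 := Complex.I_sq
      linear_combination (↑q₁ * ↑α ^ 2 * ↑y ^ 2 - ↑q₂ * ↑α ^ 2 * ↑y ^ 2) * hI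
    rw [elim] at p3
    refine p3.congr' ?_
    filter_upwards [hS.eventually_gt_atTop 0] with T hT
    have hS0 : (S T : ℂ) ≠ 0 := by exact_mod_cast hT.ne'
    unfold AF BF
    have e1 : (α : ℂ) + S T * (circleMap 0 α (y / S T) - α) / S T = circleMap 0 α (y / S T) := by
      field_simp; ring
    have e2 : ((1 - α : ℝ) : ℂ) + -(S T * (circleMap 0 α (y / S T) - α)) / S T =
        -(circleMap 0 α (y / S T) - 1) := by
      push_cast; field_simp; ring
    rw [e1, e2]

theorem reg_abs {S t g : ℝ → ℝ} {n m : ℝ → ℤ} {α u d s : ℝ} (hα0 : 0 < α) (hα1 : α < 1)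
    (hu : 0 < u) (hS : Tendsto S atTop atTop)
    (ht : Tendsto (fun T => t T / S T ^ 3) atTop (nhds u))
    (hn : Tendsto (fun T => (n T : ℝ) / S T ^ 3) atTop (nhds ((1 - α) ^ 2 * u)))
    (hd : Tendsto (fun T => (t T - n T / (1 - α) ^ 2) / S T ^ 2) atTop (nhds d))
    (hm : ∀ T, (m T : ℝ) = t T + n T - 2 * Real.sqrt (t T * n T) - s * S T - g T)
    (hg0 : ∀ T, 0 ≤ g T) (hg1 : ∀ T, g T ≤ 1) :
    Reg atTop S t n m α u d (s / α - d ^ 2 * (1 - α) / (4 * u * α)) (d / (2 * α)) := by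
  have hb : 0 < 1 - α := by linarith
  have hSi : Tendsto (fun T => (S T)⁻¹) atTop (nhds 0) := tendsto_inv_atTop_zero.comp hS
  have hgS : Tendsto (fun T => g T / S T) atTop (nhds 0) := by
    refine squeeze_zero' ?_ ?_ hSi
    · filter_upwards [hS.eventually_gt_atTop 0] with T h
      exact div_nonneg (hg0 T) h.le
    · filter_upwards [hS.eventually_gt_atTop 0] with T h
      rw [div_eq_mul_inv]
      exact mul_le_of_le_one_left (by positivity) (hg1 T)
  have hQ : Tendsto (fun T => Real.sqrt (t T * n T) / S T ^ 3) atTop (nhds ((1 - α) * u)) := by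
    have := (Real.continuous_sqrt.tendsto _).comp (ht.mul hn)
    have e : Real.sqrt (u * ((1 - α) ^ 2 * u)) = (1 - α) * u := by
      rw [show u * ((1 - α) ^ 2 * u) = ((1 - α) * u) ^ 2 by ring]
      exact Real.sqrt_sq (by positivity)
    rw [e] at this
    refine this.congr' ?_
    filter_upwards [hS.eventually_gt_atTop 0] with T h
    simp only [Function.comp]
    rw [show t T / S T ^ 3 * (n T / S T ^ 3) = t T * n T / (S T ^ 3) ^ 2 by field_simp,
      Real.sqrt_div' _ (by positivity), Real.sqrt_sq (by positivity)]
  have hpos : ∀ᶠ T in atTop, 0 < t T * n T := by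
    filter_upwards [(ht.mul hn).eventually (lt_mem_nhds (by positivity)),
      hS.eventually_gt_atTop 0] with T h h'
    rw [show t T / S T ^ 3 * (n T / S T ^ 3) = t T * n T / (S T ^ 3) ^ 2 by field_simp] at h
    by_contra hc
    push Not at hc
    have := div_nonpos_of_nonpos_of_nonneg hc (by positivity : 0 ≤ (S T ^ 3) ^ 2)
    linarith
  have hD : Tendsto (fun T => ((1 - α) ^ 2 * t T + 2 * (1 - α) * Real.sqrt (t T * n T) + n T) / S T ^ 3)
      atTop (nhds (4 * (1 - α) ^ 2 * u)) := by
    have := ((ht.const_mul ((1 - α) ^ 2)).add (hQ.const_mul (2 * (1 - α)))).add hn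
    refine (this.congr fun T => ?_).trans (le_of_eq (congrArg nhds ?_))
    · ring
    · ring
  have hl : Tendsto (fun i => (t i - n i / (1 - α) - m i / α) / S i) atTop
      (nhds (s / α - d ^ 2 * (1 - α) / (4 * u * α))) := by
    have h1 := ((hd.const_mul ((1 - α) ^ 2)).pow 2).div hD (by positivity)
    have h2 := ((tendsto_const_nhds (x := s)).add hgS).div_const α
    have h3 := h2.sub (h1.div_const (α * (1 - α)))
    refine (h3.congr' ?_).trans (le_of_eq (congrArg nhds ?_))
    · filter_upwards [hpos, hS.eventually_gt_atTop 0, hD.eventually (lt_mem_nhds (by positivity))]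
        with T h h' hDT
      have hq2 : Real.sqrt (t T * n T) ^ 2 = t T * n T := Real.sq_sqrt h.le
      simp only [Pi.div_apply]
      rw [hm T]
      set Q := Real.sqrt (t T * n T)
      set D := (1 - α) ^ 2 * t T + 2 * (1 - α) * Q + n T with hDd
      have hD0 : D ≠ 0 := by
        rintro h0
        rw [h0, zero_div] at hDT
        exact lt_irrefl _ hDT
      have key : ((1 - α) ^ 2 * ((t T - n T / (1 - α) ^ 2) / S T ^ 2)) ^ 2 / (D / S T ^ 3) =
          ((1 - α) ^ 2 * t T - 2 * (1 - α) * Q + n T) / S T := by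
        rw [div_eq_div_iff (by positivity) h'.ne']
        have : (1 - α) ^ 2 * ((t T - n T / (1 - α) ^ 2) / S T ^ 2) =
            ((1 - α) ^ 2 * t T - n T) / S T ^ 2 := by field_simp
        rw [this]
        have h4 : ((1 - α) ^ 2 * t T - n T) ^ 2 = ((1 - α) ^ 2 * t T - 2 * (1 - α) * Q + n T) * D := by
          rw [hDd]; linear_combination (4 * (1 - α) ^ 2) * hq2
        rw [div_pow, h4]
        field_simp
      rw [key]
      field_simp
      ring
    · field_simp
      ring
  refine ⟨hS, hn, ?_, hd, hl, ?_⟩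
  · have := (((ht.add hn).sub (hQ.const_mul 2)).sub ((hSi.pow 2).const_mul s)).sub
      (hgS.mul (hSi.pow 2))
    refine (this.congr' ?_).trans (le_of_eq (congrArg nhds ?_))
    · filter_upwards [hS.eventually_gt_atTop 0] with T h
      rw [hm T]
      field_simp
    · ring
  · have := (hd.sub (hl.mul hSi)).div_const (2 * α)
    refine (this.congr' ?_).trans (le_of_eq (congrArg nhds ?_))
    · filter_upwards [hS.eventually_gt_atTop 0] with T h
      field_simp
      ring
    · ring

theorem S_pow3 {T : ℝ} (hT : 0 < T) : (T ^ ((1 : ℝ) / 3)) ^ 3 = T := by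
  rw [← Real.rpow_natCast, ← Real.rpow_mul hT.le]; norm_num

theorem S_pow2 {T : ℝ} (hT : 0 < T) : (T ^ ((1 : ℝ) / 3)) ^ 2 = T ^ ((2 : ℝ) / 3) := by
  rw [← Real.rpow_natCast, ← Real.rpow_mul hT.le]; norm_num

theorem reg_T (M : ℕ) {α u a p G : ℝ} (τ s : ℝ) (hα0 : 0 < α) (hα1 : α < 1)
    (hu : 0 < u) (ha : a = (1 - α) ^ 2 * u) (hG : G = 1 + p + (1 - p) / (1 - α) ^ 2) :
    Reg atTop (fun T : ℝ => T ^ ((1 : ℝ) / 3)) (tT u τ p) (fun T => nT M a τ p T - M)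
      (fun T => xT M u a τ p s T + (nT M a τ p T - M)) α u (-(τ * G))
      (s / α - (-(τ * G)) ^ 2 * (1 - α) / (4 * u * α)) (-(τ * G) / (2 * α)) := by
  have hb : 0 < 1 - α := by linarith
  have hS : Tendsto (fun T : ℝ => T ^ ((1 : ℝ) / 3)) atTop atTop :=
    tendsto_rpow_atTop (by norm_num)
  have hSi : Tendsto (fun T : ℝ => (T ^ ((1 : ℝ) / 3))⁻¹) atTop (nhds 0) :=
    tendsto_inv_atTop_zero.comp hS
  have hN : ∀ T, ((nT M a τ p T - M : ℤ) : ℝ) = a * T - τ * (p - 1) * T ^ ((2 : ℝ) / 3) -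
      Int.fract (a * T - τ * (p - 1) * T ^ ((2 : ℝ) / 3)) := by
    intro T
    unfold nT
    rw [add_sub_cancel_left, Int.self_sub_fract]
  have hf : Tendsto (fun T : ℝ => Int.fract (a * T - τ * (p - 1) * T ^ ((2 : ℝ) / 3)) *
      (T ^ ((1 : ℝ) / 3))⁻¹) atTop (nhds 0) := by
    refine squeeze_zero' ?_ ?_ hSi
    · filter_upwards [hS.eventually_gt_atTop 0] with T h
      exact mul_nonneg (Int.fract_nonneg _) (by positivity)
    · filter_upwards [hS.eventually_gt_atTop 0] with T h
      exact mul_le_of_le_one_left (by positivity) (Int.fract_lt_one _).le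
  refine reg_abs (g := fun T => Int.fract (tT u τ p T -
    2 * Real.sqrt (tT u τ p T * ((nT M a τ p T - M : ℤ) : ℝ)) - s * T ^ ((1 : ℝ) / 3)))
    hα0 hα1 hu hS ?_ ?_ ?_ ?_ (fun T => Int.fract_nonneg _) (fun T => (Int.fract_lt_one _).le)
  · have := (tendsto_const_nhds (x := u) (f := (atTop : Filter ℝ))).sub (hSi.const_mul (τ * (p + 1)))
    refine (this.congr' ?_).trans (le_of_eq (congrArg nhds ?_))
    · filter_upwards [eventually_gt_atTop 0, hS.eventually_gt_atTop 0] with T hT h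
      unfold tT
      rw [← S_pow2 hT]
      nth_rw 2 [← S_pow3 hT]
      field_simp
    · ring
  · have := ((tendsto_const_nhds (x := a) (f := (atTop : Filter ℝ))).sub
      (hSi.const_mul (τ * (p - 1)))).sub (hf.mul (hSi.pow 2))
    refine (this.congr' ?_).trans (le_of_eq (congrArg nhds ?_))
    · filter_upwards [eventually_gt_atTop 0, hS.eventually_gt_atTop 0] with T hT h
      rw [hN]
      generalize Int.fract (a * T - τ * (p - 1) * T ^ ((2 : ℝ) / 3)) = f
      rw [← S_pow2 hT]
      nth_rw 4 [← S_pow3 hT]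
      field_simp
    · rw [ha]; ring
  · have := (tendsto_const_nhds (x := -(τ * G)) (f := (atTop : Filter ℝ))).add
      ((hf.mul hSi).div_const ((1 - α) ^ 2))
    refine (this.congr' ?_).trans (le_of_eq (congrArg nhds ?_))
    · filter_upwards [eventually_gt_atTop 0, hS.eventually_gt_atTop 0] with T hT h
      rw [hN]
      generalize Int.fract (a * T - τ * (p - 1) * T ^ ((2 : ℝ) / 3)) = f
      unfold tT
      rw [← S_pow2 hT]
      rw [hG, ha]
      field_simp
      ring
    · ring
  · intro T
    have : (xT M u a τ p s T : ℝ) = (tT u τ p T -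
      2 * Real.sqrt (tT u τ p T * ((nT M a τ p T - M : ℤ) : ℝ)) - s * T ^ ((1 : ℝ) / 3)) -
      Int.fract (tT u τ p T -
      2 * Real.sqrt (tT u τ p T * ((nT M a τ p T - M : ℤ) : ℝ)) - s * T ^ ((1 : ℝ) / 3)) := by
      rw [Int.self_sub_fract]; rfl
    rw [Int.cast_add, this]
    ring

theorem ind_ev (M : ℕ) {a u p τ₁ τ₂ : ℝ} (hp : |p| ≤ 1) (h : ¬ τ₁ < τ₂) : ∀ᶠ T : ℝ in atTop,
    ¬ (nT M a τ₁ p T ≤ nT M a τ₂ p T ∧ tT u τ₂ p T ≤ tT u τ₁ p T ∧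
      ¬ (nT M a τ₁ p T = nT M a τ₂ p T ∧ tT u τ₁ p T = tT u τ₂ p T)) := by
  obtain ⟨hp1, hp2⟩ := abs_le.mp hp
  rcases eq_or_lt_of_le (not_lt.mp h) with h | h
  · subst h
    simp
  have hT2 : Tendsto (fun T : ℝ => T ^ ((2 : ℝ) / 3)) atTop atTop :=
    tendsto_rpow_atTop (by norm_num)
  rcases lt_or_ge (-1) p with hp3 | hp3
  · filter_upwards [eventually_gt_atTop 0, hT2.eventually_gt_atTop 0] with T hT hTT hh
    have := hh.2.1
    unfold tT at this
    have h5 : 0 < (τ₁ - τ₂) * (p + 1) * T ^ ((2 : ℝ) / 3) := by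
      have : 0 < τ₁ - τ₂ := by linarith
      have : 0 < p + 1 := by linarith
      positivity
    nlinarith
  · have hp4 : p = -1 := le_antisymm hp3 hp1
    subst hp4
    filter_upwards [hT2.eventually_gt_atTop (1 / (2 * (τ₁ - τ₂)))] with T hTT hh
    have := hh.1
    unfold nT at this
    have h6 := Int.floor_le (a * T - τ₂ * (-1 - 1) * T ^ ((2 : ℝ) / 3))
    have h7 := Int.lt_floor_add_one (a * T - τ₁ * (-1 - 1) * T ^ ((2 : ℝ) / 3))
    have h8 : ((⌊a * T - τ₁ * (-1 - 1) * T ^ ((2 : ℝ) / 3)⌋ : ℤ) : ℝ) ≤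
      ⌊a * T - τ₂ * (-1 - 1) * T ^ ((2 : ℝ) / 3)⌋ := Int.cast_le.mpr (by linarith)
    have h9 : 0 < 2 * (τ₁ - τ₂) := by linarith
    rw [div_lt_iff₀ h9] at hTT
    nlinarith

theorem ind_ev2 (M : ℕ) {a u p τ₁ τ₂ : ℝ} (hp : |p| ≤ 1) (h : τ₁ < τ₂) : ∀ᶠ T : ℝ in atTop,
    nT M a τ₁ p T ≤ nT M a τ₂ p T ∧ tT u τ₂ p T ≤ tT u τ₁ p T := by
  obtain ⟨hp1, hp2⟩ := abs_le.mp hp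
  filter_upwards [eventually_gt_atTop 0] with T hT
  have hTT : 0 < T ^ ((2 : ℝ) / 3) := by positivity
  constructor
  · unfold nT
    refine add_le_add_right (Int.floor_le_floor ?_) _
    have : 0 ≤ (τ₂ - τ₁) * (1 - p) * T ^ ((2 : ℝ) / 3) := by
      have : 0 < τ₂ - τ₁ := by linarith
      have : 0 ≤ 1 - p := by linarith
      positivity
    nlinarith
  · unfold tT
    have : 0 ≤ (τ₂ - τ₁) * (p + 1) * T ^ ((2 : ℝ) / 3) := by
      have : 0 < τ₂ - τ₁ := by linarith
      have : 0 ≤ p + 1 := by linarith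
      positivity
    nlinarith

theorem exp_two_pi_three : Complex.exp (2 * (π : ℂ) * I / 3) = ((-1 / 2 : ℝ) : ℂ) + ((Real.sqrt 3 / 2 : ℝ) : ℂ) * I := by
  have : 2 * (π : ℂ) * I / 3 = ((π - π / 3 : ℝ) : ℂ) * I := by push_cast; ring
  rw [this, Complex.exp_mul_I, ← Complex.ofReal_cos, ← Complex.ofReal_sin, Real.cos_pi_sub,
    Real.sin_pi_sub, Real.cos_pi_div_three, Real.sin_pi_div_three]
  norm_num

theorem exp_neg_two_pi_three : Complex.exp (-2 * (π : ℂ) * I / 3) = ((-1 / 2 : ℝ) : ℂ) + ((-(Real.sqrt 3 / 2) : ℝ) : ℂ) * I := by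
  have : -2 * (π : ℂ) * I / 3 = ((-(π - π / 3) : ℝ) : ℂ) * I := by push_cast; ring
  rw [this, Complex.exp_mul_I, ← Complex.ofReal_cos, ← Complex.ofReal_sin, Real.cos_neg,
    Real.sin_neg, Real.cos_pi_sub,
    Real.sin_pi_sub, Real.cos_pi_div_three, Real.sin_pi_div_three]
  norm_num

/-- the cubic exponential -/
def gE (τ σ : ℝ) (w : ℂ) : ℂ := Complex.exp (-(w ^ 3 / 3 + (τ : ℂ) * w ^ 2 - (σ : ℂ) * w))

theorem gE_norm (τ σ x y : ℝ) : ‖gE τ σ ((x : ℂ) + (y : ℂ) * I)‖ =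
    Real.exp (-(x * (x ^ 2 - 3 * y ^ 2) / 3) - τ * (x ^ 2 - y ^ 2) + σ * x) := by
  unfold gE
  rw [Complex.norm_exp]
  congr 1
  have : -(((x : ℂ) + (y : ℂ) * I) ^ 3 / 3 + (τ : ℂ) * ((x : ℂ) + (y : ℂ) * I) ^ 2 -
      (σ : ℂ) * ((x : ℂ) + (y : ℂ) * I)) =
      ((-(x * (x ^ 2 - 3 * y ^ 2) / 3) - τ * (x ^ 2 - y ^ 2) + σ * x : ℝ) : ℂ) +
      ((-((3 * x ^ 2 * y - y ^ 3) / 3) - τ * (2 * x * y) + σ * y : ℝ) : ℂ) * I := by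
    push_cast
    ring_nf
    rw [show I ^ 3 = -I by rw [pow_succ, Complex.I_sq]; ring, Complex.I_sq]
    ring
  rw [this, Complex.add_re, Complex.ofReal_re, Complex.re_ofReal_mul, Complex.I_re]
  ring

theorem gE_diff (τ σ : ℝ) : Differentiable ℂ (gE τ σ) := by
  unfold gE; fun_prop

theorem gE_cont (τ σ : ℝ) : Continuous (gE τ σ) := (gE_diff τ σ).continuous

theorem cubic_bdd (A B D : ℝ) : ∃ K, ∀ s : ℝ, 0 ≤ s → -s ^ 3 / 3 + A * s ^ 2 + B * s + D ≤ K := by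
  refine ⟨|A| * (3 * (|A| + |B|) + 3) ^ 2 + |B| * (3 * (|A| + |B|) + 3) + D, fun s hs => ?_⟩
  have h1 : A * s ^ 2 ≤ |A| * s ^ 2 := by gcongr; exact le_abs_self A
  have h2 : B * s ≤ |B| * s := by gcongr; exact le_abs_self B
  have hA := abs_nonneg A
  have hB := abs_nonneg B
  generalize |A| = a at *
  generalize |B| = b at *
  rcases le_total s (3 * (a + b) + 3) with h | h
  · have h3 : a * s ^ 2 ≤ a * (3 * (a + b) + 3) ^ 2 := by gcongr
    have h4 : b * s ≤ b * (3 * (a + b) + 3) := by gcongr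
    have : 0 ≤ s ^ 3 := by positivity
    linarith
  · have h3 : s ^ 3 ≥ (3 * (a + b) + 3) * s ^ 2 := by
      nlinarith [mul_nonneg (sub_nonneg.mpr h) (sq_nonneg s)]
    have h5 : 1 ≤ s := by linarith
    have h4 : b * s ≤ b * s ^ 2 := by
      gcongr
      nlinarith
    have : 0 ≤ s ^ 2 := by positivity
    have : 0 ≤ a * (3 * (a + b) + 3) ^ 2 + b * (3 * (a + b) + 3) := by positivity
    nlinarith

theorem ray_bound (τ σ a : ℝ) : ∃ K, 0 ≤ K ∧ ∀ (e s : ℝ), e ^ 2 = 3 / 4 → 0 ≤ s →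
    ‖gE τ σ ((a : ℂ) + (((-1 / 2 : ℝ) : ℂ) + (e : ℂ) * I) * s)‖ *
    Real.exp ‖(a : ℂ) + (((-1 / 2 : ℝ) : ℂ) + (e : ℂ) * I) * s‖ ≤ K * Real.exp (-s) := by
  obtain ⟨K, hK⟩ := cubic_bdd (a / 2 + τ / 2) (a ^ 2 / 2 + τ * a - σ / 2 + 3)
    (-a ^ 3 / 3 - τ * a ^ 2 + σ * a + |a|)
  refine ⟨Real.exp K, (Real.exp_pos _).le, fun e s he hs => ?_⟩
  have hw : (a : ℂ) + (((-1 / 2 : ℝ) : ℂ) + (e : ℂ) * I) * s =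
      ((a - s / 2 : ℝ) : ℂ) + ((e * s : ℝ) : ℂ) * I := by push_cast; ring
  have hn : ‖(a : ℂ) + (((-1 / 2 : ℝ) : ℂ) + (e : ℂ) * I) * s‖ ≤ |a| + 2 * s := by
    rw [hw]
    refine (norm_add_le _ _).trans ?_
    rw [norm_mul, Complex.norm_I, mul_one, Complex.norm_real, Complex.norm_real, Real.norm_eq_abs,
      Real.norm_eq_abs, abs_mul, abs_of_nonneg hs]
    have h1 : |e| ≤ 1 := by
      rw [abs_le]; constructor <;> nlinarith
    have h2 : |a - s / 2| ≤ |a| + s / 2 := (abs_sub _ _).trans (by rw [abs_of_nonneg (by positivity : 0 ≤ s / 2)])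
    nlinarith
  calc _ ≤ ‖gE τ σ ((a : ℂ) + (((-1 / 2 : ℝ) : ℂ) + (e : ℂ) * I) * s)‖ * Real.exp (|a| + 2 * s) := by
        gcongr
    _ ≤ Real.exp K * Real.exp (-s) := by
      rw [hw, gE_norm, ← Real.exp_add, ← Real.exp_add, Real.exp_le_exp]
      have := hK s hs
      rw [mul_pow, he]
      nlinarith

theorem line_bound (τ σ b : ℝ) (hb0 : 0 ≤ b) (hb : |τ| + 2 ≤ b) : ∃ K, 0 ≤ K ∧ ∀ y : ℝ,
    ‖gE τ σ (-(b : ℂ) + I * y)‖ * Real.exp ‖-(b : ℂ) + I * y‖ ≤ K * Real.exp (-y ^ 2) := by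
  refine ⟨Real.exp (b ^ 3 / 3 - τ * b ^ 2 - σ * b + b + 1), (Real.exp_pos _).le, fun y => ?_⟩
  have hw : -(b : ℂ) + I * y = ((-b : ℝ) : ℂ) + (y : ℂ) * I := by push_cast; ring
  have hn : ‖-(b : ℂ) + I * y‖ ≤ b + |y| := by
    refine (norm_add_le _ _).trans ?_
    rw [norm_mul, Complex.norm_I, one_mul, norm_neg, Complex.norm_real, Complex.norm_real,
      Real.norm_eq_abs, Real.norm_eq_abs, abs_of_nonneg hb0]
  calc _ ≤ ‖gE τ σ (-(b : ℂ) + I * y)‖ * Real.exp (b + |y|) := by gcongr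
    _ ≤ _ := by
      rw [hw, gE_norm, ← Real.exp_add, ← Real.exp_add, Real.exp_le_exp]
      have h1 : |y| ≤ y ^ 2 + 1 := by
        rw [← sq_abs]; nlinarith [sq_nonneg (|y| - 1), abs_nonneg y]
      have h2 : (2 : ℝ) ≤ b - τ := by linarith [le_abs_self τ]
      nlinarith [mul_le_mul_of_nonneg_right h2 (sq_nonneg y)]

theorem horiz_bound (τ σ a b : ℝ) (hb : 6 * |τ| + 10 ≤ b) : ∀ᶠ R : ℝ in atTop,
    ∀ x e : ℝ, e ^ 2 = 3 / 4 → a - R / 2 ≤ x → x ≤ -b →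
    ‖gE τ σ ((x : ℂ) + ((e * R : ℝ) : ℂ) * I)‖ * Real.exp ‖(x : ℂ) + ((e * R : ℝ) : ℂ) * I‖ ≤
      Real.exp (-R) := by
  filter_upwards [eventually_ge_atTop (2 * |a|), eventually_ge_atTop (|σ| + 3)] with R h1 h2 x e he hx1 hx2
  have hs := abs_nonneg σ
  have ht := abs_nonneg τ
  have hR : 0 ≤ R := by linarith
  have hX : -x ≤ R := by linarith [neg_abs_le a]
  have hx0 : x ≤ 0 := by linarith
  have hn : ‖(x : ℂ) + ((e * R : ℝ) : ℂ) * I‖ ≤ 2 * R := by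
    refine (norm_add_le _ _).trans ?_
    rw [norm_mul, Complex.norm_I, mul_one, Complex.norm_real, Complex.norm_real,
      Real.norm_eq_abs, Real.norm_eq_abs, abs_mul, abs_of_nonneg hR, abs_of_nonpos hx0]
    have h1 : |e| ≤ 1 := by
      rw [abs_le]; constructor <;> nlinarith
    nlinarith
  calc _ ≤ ‖gE τ σ ((x : ℂ) + ((e * R : ℝ) : ℂ) * I)‖ * Real.exp (2 * R) := by gcongr
    _ ≤ _ := by
      rw [gE_norm, ← Real.exp_add, Real.exp_le_exp, mul_pow, he]
      have hx2' : x ^ 2 ≤ R ^ 2 := by nlinarith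
      have k1 : -(x * (x ^ 2 - 3 * (3 / 4 * R ^ 2)) / 3) ≤ -(5 / 12) * b * R ^ 2 := by
        have : 5 / 4 * R ^ 2 ≤ 9 / 4 * R ^ 2 - x ^ 2 := by linarith
        have h3 : b * (5 / 4 * R ^ 2) ≤ (-x) * (9 / 4 * R ^ 2 - x ^ 2) := by
          apply mul_le_mul (by linarith) this (by positivity) (by linarith)
        linarith
      have k2 : -τ * (x ^ 2 - 3 / 4 * R ^ 2) ≤ |τ| * R ^ 2 := by
        refine (le_abs_self _).trans ?_
        rw [abs_mul, abs_neg]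
        gcongr
        rw [abs_le]
        constructor <;> nlinarith [sq_nonneg x, sq_nonneg R]
      have k3 : σ * x ≤ |σ| * R := by
        refine (le_abs_self _).trans ?_
        rw [abs_mul, abs_of_nonpos hx0]
        gcongr
      have k4 : (6 * |τ| + 10) * R ^ 2 ≤ b * R ^ 2 := by gcongr
      have k5 : (|σ| + 3) * R ≤ R * R := by gcongr
      nlinarith [mul_nonneg ht (sq_nonneg R)]

theorem sqrt3_sq : (Real.sqrt 3 / 2) ^ 2 = 3 / 4 := by
  rw [div_pow, Real.sq_sqrt (by norm_num)]; norm_num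

theorem ray_prim {f F : ℂ → ℂ} {p ω : ℂ} {A B : ℝ} (hAB : A ≤ B)
    (hF : ∀ s : ℝ, A ≤ s → s ≤ B → HasDerivAt F (f (p + ω * s)) (p + ω * s))
    (hi : IntervalIntegrable (fun s : ℝ => f (p + ω * s)) volume A B) :
    ω * ∫ s in A..B, f (p + ω * s) = F (p + ω * B) - F (p + ω * A) := by
  rw [← intervalIntegral.integral_const_mul]
  refine intervalIntegral.integral_eq_sub_of_hasDerivAt (f := fun s : ℝ => F (p + ω * s)) ?_
    (hi.const_mul ω)
  intro s hs
  rw [Set.uIcc_of_le hAB] at hs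
  have h1 : HasDerivAt (fun s : ℝ => p + ω * (s : ℂ)) ω s := by
    have := ((Complex.ofRealCLM.hasDerivAt (x := s)).const_mul ω).const_add p
    simpa using this
  have := (hF s hs.1 hs.2).scomp s h1
  exact this

theorem horiz_diff {f F : ℂ → ℂ} {x1 x2 Y B : ℝ} (h12 : x1 ≤ x2)
    (hF : ∀ x : ℝ, x1 ≤ x → x ≤ x2 → HasDerivAt F (f (x + (Y : ℂ) * I)) (x + (Y : ℂ) * I))
    (hB : ∀ x : ℝ, x1 ≤ x → x ≤ x2 → ‖f (x + (Y : ℂ) * I)‖ ≤ B) :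
    ‖F (x1 + (Y : ℂ) * I) - F (x2 + (Y : ℂ) * I)‖ ≤ B * (x2 - x1) := by
  rw [norm_sub_rev]
  refine norm_image_sub_le_of_norm_deriv_le_segment' (f := fun x : ℝ => F (x + (Y : ℂ) * I))
    (f' := fun x => f (x + (Y : ℂ) * I)) ?_ (fun x hx => hB x hx.1 hx.2.le) x2 ⟨h12, le_rfl⟩
  intro x hx
  have h1 : HasDerivAt (fun s : ℝ => (s : ℂ) + (Y : ℂ) * I) 1 x := by
    have := (Complex.ofRealCLM.hasDerivAt (x := x)).add_const ((Y : ℂ) * I)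
    simpa using this
  have := (hF x hx.1 hx.2).scomp x h1
  rw [one_smul] at this
  exact this.hasDerivWithinAt

/-- contour deformation from the wedge to the vertical line, with abstract primitives -/
theorem wedge_line_gen {f : ℂ → ℂ} {a b C : ℝ} {c : ℂ} (ha : a ≠ 0) (hb : 0 < b) (hab : -b ≤ a)
    (hI1 : IntegrableOn (fun s : ℝ => f ((a : ℂ) + Complex.exp (2 * (π : ℂ) * I / 3) * (s : ℂ)))
      (Set.Ioi 0))
    (hI2 : IntegrableOn (fun s : ℝ => f ((a : ℂ) + Complex.exp (-2 * (π : ℂ) * I / 3) * (s : ℂ)))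
      (Set.Ioi 0))
    (hI3 : Integrable (fun y : ℝ => f (-(b : ℂ) + I * (y : ℂ))))
    (hH : ∀ᶠ R : ℝ in atTop, ∀ x e : ℝ, e ^ 2 = 3 / 4 → a - R / 2 ≤ x → x ≤ -b →
      ‖f ((x : ℂ) + ((e * R : ℝ) : ℂ) * I)‖ ≤ C * Real.exp (-R))
    (hF : ∀ᶠ R : ℝ in atTop, ∃ Fu Fd : ℂ → ℂ,
      (∀ w : ℂ, w ≠ 0 → 0 ≤ w.im → w.re ≤ a → ‖w‖ ≤ 3 * R → HasDerivAt Fu (f w) w) ∧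
      (∀ w : ℂ, w ≠ 0 → w.im ≤ 0 → w.re ≤ a → ‖w‖ ≤ 3 * R → HasDerivAt Fd (f w) w) ∧
      (Fu (-b) - Fd (-b)) - (Fu a - Fd a) = c) :
    wedgeL a f = I * (∫ y : ℝ, f (-(b : ℂ) + I * (y : ℂ))) + c := by
  have s3 : 0 < Real.sqrt 3 / 2 := by positivity
  have s3' := sqrt3_sq
  set r := Real.sqrt 3 / 2 with hr
  have r1 : r ≤ 1 := by nlinarith
  -- limits
  have l1 := (intervalIntegral_tendsto_integral_Ioi 0 hI1 tendsto_id).const_mul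
    (Complex.exp (2 * (π : ℂ) * I / 3))
  have l2 := (intervalIntegral_tendsto_integral_Ioi 0 hI2 tendsto_id).const_mul
    (Complex.exp (-2 * (π : ℂ) * I / 3))
  have hrR : Tendsto (fun R : ℝ => r * R) atTop atTop := tendsto_id.const_mul_atTop s3
  have l3 := (intervalIntegral_tendsto_integral hI3 (tendsto_neg_atTop_atBot.comp hrR) hrR).const_mul I
  have l4 := (l2.neg.add l1).sub l3
  have l5 : Tendsto (fun R : ℝ => 2 * (C * Real.exp (-R) * (R / 2 - a - b))) atTop (nhds 0) := by
    have h1 := Real.tendsto_pow_mul_exp_neg_atTop_nhds_zero 1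
    have h0 := Real.tendsto_pow_mul_exp_neg_atTop_nhds_zero 0
    have := (h1.sub (h0.const_mul (2 * (a + b)))).const_mul C
    refine (this.congr fun R => ?_).trans (le_of_eq (congrArg nhds ?_))
    · simp only [pow_one, pow_zero]; ring
    · ring
  have key : ∀ᶠ R : ℝ in atTop,
      ‖(-(Complex.exp (-2 * (π : ℂ) * I / 3) * ∫ s in (0 : ℝ)..(id R),
        f ((a : ℂ) + Complex.exp (-2 * (π : ℂ) * I / 3) * (s : ℂ))) +
      Complex.exp (2 * (π : ℂ) * I / 3) * ∫ s in (0 : ℝ)..(id R),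
        f ((a : ℂ) + Complex.exp (2 * (π : ℂ) * I / 3) * (s : ℂ))) -
      I * (∫ y in (Neg.neg ∘ fun R : ℝ => r * R) R..(r * R), f (-(b : ℂ) + I * (y : ℂ))) - c‖ ≤
      2 * (C * Real.exp (-R) * (R / 2 - a - b)) := by
    filter_upwards [hH, hF, eventually_gt_atTop 0, eventually_ge_atTop |a|,
      eventually_ge_atTop b, eventually_ge_atTop (2 * (a + b))] with R hH ⟨Fu, Fd, hu, hd, hc⟩ hR hRa hRb hRab
    have nb : ∀ x y : ℝ, |x| ≤ 3 / 2 * R → |y| ≤ R → ‖(x : ℂ) + (y : ℂ) * I‖ ≤ 3 * R := by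
      intro x y hx hy
      refine (norm_add_le _ _).trans ?_
      rw [norm_mul, Complex.norm_I, mul_one, Complex.norm_real, Complex.norm_real,
        Real.norm_eq_abs, Real.norm_eq_abs]
      linarith
    have nz : ∀ x y : ℝ, x ≠ 0 ∨ y ≠ 0 → (x : ℂ) + (y : ℂ) * I ≠ 0 := by
      intro x y h h0
      have h1 := congrArg Complex.re h0
      have h2 := congrArg Complex.im h0
      simp at h1 h2
      tauto
    have hu' : ∀ x y : ℝ, x ≠ 0 ∨ y ≠ 0 → 0 ≤ y → x ≤ a → |x| ≤ 3 / 2 * R → |y| ≤ R →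
        HasDerivAt Fu (f ((x : ℂ) + (y : ℂ) * I)) ((x : ℂ) + (y : ℂ) * I) := by
      intro x y h1 h2 h3 h4 h5
      exact hu _ (nz x y h1) (by simpa using h2) (by simpa using h3) (nb x y h4 h5)
    have hd' : ∀ x y : ℝ, x ≠ 0 ∨ y ≠ 0 → y ≤ 0 → x ≤ a → |x| ≤ 3 / 2 * R → |y| ≤ R →
        HasDerivAt Fd (f ((x : ℂ) + (y : ℂ) * I)) ((x : ℂ) + (y : ℂ) * I) := by
      intro x y h1 h2 h3 h4 h5
      exact hd _ (nz x y h1) (by simpa using h2) (by simpa using h3) (nb x y h4 h5)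
    obtain ⟨ha1, ha2⟩ := abs_le.mp hRa
    -- rays
    have hxs : ∀ s : ℝ, 0 ≤ s → s ≤ R → (a - s / 2 ≠ 0 ∨ r * s ≠ 0) ∧ |a - s / 2| ≤ 3 / 2 * R ∧
        |r * s| ≤ R := by
      intro s h0 h1
      refine ⟨?_, ?_, ?_⟩
      · rcases eq_or_lt_of_le h0 with h | h
        · left; rw [← h]; simpa using ha
        · right; positivity
      · rw [abs_le]; constructor <;> linarith
      · rw [abs_of_nonneg (by positivity)]; nlinarith
    have p1 := ray_prim (f := f) (F := Fu) (p := a) (ω := Complex.exp (2 * (π : ℂ) * I / 3)) hR.le (by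
      intro s h0 h1
      have e : (a : ℂ) + Complex.exp (2 * (π : ℂ) * I / 3) * s =
          ((a - s / 2 : ℝ) : ℂ) + ((r * s : ℝ) : ℂ) * I := by
        rw [exp_two_pi_three, ← hr]; push_cast; ring
      rw [e]
      obtain ⟨k1, k2, k3⟩ := hxs s h0 h1
      exact hu' _ _ k1 (by positivity) (by linarith) k2 k3)
      (by rw [intervalIntegrable_iff_integrableOn_Ioc_of_le hR.le]
          exact hI1.mono_set Set.Ioc_subset_Ioi_self)
    have p2 := ray_prim (f := f) (F := Fd) (p := a) (ω := Complex.exp (-2 * (π : ℂ) * I / 3)) hR.le (by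
      intro s h0 h1
      have e : (a : ℂ) + Complex.exp (-2 * (π : ℂ) * I / 3) * s =
          ((a - s / 2 : ℝ) : ℂ) + ((-(r * s) : ℝ) : ℂ) * I := by
        rw [exp_neg_two_pi_three, ← hr]; push_cast; ring
      rw [e]
      obtain ⟨k1, k2, k3⟩ := hxs s h0 h1
      have : 0 ≤ r * s := by positivity
      exact hd' _ _ (by rwa [neg_ne_zero]) (by linarith) (by linarith) k2 (by rwa [abs_neg]))
      (by rw [intervalIntegrable_iff_integrableOn_Ioc_of_le hR.le]
          exact hI2.mono_set Set.Ioc_subset_Ioi_self)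
    have hY : 0 ≤ r * R := by positivity
    have hYR : r * R ≤ R := by nlinarith
    have hbb : |(-b)| ≤ 3 / 2 * R := by rw [abs_neg, abs_of_pos hb]; linarith
    have el : ∀ y : ℝ, -(b : ℂ) + I * y = ((-b : ℝ) : ℂ) + (y : ℂ) * I := by
      intro y; push_cast; ring
    have p3 := ray_prim (f := f) (F := Fu) (p := -(b : ℂ)) (ω := I) hY (by
      intro s h0 h1
      rw [el]
      exact hu' _ _ (Or.inl (neg_ne_zero.mpr hb.ne')) h0 hab hbb (by rw [abs_of_nonneg h0]; linarith))
      hI3.intervalIntegrable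
    have p4 := ray_prim (f := f) (F := Fd) (p := -(b : ℂ)) (ω := I) (neg_nonpos.mpr hY) (by
      intro s h0 h1
      rw [el]
      exact hd' _ _ (Or.inl (neg_ne_zero.mpr hb.ne')) h1 hab hbb (by rw [abs_of_nonpos h1]; linarith))
      hI3.intervalIntegrable
    have hac : a - R / 2 ≤ -b := by linarith
    have hxx : ∀ x : ℝ, a - R / 2 ≤ x → x ≤ -b → |x| ≤ 3 / 2 * R := by
      intro x h1 h2
      rw [abs_le]; constructor <;> linarith
    have q1 := horiz_diff (f := f) (F := Fu) (Y := r * R) (B := C * Real.exp (-R)) hac (by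
      intro x h1 h2
      exact hu' _ _ (Or.inl (by linarith)) hY (by linarith) (hxx x h1 h2) (by rwa [abs_of_nonneg hY]))
      (fun x h1 h2 => hH x r s3' h1 h2)
    have q2 := horiz_diff (f := f) (F := Fd) (Y := -r * R) (B := C * Real.exp (-R)) hac (by
      intro x h1 h2
      exact hd' _ _ (Or.inl (by linarith)) (by linarith) (by linarith) (hxx x h1 h2)
        (by rw [neg_mul, abs_neg]; rwa [abs_of_nonneg hY]))
      (fun x h1 h2 => hH x (-r) (by rw [neg_sq]; exact s3') h1 h2)
    have e1 : (a : ℂ) + Complex.exp (2 * (π : ℂ) * I / 3) * R =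
        ((a - R / 2 : ℝ) : ℂ) + ((r * R : ℝ) : ℂ) * I := by
      rw [exp_two_pi_three, ← hr]; push_cast; ring
    have e2 : (a : ℂ) + Complex.exp (-2 * (π : ℂ) * I / 3) * R =
        ((a - R / 2 : ℝ) : ℂ) + ((-r * R : ℝ) : ℂ) * I := by
      rw [exp_neg_two_pi_three, ← hr]; push_cast; ring
    rw [e1, Complex.ofReal_zero, mul_zero, add_zero] at p1
    rw [e2, Complex.ofReal_zero, mul_zero, add_zero] at p2
    rw [el, Complex.ofReal_zero, mul_zero, add_zero] at p3
    rw [Complex.ofReal_zero, mul_zero, add_zero, el, ← neg_mul] at p4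
    have hsum : (∫ y in (Neg.neg ∘ fun R : ℝ => r * R) R..(r * R), f (-(b : ℂ) + I * (y : ℂ))) =
        (∫ y in (-r * R)..0, f (-(b : ℂ) + I * (y : ℂ))) +
        ∫ y in (0 : ℝ)..(r * R), f (-(b : ℂ) + I * (y : ℂ)) := by
      rw [intervalIntegral.integral_add_adjacent_intervals hI3.intervalIntegrable
        hI3.intervalIntegrable, neg_mul]
      rfl
    rw [hsum, mul_add, id, p1, p2, p3, p4]
    have : -(Fd (((a - R / 2 : ℝ) : ℂ) + ((-r * R : ℝ) : ℂ) * I) - Fd a) +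
        (Fu (((a - R / 2 : ℝ) : ℂ) + ((r * R : ℝ) : ℂ) * I) - Fu a) -
        ((Fd (-(b : ℂ)) - Fd (((-b : ℝ) : ℂ) + ((-r * R : ℝ) : ℂ) * I)) +
        (Fu (((-b : ℝ) : ℂ) + ((r * R : ℝ) : ℂ) * I) - Fu (-(b : ℂ)))) - c =
        (Fu (((a - R / 2 : ℝ) : ℂ) + ((r * R : ℝ) : ℂ) * I) - Fu (((-b : ℝ) : ℂ) + ((r * R : ℝ) : ℂ) * I)) -
        (Fd (((a - R / 2 : ℝ) : ℂ) + ((-r * R : ℝ) : ℂ) * I) -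
          Fd (((-b : ℝ) : ℂ) + ((-r * R : ℝ) : ℂ) * I)) := by
      rw [← hc]; ring
    rw [this]
    refine (norm_sub_le _ _).trans ?_
    linarith
  have l6 := (l4.sub_const c).norm
  have := le_of_tendsto_of_tendsto l6 l5 key
  have h0 := norm_le_zero_iff.mp this
  unfold wedgeL
  linear_combination h0

theorem ray_norm {a e s : ℝ} (he : e ^ 2 = 3 / 4) :
    |a| / 2 ≤ ‖(a : ℂ) + (((-1 / 2 : ℝ) : ℂ) + (e : ℂ) * I) * s‖ := by
  have hw : (a : ℂ) + (((-1 / 2 : ℝ) : ℂ) + (e : ℂ) * I) * s =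
      ((a - s / 2 : ℝ) : ℂ) + ((e * s : ℝ) : ℂ) * I := by push_cast; ring
  rw [hw, Complex.norm_add_mul_I]
  apply Real.le_sqrt_of_sq_le
  rw [mul_pow, he, div_pow, sq_abs]
  nlinarith [sq_nonneg (s - a / 2)]

theorem ray_re {a e s : ℝ} (hs : 0 ≤ s) :
    ((a : ℂ) + (((-1 / 2 : ℝ) : ℂ) + (e : ℂ) * I) * s).re ≤ a := by
  have hw : (a : ℂ) + (((-1 / 2 : ℝ) : ℂ) + (e : ℂ) * I) * s =
      ((a - s / 2 : ℝ) : ℂ) + ((e * s : ℝ) : ℂ) * I := by push_cast; ring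
  rw [hw, Complex.add_re, Complex.ofReal_re, Complex.re_ofReal_mul, Complex.I_re]
  linarith

theorem ray_int {τ σ a C : ℝ} {h : ℂ → ℂ} (ha : a ≠ 0)
    (hcont : ContinuousOn h {w | w.re ≤ a ∧ w ≠ 0})
    (hbd : ∀ w : ℂ, w.re ≤ a → |a| / 2 ≤ ‖w‖ → ‖h w‖ ≤ C * Real.exp ‖w‖) {e : ℝ} (he : e ^ 2 = 3 / 4) :
    IntegrableOn (fun s : ℝ => gE τ σ ((a : ℂ) + (((-1 / 2 : ℝ) : ℂ) + (e : ℂ) * I) * s) *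
      h ((a : ℂ) + (((-1 / 2 : ℝ) : ℂ) + (e : ℂ) * I) * s)) (Set.Ioi 0) := by
  obtain ⟨K, hK0, hK⟩ := ray_bound τ σ a
  have hg : IntegrableOn (fun s : ℝ => |C| * K * Real.exp (-s)) (Set.Ioi 0) :=
    (integrableOn_exp_neg_Ioi 0).const_mul _
  refine Integrable.mono' hg ?_ ?_
  · refine ContinuousOn.aestronglyMeasurable ?_ measurableSet_Ioi
    refine ContinuousOn.mul ((gE_cont τ σ).comp (by fun_prop)).continuousOn ?_
    refine hcont.comp (by fun_prop) ?_
    intro s hs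
    refine ⟨ray_re (le_of_lt hs), fun h0 => ?_⟩
    have := ray_norm (a := a) (s := s) he
    rw [show (a : ℂ) + (((-1 / 2 : ℝ) : ℂ) + (e : ℂ) * I) * s = 0 from h0, norm_zero] at this
    have := abs_pos.mpr ha
    linarith
  · refine (ae_restrict_iff' measurableSet_Ioi).mpr (Eventually.of_forall fun s hs => ?_)
    have h1 := hK e s he (le_of_lt hs)
    have h2 := hbd _ (ray_re (e := e) (le_of_lt hs)) (ray_norm (a := a) (s := s) he)
    rw [norm_mul]
    set w := (a : ℂ) + (((-1 / 2 : ℝ) : ℂ) + (e : ℂ) * I) * s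
    calc _ ≤ ‖gE τ σ w‖ * (|C| * Real.exp ‖w‖) := by
          gcongr
          refine h2.trans ?_
          gcongr
          exact le_abs_self C
      _ = |C| * (‖gE τ σ w‖ * Real.exp ‖w‖) := by ring
      _ ≤ |C| * (K * Real.exp (-s)) := by gcongr
      _ = _ := by ring

theorem line_int {τ σ b C : ℝ} {h : ℂ → ℂ} (hb0 : 0 < b) (hb : |τ| + 2 ≤ b)
    (hcont : Continuous fun y : ℝ => h (-(b : ℂ) + I * y))
    (hbd : ∀ y : ℝ, ‖h (-(b : ℂ) + I * y)‖ ≤ C * Real.exp ‖-(b : ℂ) + I * y‖) :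
    Integrable (fun y : ℝ => gE τ σ (-(b : ℂ) + I * y) * h (-(b : ℂ) + I * y)) := by
  obtain ⟨K, hK0, hK⟩ := line_bound τ σ b hb0.le hb
  have hg : Integrable (fun y : ℝ => |C| * K * Real.exp (-1 * y ^ 2)) :=
    (integrable_exp_neg_mul_sq one_pos).const_mul _
  refine Integrable.mono' hg ?_ (Eventually.of_forall fun y => ?_)
  · refine Continuous.aestronglyMeasurable ?_
    exact ((gE_cont τ σ).comp (by fun_prop)).mul hcont
  · have h1 := hK y
    have h2 := hbd y
    rw [norm_mul]
    set w := -(b : ℂ) + I * y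
    calc _ ≤ ‖gE τ σ w‖ * (|C| * Real.exp ‖w‖) := by
          gcongr
          refine h2.trans ?_
          gcongr
          exact le_abs_self C
      _ = |C| * (‖gE τ σ w‖ * Real.exp ‖w‖) := by ring
      _ ≤ |C| * (K * Real.exp (-y ^ 2)) := by gcongr
      _ = _ := by ring_nf

theorem gE_wedge {τ σ a b C : ℝ} {h : ℂ → ℂ} {c : ℂ} (ha : a ≠ 0) (hab : |a| ≤ b)
    (hb : 6 * |τ| + 10 ≤ b)
    (hcont : ContinuousOn h {w | w.re ≤ a ∧ w ≠ 0})
    (hbd : ∀ w : ℂ, w.re ≤ a → |a| / 2 ≤ ‖w‖ → ‖h w‖ ≤ C * Real.exp ‖w‖)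
    (hF : ∀ᶠ R : ℝ in atTop, ∃ Fu Fd : ℂ → ℂ,
      (∀ w : ℂ, w ≠ 0 → 0 ≤ w.im → w.re ≤ a → ‖w‖ ≤ 3 * R → HasDerivAt Fu (gE τ σ w * h w) w) ∧
      (∀ w : ℂ, w ≠ 0 → w.im ≤ 0 → w.re ≤ a → ‖w‖ ≤ 3 * R → HasDerivAt Fd (gE τ σ w * h w) w) ∧
      (Fu (-b) - Fd (-b)) - (Fu a - Fd a) = c) :
    wedgeL a (fun w => gE τ σ w * h w) =
      I * (∫ y : ℝ, gE τ σ (-(b : ℂ) + I * y) * h (-(b : ℂ) + I * y)) + c := by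
  have ht := abs_nonneg τ
  have hb0 : 0 < b := by linarith
  have s3 := sqrt3_sq
  have hle : -b ≤ a := by linarith [neg_abs_le a]
  refine wedge_line_gen (C := |C|) ha hb0 hle ?_ ?_ ?_ ?_ hF
  · rw [exp_two_pi_three]
    exact ray_int ha hcont hbd s3
  · rw [exp_neg_two_pi_three]
    exact ray_int ha hcont hbd (by rw [neg_sq]; exact s3)
  · have hz : ∀ y : ℝ, (-(b : ℂ) + I * y).re = -b := by intro y; simp
    have hn : ∀ y : ℝ, b ≤ ‖-(b : ℂ) + I * y‖ := by
      intro y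
      have := Complex.abs_re_le_norm (-(b : ℂ) + I * y)
      rwa [hz, abs_neg, abs_of_pos hb0] at this
    refine line_int (C := C) hb0 (by linarith) ?_ ?_
    · refine hcont.comp_continuous (by fun_prop) (fun y => ⟨by rw [hz]; exact hle, fun h0 => ?_⟩)
      have := hn y
      rw [h0, norm_zero] at this
      linarith
    · intro y
      refine hbd _ (by rw [hz]; exact hle) ?_
      have := hn y
      linarith [abs_nonneg a]
  · filter_upwards [horiz_bound τ σ a b hb] with R hR x e he hx1 hx2
    have h1 := hR x e he hx1 hx2
    have hre : ((x : ℂ) + ((e * R : ℝ) : ℂ) * I).re = x := by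
      rw [Complex.add_re, Complex.ofReal_re, Complex.re_ofReal_mul, Complex.I_re]; ring
    have hn : b ≤ ‖(x : ℂ) + ((e * R : ℝ) : ℂ) * I‖ := by
      have := Complex.abs_re_le_norm ((x : ℂ) + ((e * R : ℝ) : ℂ) * I)
      rw [hre, abs_of_nonpos (by linarith)] at this
      linarith
    have h2 := hbd _ (by rw [hre]; linarith) (by linarith [abs_nonneg a])
    simp only [norm_mul (gE τ σ _)]
    generalize (x : ℂ) + ((e * R : ℝ) : ℂ) * I = w at *
    calc _ ≤ ‖gE τ σ w‖ * (|C| * Real.exp ‖w‖) := by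
          gcongr
          refine h2.trans ?_
          gcongr
          exact le_abs_self C
      _ = |C| * (‖gE τ σ w‖ * Real.exp ‖w‖) := by ring
      _ ≤ |C| * Real.exp (-R) := by gcongr

/-- holomorphic case -/
theorem gE_wedge_hol {τ σ a a' b C : ℝ} {h : ℂ → ℂ} (ha : a ≠ 0) (haa : a < a') (hab : |a| ≤ b)
    (hb : 6 * |τ| + 10 ≤ b)
    (hd : ∀ w : ℂ, w.re < a' → DifferentiableAt ℂ h w)
    (hbd : ∀ w : ℂ, w.re ≤ a → ‖h w‖ ≤ C * Real.exp ‖w‖) :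
    wedgeL a (fun w => gE τ σ w * h w) =
      I * (∫ y : ℝ, gE τ σ (-(b : ℂ) + I * y) * h (-(b : ℂ) + I * y)) := by
  have := gE_wedge (τ := τ) (σ := σ) (h := h) (c := 0) ha hab hb
    (fun w hw => (hd w (lt_of_le_of_lt hw.1 haa)).continuousAt.continuousWithinAt)
    (fun w h1 _ => hbd w h1) ?_
  · rw [this, add_zero]
  filter_upwards [eventually_gt_atTop 0] with R hR
  set L := ((|a'| + 3 * R) ^ 2 + (3 * R) ^ 2) / (a' - a) + 1 with hL
  have hδ : 0 < a' - a := by linarith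
  have hex : Complex.IsExactOn (fun w => gE τ σ w * h w) (Metric.ball (((a' - L : ℝ) : ℂ)) L) := by
    refine DifferentiableOn.isExactOn_ball ?_
    intro w hw
    refine (((gE_diff τ σ) w).mul (hd w ?_)).differentiableWithinAt
    rw [Metric.mem_ball, dist_eq_norm] at hw
    have := (le_abs_self _).trans ((Complex.abs_re_le_norm _).trans hw.le)
    have h2 := lt_of_le_of_lt ((le_abs_self _).trans (Complex.abs_re_le_norm _)) hw
    rw [Complex.sub_re, Complex.ofReal_re] at h2
    linarith
  obtain ⟨G, hG⟩ := hex
  have hin : ∀ w : ℂ, w.re ≤ a → ‖w‖ ≤ 3 * R → w ∈ Metric.ball (((a' - L : ℝ) : ℂ)) L := by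
    intro w h1 h2
    have hL0 : 0 < L := by positivity
    have hx := abs_le.mp ((Complex.abs_re_le_norm w).trans h2)
    have hy := abs_le.mp ((Complex.abs_im_le_norm w).trans h2)
    rw [Metric.mem_ball, dist_eq_norm]
    refine lt_of_pow_lt_pow_left₀ 2 hL0.le ?_
    rw [← Complex.normSq_eq_norm_sq, Complex.normSq_apply, Complex.sub_re, Complex.sub_im,
      Complex.ofReal_re, Complex.ofReal_im]
    have k1 : (a' - w.re) ^ 2 ≤ (|a'| + 3 * R) ^ 2 := by
      apply sq_le_sq'
      · linarith [abs_nonneg a', neg_abs_le a']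
      · linarith [le_abs_self a']
    have k2 : w.im ^ 2 ≤ (3 * R) ^ 2 := sq_le_sq' hy.1 hy.2
    have k3 : L * (a' - a) = ((|a'| + 3 * R) ^ 2 + (3 * R) ^ 2) + (a' - a) := by
      rw [hL]; field_simp
    have k4 : L * (a' - a) ≤ L * (a' - w.re) := by gcongr
    have k5 : 0 ≤ L * (a' - a) := by positivity
    nlinarith
  exact ⟨G, G, fun w _ _ h1 h2 => hG w (hin w h1 h2), fun w _ _ h1 h2 => hG w (hin w h1 h2), by ring⟩

/-- the pole case -/
theorem gE_wedge_pole {τ σ a b : ℝ} (j : ℕ) (ha : 0 < a) (hab : |a| ≤ b)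
    (hb : 6 * |τ| + 10 ≤ b) :
    wedgeL a (fun w => gE τ σ w * (w ^ (j + 1))⁻¹) =
      I * (∫ y : ℝ, gE τ σ (-(b : ℂ) + I * y) * ((-(b : ℂ) + I * y) ^ (j + 1))⁻¹) +
      ∮ w in C(0, b), gE τ σ w * (w ^ (j + 1))⁻¹ := by
  have hb0 : 0 < b := by linarith [abs_nonneg τ]
  refine gE_wedge (C := ((a / 2) ^ (j + 1))⁻¹) ha.ne' hab hb ?_ ?_ ?_
  · intro w hw
    exact ((continuousAt_id.pow (j + 1)).inv₀ (pow_ne_zero _ hw.2)).continuousWithinAt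
  · intro w h1 h2
    rw [abs_of_pos ha] at h2
    rw [norm_inv, norm_pow]
    have : 1 ≤ Real.exp ‖w‖ := Real.one_le_exp (norm_nonneg w)
    calc _ ≤ ((a / 2) ^ (j + 1))⁻¹ := by gcongr
      _ ≤ _ := le_mul_of_one_le_right (by positivity) this
  · refine Eventually.of_forall fun R => ?_
    set f : ℂ → ℂ := fun w => gE τ σ w * (w ^ (j + 1))⁻¹ with hf
    have hent : Differentiable ℂ (fun z => f (Complex.exp z) * Complex.exp z) := by
      intro z
      refine DifferentiableAt.mul (DifferentiableAt.mul ?_ (DifferentiableAt.inv ?_ ?_)) ?_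
      · exact ((gE_diff τ σ) _).comp z Complex.differentiableAt_exp
      · fun_prop
      · exact pow_ne_zero _ (Complex.exp_ne_zero z)
      · fun_prop
    obtain ⟨G, hG⟩ := hent.isExactOn_univ
    have hlog : ∀ (k w : ℂ), w ≠ 0 → k ≠ 0 → k * w ∈ Complex.slitPlane → ∀ d : ℂ, Complex.exp d = k⁻¹ →
        HasDerivAt (fun w => G (Complex.log (k * w) + d)) (f w) w := by
      intro k w hw hk hs d hd
      have h1 : HasDerivAt (fun w => Complex.log (k * w) + d) (k / (k * w)) w := by
        have := (((hasDerivAt_id w).const_mul k).clog hs).add_const d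
        simpa using this
      have h2 := (hG (Complex.log (k * w) + d) (Set.mem_univ _)).comp w h1
      have he : Complex.exp (Complex.log (k * w) + d) = w := by
        rw [Complex.exp_add, Complex.exp_log (mul_ne_zero hk hw), hd]
        field_simp
      refine HasDerivAt.congr_deriv h2 ?_
      beta_reduce
      rw [he]
      field_simp
    have hslit : ∀ w : ℂ, w ≠ 0 → 0 ≤ w.im → -I * w ∈ Complex.slitPlane := by
      intro w hw h
      rw [Complex.mem_slitPlane_iff]
      have e1 : (-I * w).re = w.im := by simp
      have e2 : (-I * w).im = -w.re := by simp
      rw [e1, e2]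
      rcases eq_or_lt_of_le h with h | h
      · right
        intro h0
        exact hw (Complex.ext (by simpa using h0) h.symm)
      · left; exact h
    have hslit2 : ∀ w : ℂ, w ≠ 0 → w.im ≤ 0 → I * w ∈ Complex.slitPlane := by
      intro w hw h
      have := hslit (-w) (neg_ne_zero.mpr hw) (by simpa using h)
      rwa [neg_mul_neg] at this
    have hpi : Complex.exp ((π : ℂ) / 2 * I) = I := Complex.exp_pi_div_two_mul_I
    have hpi' : Complex.exp (-((π : ℂ) / 2 * I)) = -I := by
      rw [Complex.exp_neg, hpi, Complex.inv_I]
    have logI : ∀ x : ℝ, 0 < x → Complex.log (I * x) = Real.log x + (π : ℂ) / 2 * I := by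
      intro x hx
      rw [mul_comm, Complex.log_ofReal_mul hx Complex.I_ne_zero, Complex.log_I]
    have lognI : ∀ x : ℝ, 0 < x → Complex.log (-I * x) = Real.log x - (π : ℂ) / 2 * I := by
      intro x hx
      rw [mul_comm, Complex.log_ofReal_mul hx (neg_ne_zero.mpr Complex.I_ne_zero), Complex.log_neg_I]
      ring
    refine ⟨fun w => G (Complex.log (-I * w) + (π : ℂ) / 2 * I),
      fun w => G (Complex.log (I * w) + -((π : ℂ) / 2 * I)),
      fun w hw h _ _ => hlog (-I) w hw (neg_ne_zero.mpr Complex.I_ne_zero) (hslit w hw h) _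
        (by rw [hpi, inv_neg, Complex.inv_I, neg_neg]),
      fun w hw h _ _ => hlog I w hw Complex.I_ne_zero (hslit2 w hw h) _
        (by rw [hpi', Complex.inv_I]), ?_⟩
    have e1 : -I * (-(b : ℂ)) = I * b := by ring
    have e2 : I * (-(b : ℂ)) = -I * b := by ring
    simp only [e1, e2, logI b hb0, lognI b hb0, logI a ha, lognI a ha]
    have e3 : (Real.log b : ℂ) + (π : ℂ) / 2 * I + (π : ℂ) / 2 * I = Real.log b + (π : ℝ) * I := by ring
    have e4 : (Real.log b : ℂ) - (π : ℂ) / 2 * I + -((π : ℂ) / 2 * I) = Real.log b + ((-π : ℝ) : ℂ) * I := by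
      push_cast; ring
    rw [e3, e4]
    have hcm : ∀ φ : ℝ, circleMap 0 b φ = Complex.exp (Real.log b + I * φ) := by
      intro φ
      rw [circleMap_zero, Complex.exp_add, ← Complex.ofReal_exp, Real.exp_log hb0, mul_comm I]
    have hper : Function.Periodic (fun φ : ℝ => f (circleMap 0 b φ) * circleMap 0 b φ) (2 * π) := by
      intro φ
      simp only [(periodic_circleMap 0 b) φ]
    have e5 : ∮ w in C(0, b), f w = I * ∫ φ in (-π)..π, f (Complex.exp (Real.log b + I * φ)) *
        Complex.exp (Real.log b + I * φ) := by
      have h1 := hper.intervalIntegral_add_eq 0 (-π)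
      rw [zero_add, show -π + 2 * π = π by ring] at h1
      simp only [← hcm]
      rw [← h1, ← intervalIntegral.integral_const_mul, circleIntegral]
      refine intervalIntegral.integral_congr fun φ _ => ?_
      simp only [deriv_circleMap, smul_eq_mul]
      ring
    rw [e5]
    have := ray_prim (f := fun z => f (Complex.exp z) * Complex.exp z) (F := G) (p := Real.log b)
      (ω := I) (A := -π) (B := π) (by linarith [Real.pi_pos]) (fun s _ _ => hG _ (Set.mem_univ _))
      (Continuous.intervalIntegrable (by exact (hent.continuous.comp (by fun_prop))) _ _)
    rw [this, mul_comm I, mul_comm I]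
    ring_nf

theorem wedgeR_eq (a : ℝ) (f : ℂ → ℂ) : wedgeR a f = -wedgeL (-a) (fun z => f (-z)) := by
  unfold wedgeR wedgeL
  have e1 : Complex.exp (-2 * (π : ℂ) * I / 3) = -Complex.exp ((π : ℂ) * I / 3) := by
    rw [← neg_eq_iff_eq_neg, ← neg_one_mul, ← Complex.exp_pi_mul_I, ← Complex.exp_add]
    congr 1; ring
  have e2 : Complex.exp (2 * (π : ℂ) * I / 3) = -Complex.exp (-(π : ℂ) * I / 3) := by
    rw [← neg_eq_iff_eq_neg, ← neg_one_mul, ← Complex.exp_neg_pi_mul_I, ← Complex.exp_add]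
    congr 1; ring
  rw [e1, e2]
  have e3 : ∀ (x : ℂ) (s : ℝ), -(((-a : ℝ) : ℂ) + -x * s) = a + x * s := by
    intro x s; push_cast; ring
  simp only [e3]
  ring

/-- admissible multipliers -/
def Adm (a : ℝ) (h : ℂ → ℂ) : Prop :=
  ContinuousOn h {w | w.re ≤ a ∧ w ≠ 0} ∧
    ∃ C : ℝ, ∀ w : ℂ, w.re ≤ a → |a| / 2 ≤ ‖w‖ → ‖h w‖ ≤ C * Real.exp ‖w‖

theorem Adm.add {a : ℝ} {h k : ℂ → ℂ} (hh : Adm a h) (hk : Adm a k) : Adm a (fun w => h w + k w) := by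
  obtain ⟨h1, C, h2⟩ := hh
  obtain ⟨k1, D, k2⟩ := hk
  refine ⟨h1.add k1, C + D, fun w a1 a2 => ?_⟩
  refine (norm_add_le _ _).trans ?_
  rw [add_mul]
  exact add_le_add (h2 w a1 a2) (k2 w a1 a2)

theorem Adm.const_mul {a : ℝ} {h : ℂ → ℂ} (hh : Adm a h) (c : ℂ) : Adm a (fun w => c * h w) := by
  obtain ⟨h1, C, h2⟩ := hh
  refine ⟨continuousOn_const.mul h1, ‖c‖ * C, fun w a1 a2 => ?_⟩
  rw [norm_mul, mul_assoc]
  exact mul_le_mul_of_nonneg_left (h2 w a1 a2) (norm_nonneg _)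

theorem wedgeL_add {τ σ a : ℝ} {h k : ℂ → ℂ} (ha : a ≠ 0) (hh : Adm a h) (hk : Adm a k) :
    wedgeL a (fun w => gE τ σ w * (h w + k w)) =
      wedgeL a (fun w => gE τ σ w * h w) + wedgeL a (fun w => gE τ σ w * k w) := by
  obtain ⟨h1, C, h2⟩ := hh
  obtain ⟨k1, D, k2⟩ := hk
  unfold wedgeL
  rw [exp_two_pi_three, exp_neg_two_pi_three]
  have s3 := sqrt3_sq
  simp only [mul_add (gE τ σ _)]
  rw [integral_add (ray_int ha h1 h2 (by rw [neg_sq]; exact s3))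
    (ray_int ha k1 k2 (by rw [neg_sq]; exact s3)),
    integral_add (ray_int ha h1 h2 s3) (ray_int ha k1 k2 s3)]
  ring

theorem wedgeL_const_mul (a : ℝ) (c : ℂ) (f : ℂ → ℂ) :
    wedgeL a (fun w => c * f w) = c * wedgeL a f := by
  unfold wedgeL
  rw [integral_const_mul, integral_const_mul]
  ring

theorem wedgeL_sum {τ σ a : ℝ} (ha : a ≠ 0) {h : ℂ → ℂ} (hh : Adm a h) (k : ℕ → ℂ → ℂ)
    (hk : ∀ j, Adm a (k j)) (M : ℕ) :
    wedgeL a (fun w => gE τ σ w * (h w + ∑ j ∈ Finset.range M, k j w)) =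
      wedgeL a (fun w => gE τ σ w * h w) +
        ∑ j ∈ Finset.range M, wedgeL a (fun w => gE τ σ w * k j w) ∧
    Adm a (fun w => h w + ∑ j ∈ Finset.range M, k j w) := by
  induction M with
  | zero => simpa using hh
  | succ n ih =>
    simp only [Finset.sum_range_succ, ← add_assoc]
    refine ⟨?_, ih.2.add (hk n)⟩
    rw [wedgeL_add ha ih.2 (hk n), ih.1]

theorem wedgeL_congr {a : ℝ} {f g : ℂ → ℂ} (ha : a ≠ 0)
    (h : ∀ w : ℂ, w.re ≤ a → w ≠ 0 → f w = g w) : wedgeL a f = wedgeL a g := by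
  unfold wedgeL
  rw [exp_two_pi_three, exp_neg_two_pi_three]
  have s3 := sqrt3_sq
  have : ∀ e : ℝ, e ^ 2 = 3 / 4 → (∫ s in Set.Ioi (0 : ℝ),
      f ((a : ℂ) + (((-1 / 2 : ℝ) : ℂ) + (e : ℂ) * I) * s)) = ∫ s in Set.Ioi (0 : ℝ),
      g ((a : ℂ) + (((-1 / 2 : ℝ) : ℂ) + (e : ℂ) * I) * s) := by
    intro e he
    refine setIntegral_congr_fun measurableSet_Ioi fun s hs => ?_
    refine h _ (ray_re (le_of_lt hs)) fun h0 => ?_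
    have := ray_norm (a := a) (s := s) he
    rw [h0, norm_zero] at this
    have := abs_pos.mpr ha
    linarith
  rw [this _ s3, this _ (by rw [neg_sq]; exact s3)]

theorem line_ne {b y : ℝ} {z : ℂ} (h : z.re < b) : b - z.re ≤ ‖(-(b : ℂ) + I * y) + z‖ := by
  have := Complex.abs_re_le_norm ((-(b : ℂ) + I * y) + z)
  have e : ((-(b : ℂ) + I * y) + z).re = -b + z.re := by simp
  rw [e, abs_of_neg (by linarith)] at this
  linarith

/-- the Cauchy transform along the line -/
def h0f (τ σ b : ℝ) (z : ℂ) : ℂ :=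
  I * ∫ y : ℝ, gE τ σ (-(b : ℂ) + I * y) * ((-(b : ℂ) + I * y) + z)⁻¹

theorem gE_line_int {τ σ b : ℝ} (hb0 : 0 < b) (hb : |τ| + 2 ≤ b) :
    Integrable (fun y : ℝ => gE τ σ (-(b : ℂ) + I * y)) := by
  have := line_int (τ := τ) (σ := σ) (h := fun _ => 1) (C := 1) hb0 hb continuous_const (fun y => by
    rw [norm_one, one_mul]; exact Real.one_le_exp (norm_nonneg _))
  simpa using this

theorem h0f_cauchy_int {τ σ b : ℝ} (hb0 : 0 < b) (hb : |τ| + 2 ≤ b) {z : ℂ} (hz : z.re < b) :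
    Integrable (fun y : ℝ => gE τ σ (-(b : ℂ) + I * y) * ((-(b : ℂ) + I * y) + z)⁻¹) := by
  refine line_int (h := fun w => (w + z)⁻¹) (C := (b - z.re)⁻¹) hb0 hb ?_ ?_
  · refine Continuous.inv₀ (by fun_prop) fun y h0 => ?_
    have := line_ne (y := y) hz
    rw [h0, norm_zero] at this
    linarith
  · intro y
    rw [norm_inv]
    have h1 := line_ne (y := y) hz
    have h2 : 0 < b - z.re := by linarith
    calc _ ≤ (b - z.re)⁻¹ := by gcongr
      _ ≤ _ := le_mul_of_one_le_right (by positivity) (Real.one_le_exp (norm_nonneg _))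

theorem h0f_bound {τ σ b A : ℝ} (hb0 : 0 < b) (hb : |τ| + 2 ≤ b) (hA : A < b) : ∃ C, ∀ z : ℂ, z.re ≤ A →
    ‖h0f τ σ b z‖ ≤ C := by
  refine ⟨∫ y : ℝ, ‖gE τ σ (-(b : ℂ) + I * y)‖ * (b - A)⁻¹, fun z hz => ?_⟩
  unfold h0f
  rw [norm_mul, Complex.norm_I, one_mul]
  refine norm_integral_le_of_norm_le ((gE_line_int hb0 hb).norm.mul_const _)
    (Eventually.of_forall fun y => ?_)
  rw [norm_mul, norm_inv]
  have h1 := line_ne (b := b) (y := y) (z := z) (by linarith)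
  have h2 : 0 < b - A := by linarith
  gcongr
  linarith

theorem h0f_diff {τ σ b : ℝ} (hb0 : 0 < b) (hb : |τ| + 2 ≤ b) {z : ℂ} (hz : z.re < b) :
    DifferentiableAt ℂ (h0f τ σ b) z := by
  unfold h0f
  refine DifferentiableAt.const_mul ?_ _
  set δ := (b - z.re) / 2 with hδ
  have hδ0 : 0 < δ := by rw [hδ]; linarith
  have hball : ∀ x ∈ Metric.ball z δ, x.re < b ∧ ∀ y : ℝ, δ ≤ ‖(-(b : ℂ) + I * y) + x‖ := by
    intro x hx
    rw [Metric.mem_ball, dist_eq_norm] at hx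
    have h2 := lt_of_le_of_lt ((le_abs_self _).trans (Complex.abs_re_le_norm _)) hx
    rw [Complex.sub_re] at h2
    have h3 : x.re < b := by linarith
    refine ⟨h3, fun y => ?_⟩
    have := line_ne (y := y) h3
    linarith
  have := hasDerivAt_integral_of_dominated_loc_of_deriv_le
    (μ := (volume : Measure ℝ)) (F := fun (x : ℂ) (y : ℝ) => gE τ σ (-(b : ℂ) + I * y) * ((-(b : ℂ) + I * y) + x)⁻¹)
    (F' := fun (x : ℂ) (y : ℝ) => gE τ σ (-(b : ℂ) + I * y) * (-1 / ((-(b : ℂ) + I * y) + x) ^ 2))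
    (bound := fun y : ℝ => ‖gE τ σ (-(b : ℂ) + I * (y:ℂ))‖ * (1 / δ ^ 2)) (x₀ := z) (s := Metric.ball z δ)
    (Metric.ball_mem_nhds z hδ0) ?_ (h0f_cauchy_int hb0 hb hz) ?_ ?_
    ((gE_line_int hb0 hb).norm.mul_const _) ?_
  · exact this.2.differentiableAt
  · filter_upwards [Metric.ball_mem_nhds z hδ0] with x hx
    exact (h0f_cauchy_int hb0 hb (hball x hx).1).aestronglyMeasurable
  · refine Continuous.aestronglyMeasurable ?_
    refine Continuous.mul ((gE_cont τ σ).comp (by fun_prop)) ?_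
    refine continuous_const.div (by fun_prop) fun y h0 => ?_
    have h1 := line_ne (y := y) hz
    rw [pow_eq_zero_iff (by norm_num)] at h0
    rw [h0, norm_zero] at h1
    linarith
  · refine Eventually.of_forall fun y x hx => ?_
    rw [norm_mul, norm_div, norm_neg, norm_one, norm_pow]
    have := (hball x hx).2 y
    gcongr
  · refine Eventually.of_forall fun y x hx => ?_
    refine HasDerivAt.const_mul _ ?_
    have h1 := (hball x hx).2 y
    have hne : (-(b : ℂ) + I * y) + x ≠ 0 := by
      intro h0
      rw [h0, norm_zero] at h1
      linarith
    exact ((hasDerivAt_id x).const_add _).inv hne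

theorem pow_le_exp_norm (w : ℂ) (j : ℕ) : ‖w ^ j‖ ≤ (j.factorial : ℝ) * Real.exp ‖w‖ := by
  have h := Real.pow_div_factorial_le_exp ‖w‖ (norm_nonneg _) j
  rw [norm_pow]
  rwa [div_le_iff₀ (by positivity), mul_comm] at h

/-- line moments -/
def AL (τ σ b : ℝ) (j : ℕ) : ℂ :=
  I * ∫ y : ℝ, gE τ σ (-(b : ℂ) + I * y) * (-(b : ℂ) + I * y) ^ j

theorem AL_int {τ σ b : ℝ} (hb0 : 0 < b) (hb : |τ| + 2 ≤ b) (j : ℕ) :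
    Integrable (fun y : ℝ => gE τ σ (-(b : ℂ) + I * y) * (-(b : ℂ) + I * y) ^ j) :=
  line_int (h := fun w => w ^ j) (C := (j.factorial : ℝ)) hb0 hb (by fun_prop)
    (fun y => pow_le_exp_norm _ j)

theorem inner_wedge {τ σ a1 a2 b : ℝ} (M : ℕ) (ha12 : a1 < a2) (ha2 : a2 < 0) (hab : |a1| ≤ b)
    (hb : 6 * |τ| + 10 ≤ b) {z : ℂ} (hz : z.re ≤ -a2) (hz0 : z ≠ 0) (hzb : z.re < b) :
    wedgeL a1 (fun w => gE τ σ w * (w ^ M * ((-z) ^ M)⁻¹ * (w - -z)⁻¹)) =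
      h0f τ σ b z + ∑ j ∈ Finset.range M, AL τ σ b j * ((-1) ^ (j + 1) * (z ^ (j + 1))⁻¹) := by
  have hb0 : 0 < b := by have := abs_nonneg τ; linarith
  have hb2 : |τ| + 2 ≤ b := by have := abs_nonneg τ; linarith
  have hne : ∀ w : ℂ, w.re < a2 → w - -z ≠ 0 := by
    intro w hw h0
    have := congrArg Complex.re h0
    simp at this
    linarith
  rw [gE_wedge_hol (a' := a2) (b := b) (C := (M.factorial : ℝ) * (‖((-z) ^ M)⁻¹‖ * (a2 - a1)⁻¹))
    (by linarith) ha12 hab hb]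
  · have e : ∀ y : ℝ, gE τ σ (-(b : ℂ) + I * y) * ((-(b : ℂ) + I * y) ^ M * ((-z) ^ M)⁻¹ *
        ((-(b : ℂ) + I * y) - -z)⁻¹) = gE τ σ (-(b : ℂ) + I * y) * ((-(b : ℂ) + I * y) + z)⁻¹ +
        ∑ j ∈ Finset.range M, (gE τ σ (-(b : ℂ) + I * y) * (-(b : ℂ) + I * y) ^ j) *
          ((-1) ^ (j + 1) * (z ^ (j + 1))⁻¹) := by
      intro y
      have h1 := line_ne (y := y) hzb
      have h2 : (-(b : ℂ) + I * y) - -z ≠ 0 := by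
        intro h0
        rw [sub_neg_eq_add] at h0
        rw [h0, norm_zero] at h1
        linarith
      rw [geom_id _ _ (neg_ne_zero.mpr hz0) h2 M, sub_neg_eq_add, mul_add, Finset.mul_sum]
      congr 1
      refine Finset.sum_congr rfl fun j _ => ?_
      rw [neg_pow z (j + 1), div_eq_mul_inv, mul_inv, ← inv_pow, inv_neg, inv_one]
      ring
    simp only [e]
    rw [integral_add (h0f_cauchy_int hb0 hb2 hzb)
      (integrable_finsetSum _ fun j _ => (AL_int hb0 hb2 j).mul_const _),
      integral_finsetSum _ fun j _ => (AL_int hb0 hb2 j).mul_const _, mul_add, Finset.mul_sum]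
    congr 1
    refine Finset.sum_congr rfl fun j _ => ?_
    rw [integral_mul_const, AL]
    ring
  · intro w hw
    have := hne w hw
    fun_prop (disch := assumption)
  · intro w hw
    rw [norm_mul, norm_mul, norm_inv (w - -z)]
    have h1 : a2 - a1 ≤ ‖w - -z‖ := by
      have := Complex.abs_re_le_norm (w - -z)
      have e : (w - -z).re = w.re + z.re := by simp
      rw [e] at this
      have := neg_abs_le (w.re + z.re)
      linarith
    have h2 := pow_le_exp_norm w M
    have h3 : 0 < a2 - a1 := by linarith
    calc _ ≤ ((M.factorial : ℝ) * Real.exp ‖w‖) * ‖((-z) ^ M)⁻¹‖ * (a2 - a1)⁻¹ := by gcongr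
      _ = _ := by ring

theorem adm_pole {a : ℝ} (ha : a ≠ 0) (j : ℕ) : Adm a (fun w => (w ^ (j + 1))⁻¹) := by
  refine ⟨?_, ((|a| / 2) ^ (j + 1))⁻¹, fun w _ h2 => ?_⟩
  · exact ContinuousOn.inv₀ (by fun_prop) fun w hw => pow_ne_zero _ hw.2
  · have := abs_pos.mpr ha
    rw [norm_inv, norm_pow]
    calc (‖w‖ ^ (j + 1))⁻¹ ≤ ((|a| / 2) ^ (j + 1))⁻¹ := by gcongr
      _ ≤ _ := le_mul_of_one_le_right (by positivity) (Real.one_le_exp (norm_nonneg _))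

/-- pole line integrals plus residue circle -/
def BL (τ σ b : ℝ) (j : ℕ) : ℂ :=
  I * (∫ y : ℝ, gE τ σ (-(b : ℂ) + I * y) * ((-(b : ℂ) + I * y) ^ (j + 1))⁻¹) +
    ∮ w in C(0, b), gE τ σ w * (w ^ (j + 1))⁻¹

theorem double_wedge (M : ℕ) {τ₁ σ₁ τ₂ σ₂ a1 a2 b1 b2 : ℝ} (ha12 : a1 < a2) (ha2 : a2 < 0)
    (hab1 : |a1| ≤ b1) (hb1 : 6 * |τ₁| + 10 ≤ b1) (hb21 : -a2 < b1)
    (hab2 : |a2| ≤ b2) (hb2 : 6 * |τ₂| + 10 ≤ b2) :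
    wedgeR a2 (fun w₂ => wedgeL a1 (fun w₁ =>
    Complex.exp ((w₂ ^ 3 / 3 + (τ₂ : ℂ) * w₂ ^ 2 - (σ₂ : ℂ) * w₂) -
        (w₁ ^ 3 / 3 + (τ₁ : ℂ) * w₁ ^ 2 - (σ₁ : ℂ) * w₁)) *
      (w₁ / w₂) ^ M * (w₁ - w₂)⁻¹)) =
    -(I * (∫ y : ℝ, gE (-τ₂) σ₂ (-(b2 : ℂ) + I * y) * h0f τ₁ σ₁ b1 (-(b2 : ℂ) + I * y)) +
      ∑ j ∈ Finset.range M, AL τ₁ σ₁ b1 j * (-1) ^ (j + 1) * BL (-τ₂) σ₂ b2 j) := by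
  have hb10 : 0 < b1 := by have := abs_nonneg τ₁; linarith
  have hb12 : |τ₁| + 2 ≤ b1 := by have := abs_nonneg τ₁; linarith
  have hA : -a2 ≠ 0 := by linarith
  rw [wedgeR_eq]
  congr 1
  have hh : Adm (-a2) (h0f τ₁ σ₁ b1) := by
    obtain ⟨C, hC⟩ := h0f_bound (σ := σ₁) hb10 hb12 hb21
    refine ⟨fun w hw => (h0f_diff hb10 hb12 (lt_of_le_of_lt hw.1 hb21)).continuousAt.continuousWithinAt,
      C, fun w h1 _ => (hC w h1).trans ?_⟩
    exact le_mul_of_one_le_right ((norm_nonneg _).trans (hC w h1)) (Real.one_le_exp (norm_nonneg _))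
  have key := wedgeL_sum (τ := -τ₂) (σ := σ₂) hA hh
    (fun j w => (AL τ₁ σ₁ b1 j * (-1) ^ (j + 1)) * (w ^ (j + 1))⁻¹)
    (fun j => (adm_pole hA j).const_mul _) M
  rw [wedgeL_congr (g := fun w => gE (-τ₂) σ₂ w * (h0f τ₁ σ₁ b1 w + ∑ j ∈ Finset.range M,
    (AL τ₁ σ₁ b1 j * (-1) ^ (j + 1)) * (w ^ (j + 1))⁻¹)) hA, key.1]
  · congr 1
    · obtain ⟨C, hC⟩ := h0f_bound (σ := σ₁) hb10 hb12 hb21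
      refine gE_wedge_hol (a' := b1) (C := C) hA hb21 (by rwa [abs_neg]) (by rwa [abs_neg])
        (fun w hw => h0f_diff hb10 hb12 hw) fun w hw => (hC w hw).trans ?_
      exact le_mul_of_one_le_right ((norm_nonneg _).trans (hC w hw)) (Real.one_le_exp (norm_nonneg _))
    · refine Finset.sum_congr rfl fun j _ => ?_
      rw [BL, ← gE_wedge_pole j (a := -a2) (by linarith) (by rwa [abs_neg]) (by rwa [abs_neg]),
        ← wedgeL_const_mul]
      congr 1
      funext w
      ring
  · intro z hz hz0
    rw [show (∑ j ∈ Finset.range M, (AL τ₁ σ₁ b1 j * (-1) ^ (j + 1)) * (z ^ (j + 1))⁻¹) =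
      ∑ j ∈ Finset.range M, AL τ₁ σ₁ b1 j * ((-1) ^ (j + 1) * (z ^ (j + 1))⁻¹) from
      Finset.sum_congr rfl fun j _ => by ring,
      ← inner_wedge M ha12 ha2 hab1 hb1 hz hz0 (lt_of_le_of_lt hz hb21), ← wedgeL_const_mul]
    congr 1
    funext w
    have e : Complex.exp (((-z) ^ 3 / 3 + (τ₂ : ℂ) * (-z) ^ 2 - (σ₂ : ℂ) * (-z)) -
        (w ^ 3 / 3 + (τ₁ : ℂ) * w ^ 2 - (σ₁ : ℂ) * w)) = gE (-τ₂) σ₂ z * gE τ₁ σ₁ w := by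
      unfold gE
      rw [← Complex.exp_add]
      congr 1
      push_cast
      ring
    rw [e, div_pow, div_eq_mul_inv]
    ring

theorem fE_gE {e q c k τ σ : ℝ} (h1 : e * k = σ) (h2 : q * k ^ 2 = -τ) (h3 : c * k ^ 3 = 1 / 3)
    (w : ℂ) : fE e q c (k * w) = gE τ σ w := by
  unfold fE gE
  congr 1
  have h1' : (e : ℂ) * k = σ := by exact_mod_cast h1
  have h2' : (q : ℂ) * k ^ 2 = -τ := by exact_mod_cast h2
  have h3' : (c : ℂ) * k ^ 3 = 1 / 3 := by
    have := congrArg (fun x : ℝ => (x : ℂ)) h3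
    push_cast at this
    exact this
  linear_combination w * h1' + w ^ 2 * h2' - w ^ 3 * h3'

theorem line_scale (F : ℂ → ℂ) {k β : ℝ} (hk : 0 < k) (hβ : 0 < β) (b : ℝ) :
    I * (β : ℂ) * ∫ y : ℝ, F (-((k * b : ℝ) : ℂ) + I * β * y) =
      k * (I * ∫ y : ℝ, F (k * (-(b : ℂ) + I * y))) := by
  have h := Measure.integral_comp_mul_left (fun y : ℝ => F (k * (-(b : ℂ) + I * y))) (β / k)
  have hk' : (k : ℂ) ≠ 0 := by exact_mod_cast hk.ne'
  have hβ' : (β : ℂ) ≠ 0 := by exact_mod_cast hβ.ne'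
  have e : ∀ y : ℝ, F (-((k * b : ℝ) : ℂ) + I * β * y) =
      F (k * (-(b : ℂ) + I * ((β / k * y : ℝ) : ℂ))) := by
    intro y
    congr 1
    push_cast
    field_simp
  simp only [e]
  rw [h, abs_of_pos (by positivity), Complex.real_smul]
  push_cast
  field_simp

theorem aj_match {e q c k τ σ α : ℝ} (h1 : e * k = σ) (h2 : q * k ^ 2 = -τ)
    (h3 : c * k ^ 3 = 1 / 3) (hk : 0 < k) (hα : 0 < α) (b : ℝ) (j : ℕ) :
    I * α * ∫ y : ℝ, fE e q c (-((k * b : ℝ) : ℂ) + I * α * y) *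
        ((α : ℂ)⁻¹ * (α * (-((k * b : ℝ) : ℂ) + I * α * y)) ^ j) =
      k * (α : ℂ)⁻¹ * (α * k) ^ j * AL τ σ b j := by
  rw [line_scale (fun x => fE e q c x * ((α : ℂ)⁻¹ * (α * x) ^ j)) hk hα b]
  simp only [fE_gE h1 h2 h3]
  have : ∀ y : ℝ, gE τ σ (-(b : ℂ) + I * y) * ((α : ℂ)⁻¹ * (α * (k * (-(b : ℂ) + I * y))) ^ j) =
      ((α : ℂ)⁻¹ * (α * k) ^ j) * (gE τ σ (-(b : ℂ) + I * y) * (-(b : ℂ) + I * y) ^ j) := by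
    intro y
    rw [← mul_assoc (α : ℂ), mul_pow (α * k : ℂ)]
    ring
  simp only [this]
  rw [integral_const_mul, AL]
  ring

theorem big_match {e q c k τ σ α β : ℝ} (h1 : e * k = σ) (h2 : q * k ^ 2 = -τ)
    (h3 : c * k ^ 3 = 1 / 3) (hk : 0 < k) (hβ : 0 < β) (b : ℝ) (j : ℕ) :
    -(I * (β : ℂ) * ∫ y : ℝ, fE e q c (-((k * b : ℝ) : ℂ) + I * (β : ℂ) * y) *
        (2 * (π : ℂ) * I * (α / (α * -(-((k * b : ℝ) : ℂ) + I * (β : ℂ) * y)) ^ (j + 1)))) =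
      -(2 * (π : ℂ) * I) * (k * α * (((-(α * k) : ℂ)) ^ (j + 1))⁻¹) *
        (I * (∫ y : ℝ, gE τ σ (-(b : ℂ) + I * y) * ((-(b : ℂ) + I * y) ^ (j + 1))⁻¹)) := by
  rw [line_scale (fun x => fE e q c x * (2 * (π : ℂ) * I * (α / (α * -x) ^ (j + 1)))) hk hβ b]
  simp only [fE_gE h1 h2 h3]
  have : ∀ y : ℝ, gE τ σ (-(b : ℂ) + I * y) *
      (2 * (π : ℂ) * I * (α / (α * -(k * (-(b : ℂ) + I * y))) ^ (j + 1))) =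
      (2 * (π : ℂ) * I * (α * ((-(α * k) : ℂ) ^ (j + 1))⁻¹)) *
        (gE τ σ (-(b : ℂ) + I * y) * ((-(b : ℂ) + I * y) ^ (j + 1))⁻¹) := by
    intro y
    rw [show (α : ℂ) * -(k * (-(b : ℂ) + I * y)) = (-(α * k)) * (-(b : ℂ) + I * y) by ring,
      mul_pow (-(α * k) : ℂ), div_eq_mul_inv, mul_inv]
    ring
  simp only [this]
  rw [integral_const_mul]
  ring

theorem small_match {e q c k τ σ α : ℝ} (h1 : e * k = σ) (h2 : q * k ^ 2 = -τ)
    (h3 : c * k ^ 3 = 1 / 3) (hk : 0 < k) (b : ℝ) (j : ℕ) :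
    (∮ ζ in C((0 : ℂ), k * b), α / (α * ζ) ^ (j + 1) * fE e q c (-ζ)) =
      -(k * α * (((-(α * k) : ℂ)) ^ (j + 1))⁻¹) * ∮ w in C(0, b), gE τ σ w * (w ^ (j + 1))⁻¹ := by
  have hk' : (k : ℂ) ≠ 0 := by exact_mod_cast hk.ne'
  rw [circ_neg, show k * b = b / k⁻¹ by rw [div_inv_eq_mul, mul_comm],
    circ_scale _ _ _ (inv_ne_zero hk.ne'), neg_mul, ← circleIntegral.integral_const_mul]
  congr 1
  refine congrArg (fun f : ℂ → ℂ => circleIntegral f 0 b) (funext fun w => ?_)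
  rw [Complex.ofReal_inv, inv_inv, zero_add, div_inv_eq_mul, mul_comm w (k : ℂ), neg_neg,
    fE_gE h1 h2 h3, show (α : ℂ) * -(k * w) = (-(α * k)) * w by ring, mul_pow (-(α * k) : ℂ),
    div_eq_mul_inv, mul_inv]
  ring

theorem K1_match {e₁ q₁ c₁ τ₁ σ₁ e₂ q₂ c₂ τ₂ σ₂ k α β : ℝ} (h1 : e₁ * k = σ₁)
    (h2 : q₁ * k ^ 2 = -τ₁) (h3 : c₁ * k ^ 3 = 1 / 3) (h1' : e₂ * k = σ₂)
    (h2' : q₂ * k ^ 2 = -τ₂) (h3' : c₂ * k ^ 3 = 1 / 3) (hk : 0 < k) (hα : 0 < α) (hβ : 0 < β)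
    (b1 b2 : ℝ) :
    -(I * (β : ℂ) * ∫ y₂ : ℝ, fE e₂ q₂ c₂ (-((k * b2 : ℝ) : ℂ) + I * (β : ℂ) * y₂) *
        (I * α * ∫ y₁ : ℝ, fE e₁ q₁ c₁ (-((k * b1 : ℝ) : ℂ) + I * α * y₁) *
        ((α : ℂ)⁻¹ * ((-((k * b1 : ℝ) : ℂ) + I * α * y₁) +
          (-((k * b2 : ℝ) : ℂ) + I * (β : ℂ) * y₂))⁻¹))) =
      -(k * (α : ℂ)⁻¹ * (I * ∫ y : ℝ, gE τ₂ σ₂ (-(b2 : ℂ) + I * y) *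
        h0f τ₁ σ₁ b1 (-(b2 : ℂ) + I * y))) := by
  have hk' : (k : ℂ) ≠ 0 := by exact_mod_cast hk.ne'
  rw [line_scale (fun x => fE e₂ q₂ c₂ x * (I * α * ∫ y₁ : ℝ, fE e₁ q₁ c₁
    (-((k * b1 : ℝ) : ℂ) + I * α * y₁) * ((α : ℂ)⁻¹ * ((-((k * b1 : ℝ) : ℂ) + I * α * y₁) + x)⁻¹)))
    hk hβ b2]
  simp only [fE_gE h1' h2' h3']
  have : ∀ z : ℂ, (I * α * ∫ y₁ : ℝ, fE e₁ q₁ c₁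
    (-((k * b1 : ℝ) : ℂ) + I * α * y₁) * ((α : ℂ)⁻¹ * ((-((k * b1 : ℝ) : ℂ) + I * α * y₁) +
      k * z)⁻¹)) = (α : ℂ)⁻¹ * h0f τ₁ σ₁ b1 z := by
    intro z
    rw [line_scale (fun x => fE e₁ q₁ c₁ x * ((α : ℂ)⁻¹ * (x + k * z)⁻¹)) hk hα b1]
    simp only [fE_gE h1 h2 h3]
    have : ∀ y : ℝ, gE τ₁ σ₁ (-(b1 : ℂ) + I * y) *
        ((α : ℂ)⁻¹ * (k * (-(b1 : ℂ) + I * y) + k * z)⁻¹) = ((α : ℂ)⁻¹ * (k : ℂ)⁻¹) *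
        (gE τ₁ σ₁ (-(b1 : ℂ) + I * y) * ((-(b1 : ℂ) + I * y) + z)⁻¹) := by
      intro y
      rw [← mul_add, mul_inv]
      ring
    simp only [this]
    rw [integral_const_mul, h0f]
    field_simp
  simp only [this]
  have e2 : ∀ y : ℝ, gE τ₂ σ₂ (-(b2 : ℂ) + I * y) * ((α : ℂ)⁻¹ * h0f τ₁ σ₁ b1 (-(b2 : ℂ) + I * y)) =
      (α : ℂ)⁻¹ * (gE τ₂ σ₂ (-(b2 : ℂ) + I * y) * h0f τ₁ σ₁ b1 (-(b2 : ℂ) + I * y)) := by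
    intro y; ring
  simp only [e2]
  rw [integral_const_mul]
  ring

theorem phi_match {e₁ q₁ τ₁ σ₁ e₂ q₂ τ₂ σ₂ k α : ℝ} (h1 : e₁ * k = σ₁)
    (h2 : q₁ * k ^ 2 = -τ₁) (h1' : e₂ * k = σ₂) (h2' : q₂ * k ^ 2 = -τ₂) (hk : 0 < k) (hα : 0 < α)
    (hτ : τ₁ < τ₂) :
    (2 * π)⁻¹ * (Real.sqrt (π / ((q₁ - q₂) * α ^ 2)) * Real.exp (-(e₁ - e₂) ^ 2 / (4 * (q₁ - q₂)))) =
      (k / α) * ((Real.sqrt (4 * π * (τ₂ - τ₁)))⁻¹ *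
        Real.exp (-(σ₂ - σ₁) ^ 2 / (4 * (τ₂ - τ₁)))) := by
  have hq : q₁ - q₂ = (τ₂ - τ₁) / k ^ 2 := by
    rw [eq_div_iff (by positivity)]; linarith
  have hD : 0 < τ₂ - τ₁ := by linarith
  have he : e₁ - e₂ = (σ₁ - σ₂) / k := by
    rw [eq_div_iff hk.ne']; linarith
  rw [hq, he]
  have x1 : -((σ₁ - σ₂) / k) ^ 2 / (4 * ((τ₂ - τ₁) / k ^ 2)) = -(σ₂ - σ₁) ^ 2 / (4 * (τ₂ - τ₁)) := by
    field_simp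
    ring
  rw [x1, ← mul_assoc, ← mul_assoc]
  congr 1
  have x2 : π / ((τ₂ - τ₁) / k ^ 2 * α ^ 2) = (2 * π * (k / α)) ^ 2 * (4 * π * (τ₂ - τ₁))⁻¹ := by
    have := Real.pi_pos
    field_simp
    norm_num
  have := Real.pi_pos
  rw [x2, Real.sqrt_mul (by positivity), Real.sqrt_sq (by positivity), Real.sqrt_inv]
  field_simp

theorem exists_b (L d : ℝ) {c : ℝ} (hc : 0 < c) : ∃ b, L ≤ b ∧ 0 < d + c * b := by
  refine ⟨max L ((|d| + 1) / c), le_max_left _ _, ?_⟩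
  have h1 : (|d| + 1) / c ≤ max L ((|d| + 1) / c) := le_max_right _ _
  rw [div_le_iff₀ hc] at h1
  have := neg_abs_le d
  linarith

theorem conj_cnj (M : ℕ) (α u a τ p s T : ℝ) : conjT M α u a τ p s T =
    cnj α (tT u τ p T) (nT M a τ p T - M) (xT M u a τ p s T + (nT M a τ p T - M)) := by
  unfold conjT cnj
  rw [add_sub_assoc]

theorem ind_lim (M : ℕ) {α u a p G τ₁ τ₂ s₁ s₂ : ℝ} (hα0 : 0 < α) (hα1 : α < 1)
    (hG0 : 0 < G)
    (hp : |p| ≤ 1) {e₁ q₁ e₂ q₂ σ₁ σ₂ τ₁' τ₂' k : ℝ}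
    (h1 : Reg atTop (fun T : ℝ => T ^ ((1 : ℝ) / 3)) (tT u τ₁ p) (fun T => nT M a τ₁ p T - M)
      (fun T => xT M u a τ₁ p s₁ T + (nT M a τ₁ p T - M)) α u (-(τ₁ * G)) e₁ q₁)
    (h2 : Reg atTop (fun T : ℝ => T ^ ((1 : ℝ) / 3)) (tT u τ₂ p) (fun T => nT M a τ₂ p T - M)
      (fun T => xT M u a τ₂ p s₂ T + (nT M a τ₂ p T - M)) α u (-(τ₂ * G)) e₂ q₂)
    (x1 : e₁ * k = σ₁) (x2 : q₁ * k ^ 2 = -τ₁') (x1' : e₂ * k = σ₂) (x2' : q₂ * k ^ 2 = -τ₂')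
    (hk : 0 < k) (hττ : τ₁ < τ₂ ↔ τ₁' < τ₂') :
    Tendsto (fun T : ℝ => -(if nT M a τ₁ p T ≤ nT M a τ₂ p T ∧ tT u τ₂ p T ≤ tT u τ₁ p T ∧
      ¬(nT M a τ₁ p T = nT M a τ₂ p T ∧ tT u τ₁ p T = tT u τ₂ p T) then (1 : ℂ) else 0) *
      ((2 * (π : ℂ) * I)⁻¹ * (((T ^ ((1 : ℝ) / 3) : ℝ) : ℂ) * ∮ w in C((0 : ℂ), α),
        AF α (tT u τ₁ p T) (nT M a τ₁ p T - M) (xT M u a τ₁ p s₁ T + (nT M a τ₁ p T - M)) w *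
        BF α (tT u τ₂ p T) (nT M a τ₂ p T - M) (xT M u a τ₂ p s₂ T + (nT M a τ₂ p T - M)) (w - 1))))
      atTop (nhds (((k / α : ℝ) : ℂ) * -(if τ₁' < τ₂' then
      (((Real.sqrt (4 * π * (τ₂' - τ₁')))⁻¹ *
        Real.exp (-(σ₂ - σ₁) ^ 2 / (4 * (τ₂' - τ₁'))) : ℝ) : ℂ)
    else 0))) := by
  by_cases hτ : τ₁ < τ₂
  · rw [if_pos (hττ.mp hτ)]
    have hev := ind_ev2 M (a := a) (u := u) hp hτ
    have hdd : 0 < -(τ₁ * G) - -(τ₂ * G) := by nlinarith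
    have hne : ∀ᶠ T : ℝ in atTop,
        ¬(nT M a τ₁ p T = nT M a τ₂ p T ∧ tT u τ₁ p T = tT u τ₂ p T) := by
      have hl := (h1.hd.sub h2.hd).eventually (lt_mem_nhds hdd)
      filter_upwards [hl] with T hT h0
      simp only [h0.1, h0.2, sub_self, lt_self_iff_false] at hT
    have hQ : 0 < q₁ - q₂ := by
      have hq : q₁ - q₂ = (τ₂' - τ₁') / k ^ 2 := by
        rw [eq_div_iff (by positivity)]; linarith
      rw [hq]
      have := hττ.mp hτ
      exact div_pos (by linarith) (by positivity)
    have hl := phi_lim hα0 hα1 h1 h2 hdd hQ (hev.mono fun T h => h.2)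
      (hev.mono fun T h => by have := h.1; omega)
    have hl2 := (hl.const_mul ((2 * (π : ℂ) * I)⁻¹)).const_mul (-1 : ℂ)
    have hm := phi_match (α := α) x1 x2 x1' x2' hk hα0 (hττ.mp hτ)
    have hpi : (π : ℂ) ≠ 0 := by exact_mod_cast Real.pi_ne_zero
    have e : (-1 : ℂ) * ((2 * (π : ℂ) * I)⁻¹ * (I * ((Real.sqrt (π / ((q₁ - q₂) * α ^ 2)) *
        Real.exp (-(e₁ - e₂) ^ 2 / (4 * (q₁ - q₂))) : ℝ) : ℂ))) =
        ((k / α : ℝ) : ℂ) * -(((Real.sqrt (4 * π * (τ₂' - τ₁')))⁻¹ *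
        Real.exp (-(σ₂ - σ₁) ^ 2 / (4 * (τ₂' - τ₁'))) : ℝ) : ℂ) := by
      rw [mul_neg, ← Complex.ofReal_mul, ← hm]
      push_cast
      field_simp
    rw [← e]
    refine hl2.congr' ?_
    filter_upwards [hev, hne] with T h h'
    rw [if_pos ⟨h.1, h.2, h'⟩]
  · rw [if_neg (fun h => hτ (hττ.mpr h)), neg_zero, mul_zero]
    refine Tendsto.congr' ?_ tendsto_const_nhds
    filter_upwards [ind_ev M (a := a) (u := u) hp hτ] with T h
    rw [if_neg h, neg_zero, zero_mul]

theorem scale_alg {Z : ℂ} (hZ : Z ≠ 0) (j : ℕ) (A P X Y : ℂ) :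
    Z ^ (j + 1) * A * (P * ((Z ^ j)⁻¹ * X) + (Z ^ j)⁻¹ * Y) = Z * (A * (P * X + Y)) := by
  have : Z ^ j * (Z ^ j)⁻¹ = 1 := mul_inv_cancel₀ (pow_ne_zero _ hZ)
  linear_combination (Z * A * (P * X + Y)) * this

theorem main_lim (M : ℕ) {α u a p G τ₁ τ₂ s₁ s₂ : ℝ} (hα0 : 1 / 2 < α) (hα1 : α < 1)
    (hu : 0 < u) (hG0 : 0 < G)
    (hp : |p| ≤ 1) {e₁ q₁ e₂ q₂ σ₁ σ₂ τ₁' τ₂' k : ℝ}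
    (h1 : Reg atTop (fun T : ℝ => T ^ ((1 : ℝ) / 3)) (tT u τ₁ p) (fun T => nT M a τ₁ p T - M)
      (fun T => xT M u a τ₁ p s₁ T + (nT M a τ₁ p T - M)) α u (-(τ₁ * G)) e₁ q₁)
    (h2 : Reg atTop (fun T : ℝ => T ^ ((1 : ℝ) / 3)) (tT u τ₂ p) (fun T => nT M a τ₂ p T - M)
      (fun T => xT M u a τ₂ p s₂ T + (nT M a τ₂ p T - M)) α u (-(τ₂ * G)) e₂ q₂)
    (x1 : e₁ * k = σ₁) (x2 : q₁ * k ^ 2 = -τ₁') (x1' : e₂ * k = σ₂) (x2' : q₂ * k ^ 2 = -τ₂')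
    (x3 : u / (3 * α * (1 - α)) * k ^ 3 = 1 / 3)
    (hk : 0 < k) (hττ : τ₁ < τ₂ ↔ τ₁' < τ₂')
    {a1 a2 : ℝ} (ha12 : a1 < a2) (ha2 : a2 < 0)
    {r0 rv1 rw1 rv2 rz2 rw2 : ℝ}
    (g0 : 0 < r0) (g0' : r0 < 1) (gw1 : 0 < rw1) (gwv1 : rw1 < rv1)
    (gv1 : rv1 < (1 - α) / 4) (gv1' : rv1 < (2 * α - 1) / 4)
    (gz2 : 0 < rz2) (gzv2 : rz2 < rv2) (gw2 : 0 < rw2) (gwv2 : rw2 < rv2)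
    (gε1 : rv2 < (1 - α) / 4) (gε2 : rv2 < (2 * α - 1) / 4) :
    Tendsto (fun T : ℝ =>
          ((conjT M α u a τ₂ p s₂ T / conjT M α u a τ₁ p s₁ T : ℝ) : ℂ) *
            ((T ^ ((1 : ℝ) / 3) : ℝ) : ℂ) *
            Kker (M : ℤ) α (nT M a τ₁ p T) (nT M a τ₂ p T) (tT u τ₁ p T) (tT u τ₂ p T)
              (xT M u a τ₁ p s₁ T) (xT M u a τ₂ p s₂ T) r0 rv1 rw1 rv2 rz2 rw2)
        atTop
        (nhds (((k / α : ℝ) : ℂ) * (-(if τ₁' < τ₂' then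
      (((Real.sqrt (4 * π * (τ₂' - τ₁')))⁻¹ *
        Real.exp (-(σ₂ - σ₁) ^ 2 / (4 * (τ₂' - τ₁'))) : ℝ) : ℂ)
    else 0) +
  ((2 * (π : ℂ) * I)⁻¹) ^ 2 * wedgeR a2 (fun w₂ => wedgeL a1 (fun w₁ =>
    Complex.exp ((w₂ ^ 3 / 3 + (τ₂' : ℂ) * w₂ ^ 2 - (σ₂ : ℂ) * w₂) -
        (w₁ ^ 3 / 3 + (τ₁' : ℂ) * w₁ ^ 2 - (σ₁ : ℂ) * w₁)) *
      (w₁ / w₂) ^ M * (w₁ - w₂)⁻¹))))) := by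
  have hα : 0 < α := by linarith
  have hβ : 0 < 1 - α := by linarith
  have hpi : (π : ℂ) ≠ 0 := by exact_mod_cast Real.pi_ne_zero
  have hk' : (k : ℂ) ≠ 0 := by exact_mod_cast hk.ne'
  have hα' : (α : ℂ) ≠ 0 := by exact_mod_cast hα.ne'
  obtain ⟨b1, hb1L, hb1d⟩ := exists_b (|a1| + |a2| + (6 * |τ₁'| + 11)) (-(τ₁ * G))
    (c := 2 * u * k / (1 - α)) (by positivity)
  obtain ⟨b2, hb2L, hb2d⟩ := exists_b (|a1| + |a2| + (6 * |τ₂'| + 11)) (-(τ₂ * G) - 2 * q₂)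
    (c := 2 * u * k / (1 - (1 - α))) (by rw [sub_sub_cancel]; positivity)
  have n1 := abs_nonneg a1
  have n2 := abs_nonneg a2
  have n3 := abs_nonneg τ₁'
  have n4 := abs_nonneg τ₂'
  have n5 := neg_abs_le a2
  have hb10 : 0 < b1 := by linarith
  have hb20 : 0 < b2 := by linarith
  rw [double_wedge M ha12 ha2 (b1 := b1) (b2 := b2) (by linarith) (by linarith) (by linarith)
    (by linarith) (by linarith)]
  have hd1 : 0 < -(τ₁ * G) + 2 * u * (k * b1) / (1 - α) := by
    convert hb1d using 2; ring
  have hd2 : 0 < -(τ₂ * G) - 2 * q₂ + 2 * u * (k * b2) / (1 - (1 - α)) := by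
    convert hb2d using 2; ring
  have hkb1 : 0 < k * b1 := by positivity
  have hkb2 : 0 < k * b2 := by positivity
  have y2 : -q₂ * k ^ 2 = - -τ₂' := by linarith
  have y3 : u / (3 * (1 - α) * (1 - (1 - α))) * k ^ 3 = 1 / 3 := by
    rw [← x3, sub_sub_cancel]; congr 2; ring
  have L0 := ind_lim M hα hα1 hG0 hp h1 h2 x1 x2 x1' x2' hk hττ
  have L1 := K1_lim hα0 hα1 hu h1 h2.symm (k * b1) (k * b2) hkb1 hkb2 hd1 hd2
  rw [K1_match x1 x2 x3 x1' y2 y3 hk hα hβ] at L1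
  have La := fun j : ℕ => aj_lim hα hα1 hu h1 (k * b1) hd1 j
  simp only [aj_match x1 x2 x3 hk hα] at La
  have Lb := fun j : ℕ => bj_big_lim hα0 hα1 hu h2.symm (k * b2) hkb2 hd2
    (lt_trans gw2 gwv2) gε1 gε2 j
  simp only [big_match x1' y2 y3 hk hβ] at Lb
  have Lc := fun j : ℕ => bj_small_lim hα hα1 h2.symm hkb2 j
  simp only [small_match x1' y2 y3 hk] at Lc
  have L2 := tendsto_finsetSum (Finset.range M) fun j _ =>
    (La j).mul (((Lc j).const_mul (2 * (π : ℂ) * I)).add (Lb j))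
  have L := (L0.add (L1.const_mul (((2 * (π : ℂ) * I)⁻¹) ^ 2))).add
    (L2.const_mul (((2 * (π : ℂ) * I)⁻¹) ^ 3))
  have hval : ∀ X : ℂ, ((k / α : ℝ) : ℂ) * X + ((2 * (π : ℂ) * I)⁻¹) ^ 2 * -(k * (α : ℂ)⁻¹ * (I *
      ∫ y : ℝ, gE (-τ₂') σ₂ (-(b2 : ℂ) + I * y) * h0f τ₁' σ₁ b1 (-(b2 : ℂ) + I * y))) +
      ((2 * (π : ℂ) * I)⁻¹) ^ 3 * ∑ j ∈ Finset.range M,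
        (k * (α : ℂ)⁻¹ * (α * k) ^ j * AL τ₁' σ₁ b1 j *
          (2 * (π : ℂ) * I * (-(k * α * ((-(α * k) : ℂ) ^ (j + 1))⁻¹) *
            ∮ w in C(0, b2), gE (-τ₂') σ₂ w * (w ^ (j + 1))⁻¹) +
          -(2 * (π : ℂ) * I) * (k * α * ((-(α * k) : ℂ) ^ (j + 1))⁻¹) *
            (I * ∫ y : ℝ, gE (-τ₂') σ₂ (-(b2 : ℂ) + I * y) * ((-(b2 : ℂ) + I * y) ^ (j + 1))⁻¹))) =
      ((k / α : ℝ) : ℂ) * (X + ((2 * (π : ℂ) * I)⁻¹) ^ 2 *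
      -(I * (∫ y : ℝ, gE (-τ₂') σ₂ (-(b2 : ℂ) + I * y) * h0f τ₁' σ₁ b1 (-(b2 : ℂ) + I * y)) +
      ∑ j ∈ Finset.range M, AL τ₁' σ₁ b1 j * (-1) ^ (j + 1) * BL (-τ₂') σ₂ b2 j)) := by
    intro X
    have hs : ∀ j : ℕ, (k * (α : ℂ)⁻¹ * (α * k) ^ j * AL τ₁' σ₁ b1 j *
          (2 * (π : ℂ) * I * (-(k * α * ((-(α * k) : ℂ) ^ (j + 1))⁻¹) *
            ∮ w in C(0, b2), gE (-τ₂') σ₂ w * (w ^ (j + 1))⁻¹) +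
          -(2 * (π : ℂ) * I) * (k * α * ((-(α * k) : ℂ) ^ (j + 1))⁻¹) *
            (I * ∫ y : ℝ, gE (-τ₂') σ₂ (-(b2 : ℂ) + I * y) * ((-(b2 : ℂ) + I * y) ^ (j + 1))⁻¹))) =
        -(2 * (π : ℂ) * I) * (k * (α : ℂ)⁻¹) *
          (AL τ₁' σ₁ b1 j * (-1) ^ (j + 1) * BL (-τ₂') σ₂ b2 j) := by
      intro j
      have e : ((α * k : ℂ)) ^ j * (k * α * ((-(α * k) : ℂ) ^ (j + 1))⁻¹) = (-1) ^ (j + 1) := by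
        rw [neg_pow, mul_inv, ← inv_pow, inv_neg, inv_one, pow_succ (α * k : ℂ) j]
        field_simp
      rw [BL, ← e]
      ring
    simp only [hs]
    rw [← Finset.mul_sum]
    push_cast
    field_simp
    ring
  rw [hval] at L
  refine L.congr' ?_
  have hSt := h1.hS
  have hS1 := (Tendsto.const_div_atTop hSt (k * b1)).eventually
    (gt_mem_nhds (show (0 : ℝ) < (2 * α - 1) / 4 by linarith))
  have hS2 := (Tendsto.const_div_atTop hSt (k * b2)).eventually
    (gt_mem_nhds (show (0 : ℝ) < 1 - α by linarith))
  filter_upwards [hS1, hS2, hSt.eventually (eventually_gt_atTop 0)] with T c1 c2 c3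
  have c4 : 0 < k * b1 / T ^ ((1 : ℝ) / 3) := div_pos hkb1 c3
  have c5 : 0 < k * b2 / T ^ ((1 : ℝ) / 3) := div_pos hkb2 c3
  have hS' : ((T ^ ((1 : ℝ) / 3) : ℝ) : ℂ) ≠ 0 := by exact_mod_cast c3.ne'
  rw [conj_cnj, conj_cnj]
  refine Eq.trans ?_ ((show ∀ x y z : ℂ, y * (x * z) = x * y * z from fun x y z => by ring) _ _ _)
  rw [Kker_exact hα0 hα1 M (nT M a τ₁ p T) (nT M a τ₂ p T) (tT u τ₁ p T) (tT u τ₂ p T)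
      (xT M u a τ₁ p s₁ T) (xT M u a τ₂ p s₂ T) (r1 := α - k * b1 / T ^ ((1 : ℝ) / 3))
      (r2 := 1 - α - k * b2 / T ^ ((1 : ℝ) / 3)) (ρ := k * b2 / T ^ ((1 : ℝ) / 3))
      g0 g0' gw1 gwv1 (by linarith) (by linarith) (by linarith) gz2 gzv2 gw2 gwv2 gε1 gε2
      (by linarith) (by linarith) (by linarith) (by linarith) c5 c2 rfl rfl rfl rfl]
  rw [mul_add, mul_add]
  congr 1
  · congr 1
    · ring
    · ring
  · refine Eq.trans ?_ (mul_left_comm _ _ _)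
    congr 1
    rw [Finset.mul_sum]
    refine Finset.sum_congr rfl fun j _ => ?_
    rw [bjI]
    exact scale_alg hS' j _ _ _ _

/-- Convergence of the conjugated rescaled TASEP kernel to the kernel `K_{DBM→2}`
along the curve `n ≈ (1-α)² t`, for `α ∈ (1/2, 1)`. -/
theorem DBM_to_Airy2_transition_limit
    (M : ℕ) (hM : 1 ≤ M) (α : ℝ) (hα0 : 1 / 2 < α) (hα1 : α < 1)
    (θ : ℝ) (hθ : 0 < θ)
    (pf : ℝ → ℝ) (hpf : ContDiff ℝ 1 pf) (hpf' : ∀ x, |deriv pf x| ≤ 1)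
    (hπθ : pf θ = θ * (2 - 2 * α + α ^ 2) / (α * (2 - α)))
    (p : ℝ) (hp : p = deriv pf θ)
    (u a : ℝ) (hu : u = 2 * θ / (α * (2 - α))) (ha : a = 2 * θ * (1 - α) ^ 2 / (α * (2 - α)))
    (Sv Sh : ℝ) (hSv : Sv = (2 * θ * α / ((1 - α) * (2 - α))) ^ ((1 : ℝ) / 3))
    (hSh : Sh = (2 / α) * Sv ^ 2 / (1 + p + (1 - p) / (1 - α) ^ 2))
    (τ₁ τ₂ s₁ s₂ : ℝ)
    (a1 a2 : ℝ) (ha12 : a1 < a2) (ha2 : a2 < 0) :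
    ∃ ε > 0, ∀ r0 rv1 rw1 rv2 rz2 rw2 : ℝ,
      0 < r0 → r0 < ε → 0 < rw1 → rw1 < rv1 → rv1 < ε →
      0 < rz2 → rz2 < rv2 → 0 < rw2 → rw2 < rv2 → rv2 < ε →
      Tendsto (fun T : ℝ =>
          ((conjT M α u a τ₂ p s₂ T / conjT M α u a τ₁ p s₁ T : ℝ) : ℂ) *
            ((T ^ ((1 : ℝ) / 3) : ℝ) : ℂ) *
            Kker (M : ℤ) α (nT M a τ₁ p T) (nT M a τ₂ p T) (tT u τ₁ p T) (tT u τ₂ p T)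
              (xT M u a τ₁ p s₁ T) (xT M u a τ₂ p s₂ T) r0 rv1 rw1 rv2 rz2 rw2)
        atTop
        (nhds (((Sv⁻¹ : ℝ) : ℂ) *
          KDBM2 M (τ₁ / Sh) (s₁ / Sv) (τ₂ / Sh) (s₂ / Sv) a1 a2)) := by
  have hα : 0 < α := by linarith
  have hβ : 0 < 1 - α := by linarith
  have hγ : 0 < 2 - α := by linarith
  have hp1 : |p| ≤ 1 := by rw [hp]; exact hpf' θ
  have hu0 : 0 < u := by rw [hu]; positivity
  have hau : a = (1 - α) ^ 2 * u := by rw [ha, hu]; ring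
  have hbase : 0 < 2 * θ * α / ((1 - α) * (2 - α)) := by positivity
  have hSv0 : 0 < Sv := by rw [hSv]; exact Real.rpow_pos_of_pos hbase _
  have hSv3 : Sv ^ 3 = α ^ 2 * u / (1 - α) := by
    rw [hSv, ← Real.rpow_natCast, ← Real.rpow_mul hbase.le]
    norm_num
    rw [hu]
    field_simp
  obtain ⟨hpl, hpr⟩ := abs_le.mp hp1
  have hG0 : 0 < 1 + p + (1 - p) / (1 - α) ^ 2 := by
    have h1 : 1 - p ≤ (1 - p) / (1 - α) ^ 2 := by
      rw [le_div_iff₀ (by positivity)]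
      have : (1 - α) ^ 2 ≤ 1 := by nlinarith
      nlinarith
    linarith
  set G := 1 + p + (1 - p) / (1 - α) ^ 2 with hG
  have hSh0 : 0 < Sh := by rw [hSh]; positivity
  have hk : 0 < α / Sv := by positivity
  have hkα : Sv⁻¹ = (α / Sv) / α := by field_simp
  have hq : ∀ τ : ℝ, -(τ * G) / (2 * α) * (α / Sv) ^ 2 = -(τ / Sh) := by
    intro τ
    rw [hSh]
    field_simp
  have he : ∀ τ s : ℝ, (s / α - (-(τ * G)) ^ 2 * (1 - α) / (4 * u * α)) * (α / Sv) =
      s / Sv - (τ / Sh) ^ 2 := by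
    intro τ s
    have h4 : Sv ^ 4 = α ^ 2 * u / (1 - α) * Sv := by rw [← hSv3]; ring
    have : (τ / Sh) ^ 2 = τ ^ 2 * G ^ 2 * α ^ 2 / (4 * Sv ^ 4) := by
      rw [hSh]
      field_simp
      norm_num
    rw [this, h4]
    field_simp
  have hc : u / (3 * α * (1 - α)) * (α / Sv) ^ 3 = 1 / 3 := by
    rw [div_pow, hSv3]
    field_simp
  refine ⟨min ((1 - α) / 4) ((2 * α - 1) / 4), lt_min (by linarith) (by linarith), ?_⟩
  intro r0 rv1 rw1 rv2 rz2 rw2 g0 g0' gw1 gwv1 gv1 gz2 gzv2 gw2 gwv2 gv2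
  rw [lt_min_iff] at g0' gv1 gv2
  unfold KDBM2
  rw [hkα]
  exact main_lim M hα0 hα1 hu0 hG0 hp1 (reg_T M τ₁ s₁ hα hα1 hu0 hau hG)
    (reg_T M τ₂ s₂ hα hα1 hu0 hau hG) (he τ₁ s₁) (hq τ₁) (he τ₂ s₂) (hq τ₂) hc hk
    (div_lt_div_iff_of_pos_right hSh0).symm ha12 ha2 g0 (by linarith [g0'.1]) gw1 gwv1 gv1.1 gv1.2
    gz2 gzv2 gw2 gwv2 gv2.1 gv2.2
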